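/- arXiv:0901.3449 — 2 statements merged into one kernel-verified Lean document; each statement's English description precedes it below -/
import Mathlib

section
/- (Asymptotic shape theorem.) Let d ≥ 1, let T be an ergodic measure-preserving ℤ^d-action on a probability space (X,μ), and let ρ be a random ℤ^d-semimetric modeled on (X,μ,T). Assume that for every n ∈ ℤ^d the function x ↦ ρ_x(0,n) satisfies ∫₀^∞ (μ{x : ρ_x(0,n) > s})^{1/d} ds < ∞ (i.e., ρ(0,n) lies in the Lorentz space L^{d,1}(X,μ)). Then there exists a seminorm L on ℝ^d such that for μ-almost every x ∈ X, (ρ_x(0,n) − L(n))/|n| → 0 as |n| → ∞; that is, for every ε > 0 there are only finitely many n ∈ ℤ^d with |ρ_x(0,n) − L(n)| ≥ ε|n|. -/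
open MeasureTheory

namespace AsymptoticShape

open Filter Topology
open scoped ENNReal

section

variable {X : Type*} [MeasurableSpace X] {d : ℕ}

/-- An ergodic measure-preserving action of `ℤ^d`. -/
structure IsErgodicAction (μ : Measure X) (T : (Fin d → ℤ) → X → X) : Prop where
  zero : T 0 = id
  add : ∀ n m, T (n + m) = T n ∘ T m
  mp : ∀ n, MeasurePreserving (T n) μ μ
  erg : ∀ A : Set X, MeasurableSet A → (∀ n, T n ⁻¹' A = A) → μ A = 0 ∨ μ A = 1

/-- A random semimetric on `ℤ^d` which is equivariant under the action `T`. -/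
structure IsRandomSemimetric (T : (Fin d → ℤ) → X → X)
    (ρ : X → (Fin d → ℤ) → (Fin d → ℤ) → ℝ) : Prop where
  nonneg : ∀ x m n, 0 ≤ ρ x m n
  symm : ∀ x m n, ρ x m n = ρ x n m
  refl : ∀ x m, ρ x m m = 0
  tri : ∀ x m k n, ρ x m n ≤ ρ x m k + ρ x k n
  equiv : ∀ x k m n, ρ (T k x) m n = ρ x (m + k) (n + k)
  meas : ∀ m n, Measurable fun x => ρ x m n

/-- The cube of radius `R` centred at the origin of `ℤ^d`. -/
noncomputable def cube (d R : ℕ) : Finset (Fin d → ℤ) := Finset.Icc (fun _ => -(R : ℤ)) (fun _ => (R : ℤ))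

theorem mem_cube {R : ℕ} {p : Fin d → ℤ} : p ∈ cube d R ↔ ∀ k, |p k| ≤ R := by
  simp only [cube, Finset.mem_Icc, Pi.le_def, abs_le]
  exact ⟨fun h k => ⟨h.1 k, h.2 k⟩, fun h => ⟨fun k => (h k).1, fun k => (h k).2⟩⟩

theorem card_cube (R : ℕ) : (cube d R).card = (2 * R + 1) ^ d := by
  simp only [cube, Pi.card_Icc, Int.card_Icc, Finset.prod_const, Finset.card_univ,
    Fintype.card_fin]
  congr 1
  omega

theorem exists_mem_cube (p : Fin d → ℤ) : ∃ R : ℕ, p ∈ cube d R := by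
  refine ⟨∑ k, (p k).natAbs, mem_cube.2 fun k => ?_⟩
  rw [Int.abs_eq_natAbs]
  exact_mod_cast Finset.single_le_sum (f := fun k => (p k).natAbs)
    (fun _ _ => Nat.zero_le _) (Finset.mem_univ k)

namespace IsErgodicAction

variable {μ : Measure X} {T : (Fin d → ℤ) → X → X}

theorem apply_add (hT : IsErgodicAction μ T) (n m : Fin d → ℤ) (x : X) :
    T n (T m x) = T (n + m) x := by
  rw [hT.add]; rfl

/-- Almost every orbit of an ergodic action visits a given non-null set. -/
theorem ae_exists_mem [IsProbabilityMeasure μ] (hT : IsErgodicAction μ T) {W : Set X}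
    (hW : MeasurableSet W) (h0 : μ W ≠ 0) : ∀ᵐ x ∂μ, ∃ m, T m x ∈ W := by
  have hm : MeasurableSet {x | ∃ m, T m x ∈ W} := by
    rw [Set.ofPred_exists]
    exact MeasurableSet.iUnion fun m => (hT.mp m).measurable hW
  have hinv : ∀ n, T n ⁻¹' {x | ∃ m, T m x ∈ W} = {x | ∃ m, T m x ∈ W} := by
    intro n
    ext x
    simp only [Set.mem_preimage, Set.mem_ofPred_eq, hT.apply_add]
    constructor
    · rintro ⟨m, hm⟩
      exact ⟨m + n, hm⟩
    · rintro ⟨m, hm⟩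
      exact ⟨m - n, by simpa using hm⟩
  rcases hT.erg _ hm hinv with h | h
  · refine absurd (measure_mono_null (fun x hx => ?_) h) h0
    exact ⟨0, by simpa [hT.zero] using hx⟩
  · exact (prob_compl_eq_zero_iff hm).2 h

theorem lintegral_comp (hT : IsErgodicAction μ T) {G : X → ℝ≥0∞} (hG : Measurable G)
    (n : Fin d → ℤ) : ∫⁻ x, G (T n x) ∂μ = ∫⁻ x, G x ∂μ :=
  (hT.mp n).lintegral_comp hG

end IsErgodicAction

/-- A Vitali covering bound for the points of a finite subset of `ℤ^d` around which some cube
carries a large amount of mass. -/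
theorem card_le_of_cube_mass (g : (Fin d → ℤ) → ℝ≥0∞) (l : ℝ≥0∞) (K : ℕ)
    (D : Finset (Fin d → ℤ)) (hDK : D ⊆ cube d K)
    (hD : ∀ p ∈ D, ∃ R ≤ K, l * (cube d R).card ≤ ∑ w ∈ cube d R, g (w + p)) :
    l * D.card ≤ 3 ^ d * ∑ w ∈ cube d (2 * K), g w := by
  classical
  choose! r hrK hr using hD
  let B : (Fin d → ℤ) → Finset (Fin d → ℤ) := fun p => (cube d (r p)).map (addRightEmbedding p)
  have hBmem : ∀ p w, w ∈ B p ↔ ∀ k, |w k - p k| ≤ r p := by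
    intro p w
    simp only [B, Finset.mem_map, addRightEmbedding_apply]
    constructor
    · rintro ⟨a, ha, rfl⟩ k
      simpa using mem_cube.1 ha k
    · intro h
      exact ⟨w - p, mem_cube.2 h, by simp⟩
  obtain ⟨u, huD, hdisj, hcov⟩ := Vitali.exists_disjoint_subfamily_covering_enlargement
    (fun p => (B p : Set (Fin d → ℤ))) (D : Set (Fin d → ℤ)) (fun p => (r p : ℝ)) 2 one_lt_two
    (fun _ _ => Nat.cast_nonneg _) K (fun p hp => by exact_mod_cast hrK p hp)
    (fun p _ => ⟨p, by simp [hBmem]⟩)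
  lift u to Finset (Fin d → ℤ) using D.finite_toSet.subset huD
  have huD' : u ⊆ D := by exact_mod_cast huD
  have hsub : D ⊆ u.biUnion fun b => (cube d (3 * r b)).map (addRightEmbedding b) := by
    intro p hp
    obtain ⟨b, hb, ⟨w, hwp, hwb⟩, hle⟩ := hcov p hp
    have hle' : r p ≤ 2 * r b := by exact_mod_cast hle
    refine Finset.mem_biUnion.2 ⟨b, hb, Finset.mem_map.2 ⟨p - b, mem_cube.2 fun k => ?_, by simp⟩⟩
    have h1 := (hBmem p w).1 hwp k
    have h2 := (hBmem b w).1 hwb k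
    simp only [Pi.sub_apply]
    rw [abs_le] at *
    push_cast
    constructor <;> omega
  have hcard : D.card ≤ ∑ b ∈ u, 3 ^ d * (cube d (r b)).card := by
    refine (Finset.card_le_card hsub).trans (Finset.card_biUnion_le.trans ?_)
    refine Finset.sum_le_sum fun b _ => ?_
    rw [Finset.card_map, card_cube, card_cube, ← mul_pow]
    exact Nat.pow_le_pow_left (by omega) d
  calc l * D.card ≤ l * (∑ b ∈ u, 3 ^ d * (cube d (r b)).card : ℕ) := by gcongr
    _ = 3 ^ d * ∑ b ∈ u, l * (cube d (r b)).card := by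
        push_cast
        rw [Finset.mul_sum, Finset.mul_sum]
        exact Finset.sum_congr rfl fun _ _ => by ring
    _ ≤ 3 ^ d * ∑ b ∈ u, ∑ w ∈ B b, g w := by
        gcongr with b hb
        simpa [B, Finset.sum_map] using hr b (huD' hb)
    _ = 3 ^ d * ∑ w ∈ u.biUnion B, g w := by
        rw [Finset.sum_biUnion]
        intro a ha b hb hab
        exact Finset.disjoint_coe.1 (hdisj ha hb hab)
    _ ≤ 3 ^ d * ∑ w ∈ cube d (2 * K), g w := by
        gcongr
        refine Finset.biUnion_subset.2 fun b hb w hw => mem_cube.2 fun k => ?_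
        have h1 := (hBmem b w).1 hw k
        have h2 := mem_cube.1 (hDK (huD' hb)) k
        have h3 := hrK b (huD' hb)
        rw [abs_le] at *
        push_cast
        constructor <;> omega

namespace IsErgodicAction

variable {μ : Measure X} {T : (Fin d → ℤ) → X → X}

/-- Wiener's weak type `(1, 1)` maximal inequality over cubes of bounded radius. -/
theorem maximal_inequality_of_le (hT : IsErgodicAction μ T) {G : X → ℝ≥0∞} (hG : Measurable G)
    (l : ℝ≥0∞) (K : ℕ) :
    l * μ {x | ∃ R ≤ K, l * (cube d R).card ≤ ∑ w ∈ cube d R, G (T w x)}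
      ≤ 6 ^ d * ∫⁻ x, G x ∂μ := by
  classical
  set E : Set X := {x | ∃ R ≤ K, l * (cube d R).card ≤ ∑ w ∈ cube d R, G (T w x)} with hE
  have hsum : ∀ R, Measurable fun x => ∑ w ∈ cube d R, G (T w x) := fun R =>
    Finset.measurable_fun_sum _ fun w _ => hG.comp (hT.mp w).measurable
  have hEm : MeasurableSet E := by
    simp only [hE, Set.ofPred_exists, Set.ofPred_and]
    exact MeasurableSet.iUnion fun R => (MeasurableSet.const _).inter
      (measurableSet_le measurable_const (hsum R))
  have hpt : ∀ x, l * ∑ p ∈ cube d K, E.indicator 1 (T p x)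
      ≤ 3 ^ d * ∑ w ∈ cube d (2 * K), G (T w x) := by
    intro x
    have := card_le_of_cube_mass (fun w => G (T w x)) l K ((cube d K).filter fun p => T p x ∈ E)
      (Finset.filter_subset _ _) (by
        intro p hp
        obtain ⟨R, hR, h⟩ := (Finset.mem_filter.1 hp).2
        exact ⟨R, hR, by simpa [hT.apply_add] using h⟩)
    refine le_trans (le_of_eq ?_) this
    rw [Finset.natCast_card_filter]
    simp only [Set.indicator_apply, Pi.one_apply]
  have hh_int := lintegral_mono (μ := μ) hpt
  have hind : ∀ p, Measurable fun x => E.indicator (1 : X → ℝ≥0∞) (T p x) := fun p =>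
    (measurable_one.indicator hEm).comp (hT.mp p).measurable
  rw [lintegral_const_mul _ (Finset.measurable_fun_sum _ fun p _ => hind p),
    lintegral_const_mul _ (hsum _), lintegral_finsetSum _ fun p _ => hind p,
    lintegral_finsetSum (f := fun w x => G (T w x)) _
      fun w _ => hG.comp (hT.mp w).measurable] at hh_int
  simp only [hT.lintegral_comp hG, hT.lintegral_comp (measurable_one.indicator hEm),
    lintegral_indicator_one hEm, Finset.sum_const, nsmul_eq_mul] at hh_int
  have hc : ((cube d (2 * K)).card : ℝ≥0∞) ≤ 2 ^ d * (cube d K).card := by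
    rw [card_cube, card_cube]
    norm_cast
    rw [← mul_pow]
    exact Nat.pow_le_pow_left (by omega) d
  have hpos : ((cube d K).card : ℝ≥0∞) ≠ 0 := by rw [card_cube]; positivity
  rw [← ENNReal.mul_le_mul_iff_right hpos (ENNReal.natCast_ne_top _)]
  calc ((cube d K).card : ℝ≥0∞) * (l * μ E) = l * ((cube d K).card * μ E) := by ring
    _ ≤ 3 ^ d * ((cube d (2 * K)).card * ∫⁻ x, G x ∂μ) := hh_int
    _ ≤ 3 ^ d * (2 ^ d * (cube d K).card * ∫⁻ x, G x ∂μ) := by gcongr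
    _ = (cube d K).card * (6 ^ d * ∫⁻ x, G x ∂μ) := by
        rw [show (6 : ℝ≥0∞) = 3 * 2 by norm_num, mul_pow]; ring

/-- The averages over large cubes are controlled by the integral. -/
theorem ae_eventually_cube_average_le [IsProbabilityMeasure μ] (hT : IsErgodicAction μ T)
    {G : X → ℝ≥0∞} (hG : Measurable G) {c : ℝ≥0∞} (hc : ∫⁻ x, G x ∂μ < c) :
    ∀ᵐ x ∂μ, ∀ᶠ R : ℕ in atTop,
      ∑ w ∈ cube d R, G (T w x) ≤ 12 ^ d * c * (cube d R).card := by
  set l : ℝ≥0∞ := 6 ^ d * c with hl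
  have hc0 : c ≠ 0 := (bot_le.trans_lt hc).ne'
  have hsum : ∀ R, Measurable fun x => ∑ w ∈ cube d R, G (T w x) := fun R =>
    Finset.measurable_fun_sum _ fun w _ => hG.comp (hT.mp w).measurable
  set F : ℕ → Set X := fun K => {x | ∃ R ≤ K, l * (cube d R).card ≤ ∑ w ∈ cube d R, G (T w x)}
    with hF
  have hFm : ∀ K, MeasurableSet (F K) := by
    intro K
    simp only [hF, Set.ofPred_exists, Set.ofPred_and]
    exact MeasurableSet.iUnion fun R => (MeasurableSet.const _).inter
      (measurableSet_le measurable_const (hsum R))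
  have hbound : l * μ (⋃ K, F K) < l * 1 := by
    have hmono : Monotone F := fun a b hab x ⟨R, hR, h⟩ => ⟨R, hR.trans hab, h⟩
    rw [hmono.measure_iUnion, ENNReal.mul_iSup]
    refine (iSup_le fun K => hT.maximal_inequality_of_le hG l K).trans_lt ?_
    rw [mul_one, hl]
    exact ENNReal.mul_lt_mul_right (by positivity) (by finiteness) hc
  have hlt : μ (⋃ K, F K) ≠ 1 := fun h => by rw [h] at hbound; exact lt_irrefl _ hbound
  have hne : μ (⋃ K, F K)ᶜ ≠ 0 := fun h =>
    hlt ((prob_compl_eq_zero_iff (MeasurableSet.iUnion hFm)).1 h)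
  filter_upwards [hT.ae_exists_mem (MeasurableSet.iUnion hFm).compl hne] with x ⟨m, hm⟩
  obtain ⟨M, hM⟩ := exists_mem_cube m
  have hall : ∀ R, ∑ w ∈ cube d R, G (T (w + m) x) ≤ l * (cube d R).card := by
    intro R
    by_contra! hcon
    refine hm (Set.mem_iUnion.2 ⟨R, R, le_rfl, ?_⟩)
    simpa [hT.apply_add] using hcon.le
  filter_upwards [eventually_ge_atTop M] with R hR
  calc ∑ w ∈ cube d R, G (T w x)
      ≤ ∑ w ∈ (cube d (R + M)).map (addRightEmbedding m), G (T w x) := by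
        refine Finset.sum_le_sum_of_subset fun w hw => ?_
        refine Finset.mem_map.2 ⟨w - m, mem_cube.2 fun k => ?_, by simp⟩
        have h1 := mem_cube.1 hw k
        have h2 := mem_cube.1 hM k
        simp only [Pi.sub_apply]
        rw [abs_le] at *
        push_cast
        constructor <;> omega
    _ = ∑ w ∈ cube d (R + M), G (T (w + m) x) := by simp [Finset.sum_map]
    _ ≤ l * (cube d (R + M)).card := hall _
    _ ≤ l * (2 ^ d * (cube d R).card) := by
        gcongr
        rw [card_cube, card_cube]
        norm_cast
        rw [← mul_pow]
        exact Nat.pow_le_pow_left (by omega) d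
    _ = 12 ^ d * c * (cube d R).card := by
        rw [hl, show (12 : ℝ≥0∞) = 6 * 2 by norm_num, mul_pow]; ring

end IsErgodicAction

end

section

variable {X : Type*}

/-- Majorant of a subadditive process `g` with `h = (g 1)⁺`: a sum of `h` along an orbit segment,
restricted to the visits to `B` and to the last `K` steps. -/
noncomputable def majorant (τ : X → X) (h : X → ℝ) (B : Set X) (K : ℕ) : ℕ → X → ℝ
  | 0, _ => 0
  | n + 1, x => B.indicator h x + (if n + 1 ≤ K then h x else 0) + majorant τ h B K n (τ x)

theorem majorant_iterate_le {τ : X → X} {h : X → ℝ} (hh : ∀ x, 0 ≤ h x) (B : Set X)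
    (K n k : ℕ) (x : X) : majorant τ h B K n (τ^[k] x) ≤ majorant τ h B K (n + k) x := by
  induction k generalizing x with
  | zero => exact le_rfl
  | succ k ih =>
    have h1 : 0 ≤ B.indicator h x := Set.indicator_nonneg (fun y _ => hh y) x
    have h2 : (0 : ℝ) ≤ if n + k + 1 ≤ K then h x else 0 := by split_ifs <;> simp [hh]
    have := ih (τ x)
    rw [← add_assoc, Function.iterate_succ_apply]
    simp only [majorant]
    linarith

theorem integrable_majorant [MeasurableSpace X] {μ : Measure X} {τ : X → X} (hτ : MeasurePreserving τ μ μ)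
    {h : X → ℝ} (hh_int : Integrable h μ) {B : Set X} (hB : MeasurableSet B) (K n : ℕ) :
    Integrable (majorant τ h B K n) μ := by
  induction n with
  | zero => exact integrable_zero _ _ _
  | succ n ih =>
    refine ((hh_int.indicator hB).add ?_).add (hτ.integrable_comp_of_integrable ih)
    split_ifs
    exacts [hh_int, integrable_zero _ _ _]

theorem integral_majorant_le [MeasurableSpace X] {μ : Measure X} {τ : X → X} (hτ : MeasurePreserving τ μ μ)
    {h : X → ℝ} (hh_int : Integrable h μ) {B : Set X} (hB : MeasurableSet B) (K n : ℕ) :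
    ∫ x, majorant τ h B K n x ∂μ = n * ∫ x in B, h x ∂μ + (min n K : ℕ) * ∫ x, h x ∂μ := by
  induction n with
  | zero => simp [majorant]
  | succ n ih =>
    have hi : Integrable (fun x => if n + 1 ≤ K then h x else 0) μ := by
      split_ifs
      exacts [hh_int, integrable_zero _ _ _]
    have hM := integrable_majorant hτ hh_int hB K n
    have hcomp : ∫ x, majorant τ h B K n (τ x) ∂μ = ∫ x, majorant τ h B K n x ∂μ := by
      conv_rhs => rw [← hτ.map_eq]
      rw [integral_map hτ.aemeasurable]
      rw [hτ.map_eq]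
      exact hM.aestronglyMeasurable
    simp only [majorant]
    rw [integral_add (f := fun x => B.indicator h x + if n + 1 ≤ K then h x else 0)
        ((hh_int.indicator hB).add hi) (g := fun x => majorant τ h B K n (τ x)) (hτ.integrable_comp_of_integrable hM),
      integral_add (hh_int.indicator hB) hi, hcomp, ih, integral_indicator hB]
    by_cases hn : n + 1 ≤ K
    · simp only [hn, if_true, min_eq_left, (Nat.le_succ n).trans hn]
      push_cast; ring
    · simp only [hn, if_false, integral_zero, min_eq_right (show K ≤ n by omega),
        min_eq_right (show K ≤ n + 1 by omega)]
      push_cast; ring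

/-- A stationary subadditive process which almost surely takes a nonpositive value at some
positive time has nonpositive mean growth rate. -/
theorem integral_le_of_subadditive [MeasurableSpace X] {μ : Measure X} {τ : X → X}
    (hτ : MeasurePreserving τ μ μ) {g : ℕ → X → ℝ} (hgm : ∀ k, Measurable (g k))
    (hgi : ∀ k, Integrable (g k) μ) (h0 : ∀ x, g 0 x = 0)
    (hsub : ∀ k l x, g (k + l) x ≤ g k x + g l (τ^[k] x))
    (hneg : ∀ᵐ x ∂μ, ∃ k, 1 ≤ k ∧ g k x ≤ 0) {ε : ℝ} (hε : 0 < ε) :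
    ∃ C : ℝ, ∀ n : ℕ, ∫ x, g n x ∂μ ≤ n * ε + C := by
  set h : X → ℝ := fun x => max (g 1 x) 0 with hh
  have hh0 : ∀ x, 0 ≤ h x := fun x => le_max_right _ _
  have hhi : Integrable h μ := (hgi 1).pos_part
  set B : ℕ → Set X := fun K => {x | ∀ k, 1 ≤ k → k ≤ K → 0 < g k x} with hBdef
  have hB : ∀ K, MeasurableSet (B K) := by
    intro K
    simp only [hBdef, Set.ofPred_forall]
    exact MeasurableSet.iInter fun k => MeasurableSet.iInter fun _ => MeasurableSet.iInter fun _ =>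
      measurableSet_lt measurable_const (hgm k)
  have hanti : Antitone B := fun a b hab x hx k h1 h2 => hx k h1 (h2.trans hab)
  have hlim : Tendsto (fun K => ∫ x in B K, h x ∂μ) atTop (𝓝 0) := by
    have := tendsto_setIntegral_of_antitone hB hanti ⟨0, hhi.integrableOn⟩ (f := h) (μ := μ)
    have hz : μ (⋂ n, B n) = 0 := by
      refine measure_mono_null (fun x hx => ?_) hneg
      simp only [Set.mem_iInter] at hx
      rintro ⟨k, hk, hgk⟩
      exact absurd (hx k k hk le_rfl) hgk.not_gt
    rwa [setIntegral_measure_zero _ hz] at this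
  obtain ⟨K, hK⟩ := (hlim.eventually_lt_const hε).exists
  have hpt : ∀ n x, g n x ≤ majorant τ h (B K) K n x := by
    intro n
    induction n using Nat.strong_induction_on with
    | _ n ih =>
      intro x
      rcases Nat.eq_zero_or_pos n with rfl | hn
      · simp [majorant, h0]
      obtain ⟨m, rfl⟩ : ∃ m, n = m + 1 := ⟨n - 1, by omega⟩
      have hi : 0 ≤ (B K).indicator h x := Set.indicator_nonneg (fun y _ => hh0 y) x
      have hj : (0 : ℝ) ≤ if m + 1 ≤ K then h x else 0 := by split_ifs <;> simp [hh0]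
      by_cases hcase : m + 1 ≤ K ∨ x ∈ B K
      · have h1 : g (m + 1) x ≤ g 1 x + g m (τ x) := by
          simpa [add_comm] using hsub 1 m x
        have h2 := ih m (by omega) (τ x)
        have h3 : g 1 x ≤ h x := le_max_left _ _
        have h4 : h x ≤ (B K).indicator h x + if m + 1 ≤ K then h x else 0 := by
          rcases hcase with hc | hc
          · rw [if_pos hc]; linarith
          · rw [Set.indicator_of_mem hc]; linarith
        simp only [majorant]
        linarith
      · push Not at hcase
        obtain ⟨hc, hxB⟩ := hcase
        simp only [hBdef, Set.mem_ofPred_eq, not_forall, not_lt] at hxB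
        obtain ⟨k, hk1, hkK, hgk⟩ := hxB
        have hm : m + 1 = k + (m + 1 - k) := by omega
        have h1 := hsub k (m + 1 - k) x
        rw [← hm] at h1
        have h2 := ih (m + 1 - k) (by omega) (τ^[k] x)
        have h3 := majorant_iterate_le (τ := τ) hh0 (B K) K (m + 1 - k) k x
        rw [show m + 1 - k + k = m + 1 by omega] at h3
        linarith
  refine ⟨K * ∫ x, h x ∂μ, fun n => ?_⟩
  refine (integral_mono (hgi n) (integrable_majorant hτ hhi (hB K) K n) (hpt n)).trans ?_
  rw [integral_majorant_le hτ hhi (hB K)]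
  have : 0 ≤ ∫ x, h x ∂μ := integral_nonneg hh0
  gcongr
  exact min_le_right _ _

end

section

variable {d : ℕ}

/-- A symmetric subadditive function on `ℤ^d` grows at most linearly. -/
theorem exists_linear_bound {m : (Fin d → ℤ) → ℝ} (h0 : m 0 = 0)
    (hneg : ∀ n, m (-n) = m n) (hadd : ∀ n k, m (n + k) ≤ m n + m k) :
    ∃ C : ℝ, 0 ≤ C ∧ ∀ n, m n ≤ C * ∑ k, |(n k : ℝ)| := by
  have hnonneg : ∀ n, 0 ≤ m n := fun n => by
    have := hadd n (-n)
    rw [add_neg_cancel, h0, hneg] at this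
    linarith
  have hnat : ∀ (a : ℕ) n, m (a • n) ≤ a * m n := by
    intro a n
    induction a with
    | zero => simp [h0]
    | succ a ih =>
      rw [succ_nsmul]
      push_cast
      linarith [hadd (a • n) n]
  have hh_int : ∀ (a : ℤ) n, m (a • n) ≤ |(a : ℝ)| * m n := by
    intro a n
    have hcast : |(a : ℝ)| = (a.natAbs : ℝ) := by
      rw [← Int.cast_abs, Int.abs_eq_natAbs]; simp
    rw [hcast]
    rcases Int.natAbs_eq a with h | h
    · conv_lhs => rw [h]
      simpa using hnat a.natAbs n
    · conv_lhs => rw [h]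
      simpa [hneg] using hnat a.natAbs n
  refine ⟨∑ k, m (Pi.single k 1), Finset.sum_nonneg fun k _ => hnonneg _, fun n => ?_⟩
  have hdecomp : n = ∑ k, n k • (Pi.single k 1 : Fin d → ℤ) := by
    ext j
    simp [Finset.sum_apply, Pi.single_apply]
  calc m n = m (∑ k, n k • (Pi.single k 1 : Fin d → ℤ)) := by rw [← hdecomp]
    _ ≤ ∑ k, m (n k • (Pi.single k 1 : Fin d → ℤ)) :=
        Finset.le_sum_of_subadditive m h0.le hadd _ _
    _ ≤ ∑ k, (∑ j, m (Pi.single j 1)) * |(n k : ℝ)| := by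
        refine Finset.sum_le_sum fun k _ => (hh_int _ _).trans ?_
        rw [mul_comm]
        gcongr
        exact Finset.single_le_sum (f := fun j => m (Pi.single j 1)) (fun j _ => hnonneg _)
          (Finset.mem_univ k)
    _ = _ := by rw [Finset.mul_sum]

theorem le_of_sum_abs_sub_le {m : (Fin d → ℤ) → ℝ} (hadd : ∀ n k, m (n + k) ≤ m n + m k)
    {C : ℝ} (hC0 : 0 ≤ C) (hC : ∀ n, m n ≤ C * ∑ k, |(n k : ℝ)|) {a b : Fin d → ℤ} {c : Fin d → ℝ}
    (h : ∀ k, |(a k : ℝ) - b k| ≤ c k) : m a ≤ m b + C * ∑ k, c k := by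
  have h1 := hadd b (a - b)
  rw [add_sub_cancel] at h1
  refine h1.trans (add_le_add le_rfl ((hC _).trans ?_))
  gcongr with k
  simpa using h k

/-- The asymptotic growth rate of a symmetric subadditive function on `ℤ^d` extends to a
seminorm on `ℝ^d`. -/
theorem exists_seminorm_tendsto {m : (Fin d → ℤ) → ℝ} (h0 : m 0 = 0)
    (hneg : ∀ n, m (-n) = m n) (hadd : ∀ n k, m (n + k) ≤ m n + m k) :
    ∃ L : Seminorm ℝ (Fin d → ℝ), ∀ v : Fin d → ℤ,
      Tendsto (fun k : ℕ => m (k • v) / k) atTop (𝓝 (L fun i => (v i : ℝ))) := by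
  obtain ⟨C, hC0, hC⟩ := exists_linear_bound h0 hneg hadd
  have hnonneg : ∀ n, 0 ≤ m n := fun n => by
    have := hadd n (-n)
    rw [add_neg_cancel, h0, hneg] at this
    linarith
  have hperturb := @le_of_sum_abs_sub_le d m hadd C hC0 hC
  let fl : ℝ → (Fin d → ℝ) → Fin d → ℤ := fun t u k => ⌊t * u k⌋
  let Sl : (Fin d → ℝ) → Set ℝ := fun u => {b | ∀ᶠ t : ℝ in atTop, m (fl t u) ≤ b * t}
  let p : (Fin d → ℝ) → ℝ := fun u => sInf (Sl u)
  have hbdd : ∀ u, BddBelow (Sl u) := fun u => ⟨0, fun b hb => by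
    obtain ⟨t, ht, ht0⟩ := (Eventually.and hb (eventually_gt_atTop (0 : ℝ))).exists
    by_contra! hb0
    have := hnonneg (fl t u)
    nlinarith⟩
  have hne : ∀ u, (Sl u).Nonempty := fun u => by
    refine ⟨C * ∑ k, (|u k| + 1), ?_⟩
    filter_upwards [eventually_ge_atTop (1 : ℝ)] with t ht
    refine (hC _).trans ?_
    rw [mul_assoc, Finset.sum_mul]
    gcongr with k
    have h1 := Int.floor_le (t * u k)
    have h2 := Int.lt_floor_add_one (t * u k)
    have h3 : |t * u k| = |u k| * t := by rw [abs_mul, abs_of_nonneg (by linarith : 0 ≤ t), mul_comm]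
    have h4 := abs_le.1 h3.le
    simp only [fl]
    rw [abs_le]
    constructor <;> nlinarith
  have hle : ∀ u b, (∀ᶠ t : ℝ in atTop, m (fl t u) ≤ b * t) → p u ≤ b := fun u b hb =>
    csInf_le (hbdd u) hb
  have hlt : ∀ u b, p u < b → ∀ᶠ t : ℝ in atTop, m (fl t u) ≤ b * t := by
    intro u b hb
    obtain ⟨b', hb', hlt⟩ := exists_lt_of_csInf_lt (hne u) hb
    filter_upwards [hb', eventually_ge_atTop (0 : ℝ)] with t h1 h2
    exact h1.trans (by gcongr)
  have hconst : ∀ c ε : ℝ, 0 < ε → ∀ᶠ t : ℝ in atTop, c ≤ ε * t := by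
    intro c ε hε
    filter_upwards [eventually_ge_atTop (c / ε)] with t ht
    rwa [div_le_iff₀' hε] at ht
  have hp0 : p 0 = 0 := by
    refine le_antisymm (hle 0 0 (Eventually.of_forall fun t => ?_)) ?_
    · have : fl t 0 = 0 := by ext k; simp [fl]
      simp [this, h0]
    · exact Real.sInf_nonneg fun b hb => by
        obtain ⟨t, ht, ht0⟩ := (Eventually.and hb (eventually_gt_atTop (0 : ℝ))).exists
        by_contra! hb0
        have := hnonneg (fl t 0)
        nlinarith
  have hpadd : ∀ u w, p (u + w) ≤ p u + p w := by
    intro u w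
    refine le_of_forall_pos_le_add fun ε hε => hle _ _ ?_
    filter_upwards [hlt u (p u + ε / 3) (by linarith), hlt w (p w + ε / 3) (by linarith),
      hconst (C * ∑ _k : Fin d, 1) (ε / 3) (by linarith)] with t h1 h2 h3
    have h4 : m (fl t (u + w)) ≤ m (fl t u + fl t w) + C * ∑ _k : Fin d, 1 := by
      refine hperturb fun k => ?_
      simp only [fl, Pi.add_apply, mul_add]
      have ha := Int.floor_le (t * u k + t * w k)
      have hb := Int.lt_floor_add_one (t * u k + t * w k)
      have h1 : (⌊t * u k⌋ + ⌊t * w k⌋ : ℝ) ≤ ⌊t * u k + t * w k⌋ := by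
        exact_mod_cast Int.le_floor_add (t * u k) (t * w k)
      have h2 : (⌊t * u k + t * w k⌋ : ℝ) - 1 ≤ ⌊t * u k⌋ + ⌊t * w k⌋ := by
        exact_mod_cast Int.le_floor_add_floor (t * u k) (t * w k)
      push_cast
      rw [abs_le]
      constructor <;> linarith
    have h5 := hadd (fl t u) (fl t w)
    linarith
  have hpsmul : ∀ (c : ℝ) u, p (c • u) ≤ ‖c‖ * p u := by
    intro c u
    rcases eq_or_ne c 0 with rfl | hc
    · simp [hp0]
    have hc' : 0 < |c| := abs_pos.2 hc
    refine le_of_forall_pos_le_add fun ε hε => hle _ _ ?_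
    have htend : Tendsto (fun t : ℝ => |c| * t) atTop atTop :=
      tendsto_id.const_mul_atTop hc'
    filter_upwards [htend.eventually (hlt u (p u + ε / (2 * |c|)) (by
      have : 0 < ε / (2 * |c|) := by positivity
      linarith)), hconst (C * ∑ _k : Fin d, 2) (ε / 2) (by linarith)] with t h1 h3
    have h4 : m (fl t (c • u)) ≤ m (fl (|c| * t) u) + C * ∑ _k : Fin d, 2 := by
      rcases abs_choice c with h | h
      · have : fl t (c • u) = fl (|c| * t) u := by
          ext k
          simp only [fl, h, Pi.smul_apply, smul_eq_mul]
          congr 1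
          ring
        rw [this]
        have : 0 ≤ C * ∑ _k : Fin d, (2 : ℝ) := by positivity
        linarith
      · rw [← hneg (fl (|c| * t) u)]
        refine hperturb fun k => ?_
        simp only [fl, h, Pi.smul_apply, smul_eq_mul, Pi.neg_apply]
        rw [show t * (c * u k) = -(-c * t * u k) by ring]
        have ha := Int.floor_le (-c * t * u k)
        have hb := Int.lt_floor_add_one (-c * t * u k)
        have ha' := Int.floor_le (-(-c * t * u k))
        have hb' := Int.lt_floor_add_one (-(-c * t * u k))
        push_cast
        rw [abs_le]
        constructor <;> linarith
    have h5 : (p u + ε / (2 * |c|)) * (|c| * t) = |c| * p u * t + ε / 2 * t := by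
      field_simp
    rw [Real.norm_eq_abs]
    linarith
  refine ⟨Seminorm.ofSMulLE p hp0 hpadd hpsmul, fun v => ?_⟩
  change Tendsto _ _ (𝓝 (p fun i => (v i : ℝ)))
  have hsub : Subadditive fun k : ℕ => m (k • v) := fun a b => by
    simp only [add_smul]
    exact hadd _ _
  have hbb : BddBelow (Set.range fun k : ℕ => m (k • v) / k) :=
    ⟨0, by rintro _ ⟨k, rfl⟩; exact div_nonneg (hnonneg _) (Nat.cast_nonneg _)⟩
  have hlim := hsub.tendsto_lim hbb
  suffices hsub.lim = p fun i => (v i : ℝ) by rwa [this] at hlim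
  refine le_antisymm (le_of_forall_gt fun b hb => ?_)
    (le_of_forall_pos_le_add fun ε hε => hle _ _ ?_)
  · obtain ⟨b', hb1, hb2⟩ := exists_between hb
    refine lt_of_le_of_lt (le_of_tendsto hlim ?_) hb2
    filter_upwards [tendsto_natCast_atTop_atTop.eventually (hlt _ _ hb1),
      eventually_gt_atTop 0] with k hk hk0
    have : fl k (fun i => (v i : ℝ)) = k • v := by
      ext i
      have : ((k : ℝ) * v i) = ((k * v i : ℤ) : ℝ) := by push_cast; rfl
      simp only [fl, this, Int.floor_intCast]
      simp
    rw [this] at hk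
    rw [div_le_iff₀ (by exact_mod_cast hk0)]
    exact hk
  · have hev := (tendsto_nat_floor_atTop (α := ℝ)).eventually
      (hlim.eventually_lt_const (show hsub.lim < hsub.lim + ε / 2 by linarith))
    filter_upwards [hev, eventually_ge_atTop (1 : ℝ),
      hconst (C * ∑ k, (|(v k : ℝ)| + 1)) (ε / 2) (by linarith)] with t h1 h2 h3
    have hk0 : 0 < ⌊t⌋₊ := Nat.floor_pos.2 h2
    rw [div_lt_iff₀ (by exact_mod_cast hk0)] at h1
    have h4 : m (fl t fun i => (v i : ℝ)) ≤ m (⌊t⌋₊ • v) + C * ∑ k, (|(v k : ℝ)| + 1) := by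
      refine hperturb fun k => ?_
      have ha := Int.floor_le (t * v k)
      have hb := Int.lt_floor_add_one (t * v k)
      have hc := Nat.floor_le (show 0 ≤ t by linarith)
      have he := Nat.lt_floor_add_one t
      have hf : |(t - ⌊t⌋₊) * v k| ≤ |(v k : ℝ)| := by
        rw [abs_mul, abs_of_nonneg (by linarith : 0 ≤ t - ⌊t⌋₊)]
        exact mul_le_of_le_one_left (abs_nonneg _) (by linarith)
      simp only [fl, Pi.smul_apply, nsmul_eq_mul]
      push_cast
      rw [abs_le] at hf ⊢
      constructor <;> linarith
    have h5 : (hsub.lim + ε / 2) * ⌊t⌋₊ ≤ (hsub.lim + ε / 2) * t := by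
      have : 0 ≤ hsub.lim := ge_of_tendsto' hlim fun k =>
        div_nonneg (hnonneg _) (Nat.cast_nonneg _)
      gcongr
      exact Nat.floor_le (by linarith)
    linarith

end

section

variable {X : Type*} [MeasurableSpace X] {d : ℕ}

/-- The `i`-th site of the discretised line with `s` steps from `y` to `q`. -/
def lineSite (y q : Fin d → ℤ) (s i : ℕ) : Fin d → ℤ := fun k => y k + (i * (q k - y k)) / s

/-- The `(d - 1)`-dimensional box of side `r` with corner `b` in the hyperplane where the
coordinate `i₀` equals `c`. -/
noncomputable def slab (i₀ : Fin d) (c : ℤ) (b : Fin d → ℤ) (r : ℕ) : Finset (Fin d → ℤ) :=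
  Fintype.piFinset fun k => if k = i₀ then {c} else Finset.Ico (b k) (b k + r)

theorem mem_slab {i₀ : Fin d} {c : ℤ} {b : Fin d → ℤ} {r : ℕ} {q : Fin d → ℤ} :
    q ∈ slab i₀ c b r ↔ q i₀ = c ∧ ∀ k, k ≠ i₀ → b k ≤ q k ∧ q k < b k + r := by
  simp only [slab, Fintype.mem_piFinset]
  constructor
  · intro h
    refine ⟨by simpa using h i₀, fun k hk => by simpa [hk] using h k⟩
  · rintro ⟨h1, h2⟩ k
    by_cases hk : k = i₀
    · subst hk; simp [h1]
    · simpa [hk] using h2 k hk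

theorem prod_card_ite_singleton (i₀ : Fin d) (c : ℤ) (S : Fin d → Finset ℤ) :
    (Fintype.piFinset fun k => if k = i₀ then {c} else S k).card
      = ∏ k ∈ Finset.univ.erase i₀, (S k).card := by
  rw [Fintype.card_piFinset, ← Finset.mul_prod_erase _ _ (Finset.mem_univ i₀)]
  simp only [if_true, Finset.card_singleton, one_mul]
  exact Finset.prod_congr rfl fun k hk => by rw [if_neg (Finset.ne_of_mem_erase hk)]

theorem card_slab (i₀ : Fin d) (c : ℤ) (b : Fin d → ℤ) (r : ℕ) :
    (slab i₀ c b r).card = r ^ (d - 1) := by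
  rw [slab, prod_card_ite_singleton]
  simp

theorem lineSite_zero (y q : Fin d → ℤ) (s : ℕ) : lineSite y q s 0 = y := by
  ext k; simp [lineSite]

theorem lineSite_self (y q : Fin d → ℤ) {s : ℕ} (hs : 0 < s) : lineSite y q s s = q := by
  ext k
  have : (s : ℤ) ≠ 0 := by exact_mod_cast hs.ne'
  simp [lineSite, Int.mul_ediv_cancel_left _ this]

theorem lineSite_apply_of_sub_eq {y q : Fin d → ℤ} {s : ℕ} (hs : 0 < s) (i : ℕ) {k : Fin d}
    (h : q k - y k = s) : lineSite y q s i k = y k + i := by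
  have : (s : ℤ) ≠ 0 := by exact_mod_cast hs.ne'
  simp [lineSite, h, Int.mul_ediv_cancel _ this]

theorem abs_lineSite_sub_le {y q : Fin d → ℤ} {s i : ℕ} (hs : 0 < s) (hi : i ≤ s) {k : Fin d}
    {c : ℤ} (h : |q k - y k| ≤ c) : |lineSite y q s i k - y k| ≤ c := by
  have hs' : (0 : ℤ) < s := by exact_mod_cast hs
  have hi' : (i : ℤ) ≤ s := by exact_mod_cast hi
  have hi0 : (0 : ℤ) ≤ i := Int.natCast_nonneg i
  have hc : 0 ≤ c := (abs_nonneg _).trans h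
  rw [abs_le] at h
  simp only [lineSite, add_sub_cancel_left]
  rw [abs_le]
  constructor
  · exact Int.le_ediv_of_mul_le hs' (by nlinarith)
  · exact Int.ediv_le_of_le_mul hs' (by nlinarith)

theorem lineSite_succ_sub_mem_cube {y q : Fin d → ℤ} {s : ℕ} (hs : 0 < s)
    (h : ∀ k, |q k - y k| ≤ s) (i : ℕ) :
    lineSite y q s (i + 1) - lineSite y q s i ∈ cube d 1 := by
  refine mem_cube.2 fun k => ?_
  have hs' : (0 : ℤ) < s := by exact_mod_cast hs
  have hk := abs_le.1 (h k)
  simp only [lineSite, Pi.sub_apply]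
  generalize q k - y k = D at *
  have h1 := Int.ediv_mul_le (i * D) hs'.ne'
  have h2 := Int.lt_ediv_add_one_mul_self (i * D) hs'
  have h3 : (i * D) / s - 1 ≤ ((i + 1 : ℕ) * D) / s :=
    Int.le_ediv_of_mul_le hs' (by push_cast; nlinarith)
  have h4 : ((i + 1 : ℕ) * D) / s < (i * D) / s + 2 :=
    Int.ediv_lt_of_lt_mul hs' (by push_cast; nlinarith)
  rw [abs_le]
  push_cast at *
  constructor <;> omega

theorem card_mul_le_of_ediv_eq {S : Finset ℤ} {y c : ℤ} {s i : ℕ} (hs : 0 < s)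
    (h : ∀ a ∈ S, (i * (a - y)) / s = c) : S.card * i ≤ s + i := by
  rcases S.eq_empty_or_nonempty with rfl | hne
  · simp
  have hs' : (0 : ℤ) < s := by exact_mod_cast hs
  set a := S.min' hne
  set b := S.max' hne
  have hab : a ≤ b := S.min'_le _ (S.max'_mem hne)
  have ha := h a (S.min'_mem hne)
  have hb := h b (S.max'_mem hne)
  have h1 := Int.ediv_mul_le (i * (a - y)) hs'.ne'
  have h2 := Int.lt_ediv_add_one_mul_self (i * (b - y)) hs'
  rw [ha] at h1
  rw [hb] at h2
  have hsub : S ⊆ Finset.Icc a b := fun x hx =>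
    Finset.mem_Icc.2 ⟨S.min'_le x hx, S.le_max' x hx⟩
  have hcard := Finset.card_le_card hsub
  rw [Int.card_Icc] at hcard
  have hcard' : (S.card : ℤ) ≤ b - a + 1 := by omega
  zify
  nlinarith [Int.natCast_nonneg i]

theorem card_fiber_mul_le {i₀ : Fin d} {c : ℤ} {b y : Fin d → ℤ} {r s i : ℕ}
    (hs : 0 < s) (hsr : s ≤ 4 * r) (hi : i ≤ s) (w : Fin d → ℤ) :
    ((slab i₀ c b r).filter fun q => lineSite y q s i = w).card * (i + 1) ^ (d - 1)
      ≤ (16 * r) ^ (d - 1) := by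
  set S : Fin d → Finset ℤ := fun k =>
    (Finset.Ico (b k) (b k + r)).filter fun a => (i * (a - y k)) / s = w k - y k
  have hsub : ((slab i₀ c b r).filter fun q => lineSite y q s i = w) ⊆
      Fintype.piFinset fun k => if k = i₀ then {c} else S k := by
    intro q hq
    obtain ⟨hq1, rfl⟩ := Finset.mem_filter.1 hq
    obtain ⟨hc, hk⟩ := mem_slab.1 hq1
    refine Fintype.mem_piFinset.2 fun k => ?_
    by_cases h : k = i₀
    · subst h; simp [hc]
    · rw [if_neg h]
      refine Finset.mem_filter.2 ⟨Finset.mem_Ico.2 (hk k h), ?_⟩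
      simp [lineSite]
  refine (Nat.mul_le_mul_right _ (Finset.card_le_card hsub)).trans ?_
  have hcard : (Finset.univ.erase i₀).card = d - 1 := by simp
  rw [prod_card_ite_singleton, ← hcard, ← Finset.prod_const, ← Finset.prod_mul_distrib]
  refine Finset.prod_le_pow_card _ _ _ fun k _ => ?_
  rcases Nat.eq_zero_or_pos i with rfl | hi0
  · have : (S k).card ≤ r := (Finset.card_filter_le _ _).trans (by simp)
    omega
  · have : (S k).card * i ≤ s + i := card_mul_le_of_ediv_eq hs fun a ha => (Finset.mem_filter.1 ha).2
    nlinarith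

/-- Counting incidences between a finite set and the fan of discretised lines from `y` to
a slab. -/
theorem card_incidences_le {i₀ : Fin d} {b y : Fin d → ℤ} {r s m : ℕ}
    (hs : 0 < s) (hsr : s ≤ 4 * r) (A : Finset (Fin d → ℤ)) (hm : 0 < m) (hA : A.card ≤ m ^ d) :
    ((slab i₀ (y i₀ + s) b r ×ˢ Finset.range s).filter fun z => lineSite y z.1 s z.2 ∈ A).card
      ≤ (1 + 16 ^ (d - 1)) * m * r ^ (d - 1) := by
  classical
  set P := (slab i₀ (y i₀ + s) b r ×ˢ Finset.range s).filter fun z => lineSite y z.1 s z.2 ∈ A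
  have h1 : (P.filter fun z => z.2 < m).card ≤ m * r ^ (d - 1) := by
    have : (P.filter fun z => z.2 < m) ⊆ slab i₀ (y i₀ + s) b r ×ˢ Finset.range m := by
      intro z hz
      simp only [P, Finset.mem_filter, Finset.mem_product, Finset.mem_range] at hz ⊢
      exact ⟨hz.1.1.1, hz.2⟩
    refine (Finset.card_le_card this).trans ?_
    rw [Finset.card_product, card_slab, Finset.card_range, mul_comm]
  have h2 : (P.filter fun z => ¬ z.2 < m).card ≤ 16 ^ (d - 1) * m * r ^ (d - 1) := by
    have hfib : ∀ w ∈ A, ((P.filter fun z => ¬ z.2 < m).filter fun z =>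
        lineSite y z.1 s z.2 = w).card * m ^ (d - 1) ≤ (16 * r) ^ (d - 1) := by
      intro w _
      set Fb := (P.filter fun z => ¬ z.2 < m).filter fun z => lineSite y z.1 s z.2 = w
      rcases Fb.eq_empty_or_nonempty with he | ⟨⟨q₁, i₁⟩, hz₁⟩
      · simp [he]
      have hFb : ∀ z ∈ Fb, z.1 ∈ slab i₀ (y i₀ + s) b r ∧ z.2 < s ∧ m ≤ z.2 ∧
          lineSite y z.1 s z.2 = w := by
        intro z hz
        simp only [Fb, P, Finset.mem_filter, Finset.mem_product, Finset.mem_range, not_lt] at hz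
        exact ⟨hz.1.1.1.1, hz.1.1.1.2, hz.1.2, hz.2⟩
      have hidx : ∀ z ∈ Fb, w i₀ = y i₀ + z.2 := by
        intro z hz
        obtain ⟨hq, -, -, rfl⟩ := hFb z hz
        exact lineSite_apply_of_sub_eq hs _ (by rw [(mem_slab.1 hq).1]; ring)
      obtain ⟨-, hi₁, hmi, -⟩ := hFb _ hz₁
      have hsub : Fb ⊆ ((slab i₀ (y i₀ + s) b r).filter fun q => lineSite y q s i₁ = w).image
          fun q => (q, i₁) := by
        rintro ⟨q, i⟩ hz
        have hii : i = i₁ := by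
          have h1 := hidx _ hz
          have h2 := hidx _ hz₁
          simp only at h1 h2
          omega
        subst hii
        obtain ⟨hq, -, -, hw⟩ := hFb _ hz
        exact Finset.mem_image.2 ⟨q, Finset.mem_filter.2 ⟨hq, hw⟩, rfl⟩
      refine le_trans ?_ (card_fiber_mul_le (i₀ := i₀) (c := y i₀ + s) (b := b) (y := y)
        hs hsr hi₁.le w)
      refine Nat.mul_le_mul ((Finset.card_le_card hsub).trans Finset.card_image_le) ?_
      exact Nat.pow_le_pow_left (by simp only at hmi; omega) _
    have hsum : (P.filter fun z => ¬ z.2 < m).card * m ^ (d - 1)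
        ≤ m ^ d * (16 * r) ^ (d - 1) := by
      rw [Finset.card_eq_sum_card_fiberwise (f := fun z => lineSite y z.1 s z.2) (t := A)
        (fun z hz => by
          simp only [P, Finset.coe_filter, Finset.mem_filter, Set.mem_ofPred_eq] at hz
          exact hz.1.2), Finset.sum_mul]
      refine (Finset.sum_le_card_nsmul _ _ _ hfib).trans ?_
      rw [smul_eq_mul]
      exact Nat.mul_le_mul_right _ hA
    have hd : m ^ d = m * m ^ (d - 1) := by
      rw [← pow_succ', Nat.sub_add_cancel (Nat.succ_le_of_lt i₀.pos)]
    rw [hd, mul_pow] at hsum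
    refine Nat.le_of_mul_le_mul_right (hsum.trans (le_of_eq ?_)) (pow_pos hm (d - 1))
    ring
  have := Finset.card_filter_add_card_filter_not (s := P) (fun z => z.2 < m)
  rw [← this]
  calc _ ≤ _ := add_le_add h1 h2
    _ = _ := by ring

theorem card_incidences_le_rpow {i₀ : Fin d} {b y : Fin d → ℤ} {r s : ℕ}
    (hs : 0 < s) (hsr : s ≤ 4 * r) (A : Finset (Fin d → ℤ)) :
    (((slab i₀ (y i₀ + s) b r ×ˢ Finset.range s).filter fun z =>
        lineSite y z.1 s z.2 ∈ A).card : ℝ≥0∞)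
      ≤ (r : ℝ≥0∞) ^ (d - 1) * (2 * (1 + 16 ^ (d - 1)) * (A.card : ℝ≥0∞) ^ (1 / (d : ℝ))) := by
  have hd : 0 < d := i₀.pos
  rcases A.eq_empty_or_nonempty with rfl | hA
  · simp
  set N : ℝ := (A.card : ℝ) ^ (1 / (d : ℝ)) with hN
  have hA1 : (1 : ℝ) ≤ A.card := by exact_mod_cast hA.card_pos
  have hN1 : 1 ≤ N := Real.one_le_rpow hA1 (by positivity)
  have hNd : N ^ d = A.card := by
    rw [hN, ← Real.rpow_natCast, ← Real.rpow_mul (by positivity), one_div_mul_cancel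
      (by positivity), Real.rpow_one]
  have hm : 0 < ⌈N⌉₊ := Nat.ceil_pos.2 (by linarith)
  have hcard : A.card ≤ ⌈N⌉₊ ^ d := by
    have : (A.card : ℝ) ≤ (⌈N⌉₊ : ℝ) ^ d := by
      rw [← hNd]
      exact pow_le_pow_left₀ (by linarith) (Nat.le_ceil _) _
    exact_mod_cast this
  have hceil : (⌈N⌉₊ : ℝ≥0∞) ≤ 2 * (A.card : ℝ≥0∞) ^ (1 / (d : ℝ)) := by
    have h1 : (⌈N⌉₊ : ℝ) ≤ 2 * N := by linarith [Nat.ceil_lt_add_one (by linarith : 0 ≤ N)]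
    have h2 := ENNReal.ofReal_le_ofReal h1
    rw [ENNReal.ofReal_natCast, ENNReal.ofReal_mul (by norm_num), hN,
      ← ENNReal.ofReal_rpow_of_pos (by linarith), ENNReal.ofReal_natCast] at h2
    simpa [hN] using h2
  have hmain := card_incidences_le (i₀ := i₀) (b := b) (y := y) hs hsr A hm hcard
  calc _ ≤ (((1 + 16 ^ (d - 1)) * ⌈N⌉₊ * r ^ (d - 1) : ℕ) : ℝ≥0∞) := by exact_mod_cast hmain
    _ = (r : ℝ≥0∞) ^ (d - 1) * ((1 + 16 ^ (d - 1)) * ⌈N⌉₊) := by push_cast; ring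
    _ ≤ (r : ℝ≥0∞) ^ (d - 1) * ((1 + 16 ^ (d - 1)) * (2 * (A.card : ℝ≥0∞) ^ (1 / (d : ℝ)))) := by
        gcongr
    _ = _ := by ring

open Classical in
/-- The total weight met by a fan of discretised lines, for a weight dominated by a constant plus a
sum of indicators. -/
theorem sum_fan_le {ι : Type*} {i₀ : Fin d} {b y : Fin d → ℤ} {r s : ℕ}
    (hs : 0 < s) (hsr : s ≤ 4 * r) {f : (Fin d → ℤ) → ℝ≥0∞} {β : ℝ≥0∞}
    {A : ι → Set (Fin d → ℤ)} (hf : ∀ p, f p ≤ β + ∑' j, (A j).indicator 1 p)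
    {Q : Finset (Fin d → ℤ)}
    (hQ : ∀ q ∈ slab i₀ (y i₀ + s) b r, ∀ i < s, lineSite y q s i ∈ Q) :
    ∑ q ∈ slab i₀ (y i₀ + s) b r, ∑ i ∈ Finset.range s, f (lineSite y q s i)
      ≤ (r : ℝ≥0∞) ^ (d - 1) * (4 * r * β + 2 * (1 + 16 ^ (d - 1)) *
          ∑' j, ((Q.filter fun p => p ∈ A j).card : ℝ≥0∞) ^ (1 / (d : ℝ))) := by
  rw [← Finset.sum_product']
  set P := slab i₀ (y i₀ + s) b r ×ˢ Finset.range s with hP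
  have hPcard : (P.card : ℝ≥0∞) ≤ r ^ (d - 1) * (4 * r) := by
    rw [hP, Finset.card_product, card_slab, Finset.card_range]
    exact_mod_cast Nat.mul_le_mul_left _ hsr
  have hj : ∀ j, ∑ z ∈ P, (A j).indicator (1 : (Fin d → ℤ) → ℝ≥0∞) (lineSite y z.1 s z.2)
      ≤ (r : ℝ≥0∞) ^ (d - 1) * (2 * (1 + 16 ^ (d - 1)) *
        ((Q.filter fun p => p ∈ A j).card : ℝ≥0∞) ^ (1 / (d : ℝ))) := by
    intro j
    refine le_trans (le_of_eq ?_) 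
      (card_incidences_le_rpow (i₀ := i₀) (b := b) (y := y) hs hsr (Q.filter fun p => p ∈ A j))
    rw [Finset.natCast_card_filter]
    refine Finset.sum_congr rfl fun z hz => ?_
    rw [Finset.mem_product, Finset.mem_range] at hz
    simp [Set.indicator_apply, hQ z.1 hz.1 z.2 hz.2]
  calc ∑ z ∈ P, f (lineSite y z.1 s z.2)
      ≤ ∑ z ∈ P, (β + ∑' j, (A j).indicator 1 (lineSite y z.1 s z.2)) :=
        Finset.sum_le_sum fun z _ => hf _
    _ = P.card * β + ∑' j, ∑ z ∈ P, (A j).indicator 1 (lineSite y z.1 s z.2) := by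
        rw [Finset.sum_add_distrib, Finset.sum_const, nsmul_eq_mul,
          Summable.tsum_finsetSum fun _ _ => ENNReal.summable]
    _ ≤ r ^ (d - 1) * (4 * r) * β + ∑' j, (r : ℝ≥0∞) ^ (d - 1) * (2 * (1 + 16 ^ (d - 1)) *
        ((Q.filter fun p => p ∈ A j).card : ℝ≥0∞) ^ (1 / (d : ℝ))) := by
        gcongr with j
        exact hj j
    _ = _ := by
        rw [ENNReal.tsum_mul_left, ENNReal.tsum_mul_left]; ring

/-- A semimetric is bounded along a discretised line by the sum of its local sizes. -/
theorem semimetric_le_sum_lineSite {r : (Fin d → ℤ) → (Fin d → ℤ) → ℝ}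
    (hnonneg : ∀ m n, 0 ≤ r m n) (hrefl : ∀ m, r m m = 0)
    (htri : ∀ m k n, r m n ≤ r m k + r k n) {y q : Fin d → ℤ} {s : ℕ} (hs : 0 < s)
    (h : ∀ k, |q k - y k| ≤ s) :
    ENNReal.ofReal (r y q) ≤ ∑ i ∈ Finset.range s,
      ∑ e ∈ cube d 1, ENNReal.ofReal (r (lineSite y q s i) (lineSite y q s i + e)) := by
  have hstep : ∀ i, ENNReal.ofReal (r (lineSite y q s i) (lineSite y q s (i + 1))) ≤
      ∑ e ∈ cube d 1, ENNReal.ofReal (r (lineSite y q s i) (lineSite y q s i + e)) := by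
    intro i
    have := Finset.single_le_sum
      (f := fun e => ENNReal.ofReal (r (lineSite y q s i) (lineSite y q s i + e)))
      (fun _ _ => zero_le) (lineSite_succ_sub_mem_cube hs h i)
    simpa using this
  have hall : ∀ n, ENNReal.ofReal (r y (lineSite y q s n)) ≤ ∑ i ∈ Finset.range n,
      ∑ e ∈ cube d 1, ENNReal.ofReal (r (lineSite y q s i) (lineSite y q s i + e)) := by
    intro n
    induction n with
    | zero => simp [lineSite_zero, hrefl]
    | succ n ih =>
      rw [Finset.sum_range_succ]
      refine le_trans ?_ (add_le_add ih (hstep n))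
      rw [← ENNReal.ofReal_add (hnonneg _ _) (hnonneg _ _)]
      exact ENNReal.ofReal_le_ofReal (htri _ _ _)
  have := hall s
  rwa [lineSite_self y q hs] at this

open Classical in
/-- A discrete Morrey-type inequality at the Lorentz endpoint `L^{d,1}`: oscillation of a
semimetric on `ℤ^d` in terms of the level sets of its local size. -/
theorem semimetric_le_of_layers {ι : Type*} {r : (Fin d → ℤ) → (Fin d → ℤ) → ℝ}
    (hd : 1 ≤ d) (hnonneg : ∀ m n, 0 ≤ r m n) (hsymm : ∀ m n, r m n = r n m)
    (hrefl : ∀ m, r m m = 0) (htri : ∀ m k n, r m n ≤ r m k + r k n) {β : ℝ≥0∞}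
    {A : ι → Set (Fin d → ℤ)}
    (hf : ∀ p, ∑ e ∈ cube d 1, ENNReal.ofReal (r p (p + e)) ≤ β + ∑' j, (A j).indicator 1 p)
    {a R : ℕ} (ha : 0 < a) {y z : Fin d → ℤ} (hyz : ∀ k, |y k - z k| ≤ a)
    (hy : y ∈ cube d R) (hz : z ∈ cube d R) :
    ENNReal.ofReal (r y z) ≤ 8 * a * β + 4 * (1 + 16 ^ (d - 1)) *
      ∑' j, (((cube d (R + 4 * a)).filter fun p => p ∈ A j).card : ℝ≥0∞) ^ (1 / (d : ℝ)) := by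
  set i₀ : Fin d := ⟨0, hd⟩
  set f : (Fin d → ℤ) → ℝ≥0∞ := fun p => ∑ e ∈ cube d 1, ENNReal.ofReal (r p (p + e)) with hfdef
  set S := slab i₀ (y i₀ + (3 * a : ℕ)) y a with hS
  obtain ⟨s, hs⟩ : ∃ s : ℕ, (s : ℤ) = y i₀ + (3 * a : ℕ) - z i₀ := by
    have := abs_le.1 (hyz i₀)
    exact ⟨(y i₀ + (3 * a : ℕ) - z i₀).toNat, by rw [Int.toNat_of_nonneg]; push_cast; omega⟩
  have hs24 : 2 * a ≤ s ∧ s ≤ 4 * a := by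
    have := abs_le.1 (hyz i₀)
    push_cast at hs
    omega
  have hS' : S = slab i₀ (z i₀ + s) y a := by rw [hS, hs]; congr 1; ring
  have hdy : ∀ q ∈ S, ∀ k, |q k - y k| ≤ (3 * a : ℕ) := by
    intro q hq k
    obtain ⟨h1, h2⟩ := mem_slab.1 (hS ▸ hq)
    by_cases hk : k = i₀
    · rw [hk, h1]; simp
    · have := h2 k hk
      rw [abs_le]; push_cast
      constructor <;> omega
  have hdz : ∀ q ∈ S, ∀ k, |q k - z k| ≤ s := by
    intro q hq k
    obtain ⟨h1, h2⟩ := mem_slab.1 (hS' ▸ hq)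
    by_cases hk : k = i₀
    · rw [hk, h1]; simp
    · have := h2 k hk
      have h3 := abs_le.1 (hyz k)
      rw [abs_le]
      constructor <;> omega
  have hQy : ∀ q ∈ S, ∀ i < 3 * a, lineSite y q (3 * a) i ∈ cube d (R + 4 * a) := by
    intro q hq i hi
    refine mem_cube.2 fun k => ?_
    have h1 := abs_le.1 (abs_lineSite_sub_le (by omega) hi.le (hdy q hq k))
    have h2 := abs_le.1 (mem_cube.1 hy k)
    rw [abs_le]; push_cast at *
    constructor <;> omega
  have hQz : ∀ q ∈ S, ∀ i < s, lineSite z q s i ∈ cube d (R + 4 * a) := by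
    intro q hq i hi
    refine mem_cube.2 fun k => ?_
    have h1 := abs_le.1 (abs_lineSite_sub_le (by omega) hi.le (hdz q hq k))
    have h2 := abs_le.1 (mem_cube.1 hz k)
    rw [abs_le]; push_cast at *
    constructor <;> omega
  have hy' := sum_fan_le (i₀ := i₀) (b := y) (y := y) (r := a) (s := 3 * a) (by omega)
    (by omega) hf hQy
  have hz' := sum_fan_le (i₀ := i₀) (b := y) (y := z) (r := a) (s := s) (by omega)
    (by omega) hf (hS' ▸ hQz)
  rw [← hS] at hy'
  rw [← hS'] at hz'
  have hscard : (S.card : ℝ≥0∞) = a ^ (d - 1) := by rw [hS, card_slab]; push_cast; rfl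
  have hpos : (a : ℝ≥0∞) ^ (d - 1) ≠ 0 := pow_ne_zero _ (by exact_mod_cast ha.ne')
  have htop : (a : ℝ≥0∞) ^ (d - 1) ≠ ⊤ := ENNReal.pow_ne_top (ENNReal.natCast_ne_top a)
  rw [← ENNReal.mul_le_mul_iff_right hpos htop]
  calc (a : ℝ≥0∞) ^ (d - 1) * ENNReal.ofReal (r y z)
      = ∑ q ∈ S, ENNReal.ofReal (r y z) := by rw [Finset.sum_const, nsmul_eq_mul, hscard]
    _ ≤ ∑ q ∈ S, (∑ i ∈ Finset.range (3 * a), f (lineSite y q (3 * a) i)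
          + ∑ i ∈ Finset.range s, f (lineSite z q s i)) := by
        refine Finset.sum_le_sum fun q hq => ?_
        refine (ENNReal.ofReal_le_ofReal (htri y q z)).trans ?_
        rw [ENNReal.ofReal_add (hnonneg _ _) (hnonneg _ _), hsymm q z]
        exact add_le_add
          (semimetric_le_sum_lineSite hnonneg hrefl htri (by omega) (hdy q hq))
          (semimetric_le_sum_lineSite hnonneg hrefl htri (by omega) (hdz q hq))
    _ ≤ _ := by
        rw [Finset.sum_add_distrib]
        refine (add_le_add hy' hz').trans (le_of_eq ?_)
        ring

end

section

variable {X : Type*} [MeasurableSpace X] {d : ℕ}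

/-- Continuity at large scales: nearby points of a large cube are at distance small compared to
the size of the cube. -/
def IsAsymptoticallyEquicontinuous (r : (Fin d → ℤ) → (Fin d → ℤ) → ℝ) : Prop :=
  ∀ η : ℝ, 0 < η → ∃ δ : ℝ, 0 < δ ∧ ∃ R₀ : ℕ, ∀ R : ℕ, R₀ ≤ R → ∀ y ∈ cube d R, ∀ z ∈ cube d R,
    (∀ k, |(y k : ℝ) - z k| ≤ δ * R) → r y z ≤ η * R

theorem rpow_le_rpow_add_mul {θ : ℝ} (h0 : 0 ≤ θ) (h1 : θ ≤ 1) (a : ℝ≥0∞) {b : ℝ≥0∞}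
    (hb : b ≠ ⊤) : b ^ θ ≤ a ^ θ + a ^ (θ - 1) * b := by
  rcases le_or_gt b a with h | h
  · exact (ENNReal.rpow_le_rpow h h0).trans le_self_add
  · have hb0 : b ≠ 0 := (zero_le.trans_lt h).ne'
    calc b ^ θ = b ^ (θ - 1) * b := by
          nth_rewrite 3 [← ENNReal.rpow_one b]
          rw [← ENNReal.rpow_add _ _ hb0 hb, sub_add_cancel]
      _ ≤ a ^ (θ - 1) * b := by
          gcongr ?_ * b
          rw [← neg_sub, ENNReal.rpow_neg, ENNReal.rpow_neg]
          exact ENNReal.inv_le_inv.2 (ENNReal.rpow_le_rpow h.le (by linarith))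
      _ ≤ _ := le_add_self

theorem ofReal_le_natCast_add_tsum (t : ℝ) (l : ℕ) :
    ENNReal.ofReal t ≤ l + ∑' i : ℕ, if ((i + l : ℕ) : ℝ) < t then (1 : ℝ≥0∞) else 0 := by
  have h1 : ∑ i ∈ Finset.range (⌈t⌉₊ - l), (if ((i + l : ℕ) : ℝ) < t then (1 : ℝ≥0∞) else 0)
      = (⌈t⌉₊ - l : ℕ) := by
    rw [Finset.sum_congr rfl fun i hi => if_pos (Nat.lt_ceil.1 ?_)]
    · simp
    · have := Finset.mem_range.1 hi
      omega
  calc ENNReal.ofReal t ≤ ((⌈t⌉₊ : ℕ) : ℝ≥0∞) := by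
        rw [← ENNReal.ofReal_natCast]
        exact ENNReal.ofReal_le_ofReal (Nat.le_ceil t)
    _ ≤ ((l + (⌈t⌉₊ - l) : ℕ) : ℝ≥0∞) := by
        exact_mod_cast (by omega : ⌈t⌉₊ ≤ l + (⌈t⌉₊ - l))
    _ ≤ _ := by
        rw [Nat.cast_add, ← h1]
        gcongr
        exact ENNReal.sum_le_tsum _

theorem tsum_le_lintegral_of_antitone {φ : ℝ → ℝ≥0∞} (hφ : Antitone φ) :
    ∑' i : ℕ, φ ((i + 1 : ℕ) : ℝ) ≤ ∫⁻ t in Set.Ioi (0 : ℝ), φ t := by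
  have hmono : Monotone fun i : ℕ => (i : ℝ) := Nat.mono_cast
  have hdisj := hmono.pairwise_disjoint_on_Ioc_succ
  calc ∑' i : ℕ, φ ((i + 1 : ℕ) : ℝ)
      ≤ ∑' i : ℕ, ∫⁻ t in Set.Ioc (i : ℝ) (Order.succ i : ℕ), φ t := by
        refine ENNReal.tsum_le_tsum fun i => ?_
        calc φ ((i + 1 : ℕ) : ℝ)
            = ∫⁻ _ in Set.Ioc (i : ℝ) (Order.succ i : ℕ), φ ((i + 1 : ℕ) : ℝ) := by simp
          _ ≤ _ := setLIntegral_mono' measurableSet_Ioc fun t ht => hφ (by simpa using ht.2)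
    _ = ∫⁻ t in ⋃ i : ℕ, Set.Ioc (i : ℝ) (Order.succ i : ℕ), φ t :=
        (lintegral_iUnion (fun _ => measurableSet_Ioc) hdisj _).symm
    _ ≤ _ := lintegral_mono_set (Set.iUnion_subset fun i t ht =>
        Set.mem_Ioi.2 ((Nat.cast_nonneg i).trans_lt ht.1))

namespace IsErgodicAction

variable {μ : Measure X} {T : (Fin d → ℤ) → X → X}

open Classical in
/-- Simultaneous control of the visits to a family of sets in `ℓ^{1/d}`. -/
theorem ae_eventually_tsum_card_rpow_le [IsProbabilityMeasure μ] (hT : IsErgodicAction μ T)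
    (hd : 1 ≤ d) {ι : Type*} [Countable ι] {A : ι → Set X} (hA : ∀ j, MeasurableSet (A j))
    {s : ℝ≥0∞} (hs : ∑' j, μ (A j) ^ (1 / (d : ℝ)) < s) :
    ∀ᵐ x ∂μ, ∀ᶠ R : ℕ in atTop,
      ∑' j, (((cube d R).filter fun p => T p x ∈ A j).card : ℝ≥0∞) ^ (1 / (d : ℝ))
        ≤ (2 * R + 1) * ((1 + 12 ^ d) * s) := by
  have hd0 : (d : ℝ) ≠ 0 := by positivity
  set θ : ℝ := 1 / (d : ℝ) with hθ
  have hθ0 : 0 < θ := by positivity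
  have hθ1 : θ ≤ 1 := by
    rw [hθ, div_le_one (by positivity)]
    exact_mod_cast hd
  set G : X → ℝ≥0∞ := fun x => ∑' j, μ (A j) ^ (θ - 1) * (A j).indicator 1 x with hGdef
  have hG : Measurable G := Measurable.tsum fun j =>
    (measurable_one.indicator (hA j)).const_mul _
  have hGs : ∫⁻ x, G x ∂μ < s := by
    refine lt_of_le_of_lt ?_ hs
    rw [hGdef, lintegral_tsum fun j => ((measurable_one.indicator (hA j)).const_mul _).aemeasurable]
    refine ENNReal.tsum_le_tsum fun j => ?_
    rw [lintegral_const_mul _ (measurable_one.indicator (hA j)), lintegral_indicator_one (hA j)]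
    rcases eq_or_ne (μ (A j)) 0 with h | h
    · simp [h]
    · nth_rewrite 2 [← ENNReal.rpow_one (μ (A j))]
      rw [← ENNReal.rpow_add _ _ h (measure_ne_top _ _), sub_add_cancel]
  filter_upwards [hT.ae_eventually_cube_average_le hG hGs] with x hx
  filter_upwards [hx] with R hR
  set V : ℝ≥0∞ := ((cube d R).card : ℝ≥0∞) with hV
  have hV0 : V ≠ 0 := by rw [hV, card_cube]; positivity
  have hVt : V ≠ ⊤ := ENNReal.natCast_ne_top _
  have hVθ : V ^ θ = 2 * R + 1 := by
    rw [hV, card_cube, Nat.cast_pow, ← ENNReal.rpow_natCast, ← ENNReal.rpow_mul, hθ,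
      mul_one_div_cancel hd0, ENNReal.rpow_one]
    push_cast; rfl
  set N : ι → ℝ≥0∞ := fun j => (((cube d R).filter fun p => T p x ∈ A j).card : ℝ≥0∞) with hN
  have hsum : ∑ p ∈ cube d R, G (T p x) = ∑' j, μ (A j) ^ (θ - 1) * N j := by
    rw [← Summable.tsum_finsetSum fun _ _ => ENNReal.summable]
    refine tsum_congr fun j => ?_
    rw [← Finset.mul_sum, hN]
    simp only [Finset.natCast_card_filter, Set.indicator_apply, Pi.one_apply]
  calc ∑' j, N j ^ θ ≤ ∑' j, V ^ θ * (μ (A j) ^ θ + V⁻¹ * (μ (A j) ^ (θ - 1) * N j)) := by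
        refine ENNReal.tsum_le_tsum fun j => ?_
        have h1 : N j = V * (V⁻¹ * N j) := by
          rw [← mul_assoc, ENNReal.mul_inv_cancel hV0 hVt, one_mul]
        have h2 : V⁻¹ * N j ≠ ⊤ :=
          ENNReal.mul_ne_top (ENNReal.inv_ne_top.2 hV0) (ENNReal.natCast_ne_top _)
        calc N j ^ θ = V ^ θ * (V⁻¹ * N j) ^ θ := by
              rw [← ENNReal.mul_rpow_of_nonneg _ _ hθ0.le, ← h1]
          _ ≤ V ^ θ * (μ (A j) ^ θ + μ (A j) ^ (θ - 1) * (V⁻¹ * N j)) := by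
              gcongr
              exact rpow_le_rpow_add_mul hθ0.le hθ1 _ h2
          _ = _ := by ring
    _ = V ^ θ * (∑' j, μ (A j) ^ θ + V⁻¹ * ∑ p ∈ cube d R, G (T p x)) := by
        rw [ENNReal.tsum_mul_left, ENNReal.tsum_add, ENNReal.tsum_mul_left, hsum]
    _ ≤ V ^ θ * (s + V⁻¹ * (12 ^ d * s * V)) := by gcongr
    _ = (2 * R + 1) * ((1 + 12 ^ d) * s) := by
        have : V⁻¹ * (12 ^ d * s * V) = 12 ^ d * s := by
          rw [mul_comm, mul_assoc, ENNReal.mul_inv_cancel hV0 hVt, mul_one]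
        rw [hVθ, this]; ring

end IsErgodicAction

namespace IsRandomSemimetric

variable {μ : Measure X} {T : (Fin d → ℤ) → X → X} {ρ : X → (Fin d → ℤ) → (Fin d → ℤ) → ℝ}

theorem exists_tail_lt [IsProbabilityMeasure μ]
    (hL : ∀ n : Fin d → ℤ, ∫⁻ t in Set.Ioi (0 : ℝ), (μ {x | t < ρ x 0 n}) ^ (1 / (d : ℝ)) < ⊤)
    {s : ℝ≥0∞} (hs : 0 < s) :
    ∃ l : ℕ, ∑ e ∈ cube d 1, ∑' i : ℕ, μ {x | ((i + l : ℕ) : ℝ) < ρ x 0 e} ^ (1 / (d : ℝ)) < s := by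
  have h1 : ∀ e : Fin d → ℤ, Tendsto
      (fun l : ℕ => ∑' i : ℕ, μ {x | ((i + l : ℕ) : ℝ) < ρ x 0 e} ^ (1 / (d : ℝ))) atTop (𝓝 0) := by
    intro e
    refine ENNReal.tendsto_sum_nat_add (fun i : ℕ => μ {x | (i : ℝ) < ρ x 0 e} ^ (1 / (d : ℝ))) ?_
    have hanti : Antitone fun t : ℝ => μ {x | t < ρ x 0 e} ^ (1 / (d : ℝ)) := fun t u htu =>
      ENNReal.rpow_le_rpow (measure_mono fun x (hx : u < ρ x 0 e) => htu.trans_lt hx)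
        (by positivity)
    rw [tsum_eq_zero_add' ENNReal.summable]
    refine ENNReal.add_ne_top.2 ⟨?_, ((tsum_le_lintegral_of_antitone hanti).trans_lt (hL e)).ne⟩
    exact ENNReal.rpow_ne_top_of_nonneg (by positivity) (measure_ne_top _ _)
  have h2 := tendsto_finsetSum (cube d 1) fun e _ => h1 e
  rw [Finset.sum_const_zero] at h2
  exact (h2.eventually_lt_const hs).exists

theorem sum_ofReal_le (hρ : IsRandomSemimetric T ρ) (x : X) (l : ℕ) (p : Fin d → ℤ) :
    ∑ e ∈ cube d 1, ENNReal.ofReal (ρ x p (p + e)) ≤ ((cube d 1).card * l : ℕ) +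
      ∑' j : cube d 1 × ℕ,
        {p | T p x ∈ {x | ((j.2 + l : ℕ) : ℝ) < ρ x 0 j.1}}.indicator (1 : (Fin d → ℤ) → ℝ≥0∞) p := by
  rw [ENNReal.tsum_prod', tsum_fintype, Finset.sum_coe_sort (cube d 1) fun e => ∑' i : ℕ,
    {p | T p x ∈ {x | ((i + l : ℕ) : ℝ) < ρ x 0 e}}.indicator (1 : (Fin d → ℤ) → ℝ≥0∞) p,
    Nat.cast_mul, ← nsmul_eq_mul, ← Finset.sum_const, ← Finset.sum_add_distrib]
  refine Finset.sum_le_sum fun e _ => ?_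
  refine (ofReal_le_natCast_add_tsum _ l).trans (le_of_eq ?_)
  congr 1
  refine tsum_congr fun i => ?_
  simp [Set.indicator_apply, hρ.equiv, add_comm e p]

/-- Asymptotic equicontinuity of random semimetrics in the Lorentz class `L^{d,1}`. -/
theorem ae_isAsymptoticallyEquicontinuous [IsProbabilityMeasure μ] (hρ : IsRandomSemimetric T ρ)
    (hT : IsErgodicAction μ T) (hd : 1 ≤ d)
    (hL : ∀ n : Fin d → ℤ, ∫⁻ t in Set.Ioi (0 : ℝ), (μ {x | t < ρ x 0 n}) ^ (1 / (d : ℝ)) < ⊤) :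
    ∀ᵐ x ∂μ, IsAsymptoticallyEquicontinuous (ρ x) := by
  classical
  have key : ∀ η : ℝ, 0 < η → ∀ᵐ x ∂μ, ∃ δ : ℝ, 0 < δ ∧ ∃ R₀ : ℕ, ∀ R : ℕ, R₀ ≤ R →
      ∀ y ∈ cube d R, ∀ z ∈ cube d R, (∀ k, |(y k : ℝ) - z k| ≤ δ * R) → ρ x y z ≤ η * R := by
    intro η hη
    set K : ℝ := 4 * (1 + 16 ^ (d - 1)) * (1 + 12 ^ d) with hK
    have hK0 : 0 < K := by positivity
    set σ : ℝ := η / (22 * K) with hσ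
    have hσ0 : 0 < σ := by positivity
    obtain ⟨l, hl⟩ := exists_tail_lt hL (ENNReal.ofReal_pos.2 hσ0)
    have hA : ∀ j : cube d 1 × ℕ, MeasurableSet {x | ((j.2 + l : ℕ) : ℝ) < ρ x 0 j.1} :=
      fun j => measurableSet_lt measurable_const (hρ.meas _ _)
    have hs : ∑' j : cube d 1 × ℕ, μ {x | ((j.2 + l : ℕ) : ℝ) < ρ x 0 j.1} ^ (1 / (d : ℝ))
        < ENNReal.ofReal σ := by
      rw [ENNReal.tsum_prod', tsum_fintype]
      rwa [← Finset.sum_coe_sort (cube d 1)] at hl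
    filter_upwards [hT.ae_eventually_tsum_card_rpow_le hd hA hs] with x hx
    obtain ⟨R₁, hR₁⟩ := eventually_atTop.1 hx
    set c : ℕ := (cube d 1).card * l with hc
    set δ : ℝ := min (1 / 2) (η / (32 * (c + 1))) with hδ
    have hδ0 : 0 < δ := by positivity
    have hδc : δ * (32 * (c + 1)) ≤ η := by
      rw [← le_div_iff₀ (by positivity)]; exact min_le_right _ _
    refine ⟨δ, hδ0, max R₁ (⌈1 / δ⌉₊ + 1), fun R hR y hy z hz hyz => ?_⟩
    have hRR₁ : R₁ ≤ R := (le_max_left _ _).trans hR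
    have hR1 : 1 ≤ R := by omega
    have hR1' : (1 : ℝ) ≤ R := by exact_mod_cast hR1
    have hδR : 1 ≤ δ * R := by
      have h1 : ⌈1 / δ⌉₊ ≤ R := by omega
      have h2 : 1 / δ ≤ R := (Nat.le_ceil _).trans (by exact_mod_cast h1)
      rwa [div_le_iff₀ hδ0, mul_comm] at h2
    set a : ℕ := ⌊δ * R⌋₊ with ha
    have ha0 : 0 < a := Nat.floor_pos.2 hδR
    have haR : (a : ℝ) ≤ δ * R := Nat.floor_le (by positivity)
    have haR' : a ≤ R := by
      have : (a : ℝ) ≤ R := haR.trans (by nlinarith [min_le_left (1 / 2) (η / (32 * (c + 1)))])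
      exact_mod_cast this
    have hyz' : ∀ k, |y k - z k| ≤ a := by
      intro k
      rw [Int.abs_eq_natAbs]
      refine Int.ofNat_le.2 (Nat.le_floor ?_)
      rw [Nat.cast_natAbs]
      push_cast
      exact hyz k
    have hmain := semimetric_le_of_layers hd (hρ.nonneg x) (hρ.symm x) (hρ.refl x) (hρ.tri x)
      (hρ.sum_ofReal_le x l) ha0 hyz' hy hz
    have hcube : cube d (R + 4 * a) ⊆ cube d (5 * R) := fun p hp => mem_cube.2 fun k =>
      (mem_cube.1 hp k).trans (by push_cast; omega)
    have h5 := hR₁ (5 * R) (by omega)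
    have hle : ENNReal.ofReal (ρ x y z) ≤
        ENNReal.ofReal (8 * a * c + K * (10 * R + 1) * σ) := by
      refine hmain.trans ?_
      calc _ ≤ 8 * (a : ℝ≥0∞) * (c : ℕ) + 4 * (1 + 16 ^ (d - 1)) *
            ((2 * ((5 * R : ℕ) : ℝ≥0∞) + 1) * ((1 + 12 ^ d) * ENNReal.ofReal σ)) := by
            gcongr
            refine le_trans (ENNReal.tsum_le_tsum fun j => ?_) h5
            gcongr
            exact fun p hp => Finset.mem_filter.2
              ⟨hcube (Finset.mem_filter.1 hp).1, (Finset.mem_filter.1 hp).2⟩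
        _ = _ := by
            rw [ENNReal.ofReal_add (by positivity) (by positivity), hK,
              ENNReal.ofReal_mul (q := σ) (by positivity),
              ENNReal.ofReal_mul (q := 10 * R + 1) (by positivity)]
            have h1 : ENNReal.ofReal (8 * a * c) = 8 * (a : ℝ≥0∞) * (c : ℕ) := by
              rw [show (8 * a * c : ℝ) = ((8 * a * c : ℕ) : ℝ) by push_cast; rfl,
                ENNReal.ofReal_natCast]
              push_cast; rfl
            have h2 : ENNReal.ofReal (4 * (1 + 16 ^ (d - 1)) * (1 + 12 ^ d))
                = 4 * (1 + 16 ^ (d - 1)) * (1 + 12 ^ d) := by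
              rw [show (4 * (1 + 16 ^ (d - 1)) * (1 + 12 ^ d) : ℝ)
                = ((4 * (1 + 16 ^ (d - 1)) * (1 + 12 ^ d) : ℕ) : ℝ) by push_cast; rfl,
                ENNReal.ofReal_natCast]
              push_cast; rfl
            have h3 : ENNReal.ofReal (10 * R + 1) = 2 * ((5 * R : ℕ) : ℝ≥0∞) + 1 := by
              rw [show (10 * R + 1 : ℝ) = ((10 * R + 1 : ℕ) : ℝ) by push_cast; rfl,
                ENNReal.ofReal_natCast]
              push_cast; ring
            rw [h1, h2, h3]
            ring
    rw [ENNReal.ofReal_le_ofReal_iff (by positivity)] at hle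
    refine hle.trans ?_
    have h1 : 8 * a * c ≤ η / 4 * R := by
      calc 8 * a * c ≤ 8 * (δ * R) * (c + 1 : ℝ) := by gcongr; linarith
        _ = δ * (32 * (c + 1)) / 4 * R := by ring
        _ ≤ η / 4 * R := by gcongr
    have h2 : K * (10 * R + 1) * σ = η * (10 * R + 1) / 22 := by
      rw [hσ]; field_simp
    rw [h2]
    nlinarith
  have key' := ae_all_iff.2 fun j : ℕ => key (1 / (j + 1)) (by positivity)
  filter_upwards [key'] with x hx η hη
  obtain ⟨j, hj⟩ := exists_nat_one_div_lt hη
  obtain ⟨δ, hδ, R₀, h⟩ := hx j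
  exact ⟨δ, hδ, R₀, fun R hR y hy z hz hyz => (h R hR y hy z hz hyz).trans (by gcongr)⟩

end IsRandomSemimetric

end

section

variable {X : Type*} [MeasurableSpace X] {d : ℕ}

theorem exists_common_cube (v w : Fin d → ℤ) : ∃ B : ℕ, 0 < B ∧ v ∈ cube d B ∧ w ∈ cube d B := by
  obtain ⟨B₁, h₁⟩ := exists_mem_cube v
  obtain ⟨B₂, h₂⟩ := exists_mem_cube w
  refine ⟨B₁ + B₂ + 1, by omega, mem_cube.2 fun k => ?_, mem_cube.2 fun k => ?_⟩
  · have := mem_cube.1 h₁ k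
    push_cast; omega
  · have := mem_cube.1 h₂ k
    push_cast; omega

theorem IsAsymptoticallyEquicontinuous.eventually_le {r : (Fin d → ℤ) → (Fin d → ℤ) → ℝ}
    (hr : IsAsymptoticallyEquicontinuous r) (v w : Fin d → ℤ) {η : ℝ} (hη : 0 < η) :
    ∀ᶠ k : ℕ in atTop, r (k • v) (k • v + w) ≤ k * η := by
  obtain ⟨B, hB, hv, hw⟩ := exists_common_cube v w
  have hB' : (0 : ℝ) < B := by exact_mod_cast hB
  obtain ⟨δ, hδ, R₀, h⟩ := hr (η / (2 * B)) (by positivity)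
  have hev : ∀ᶠ k : ℕ in atTop, 1 / (2 * δ) ≤ k :=
    tendsto_natCast_atTop_atTop.eventually_ge_atTop _
  filter_upwards [hev, eventually_ge_atTop R₀, eventually_ge_atTop 1] with k hk hkR hk1
  have hk1' : (1 : ℤ) ≤ k := by exact_mod_cast hk1
  have hkv : ∀ i, |(k : ℤ) * v i| ≤ k * B := fun i => by
    rw [abs_mul, Nat.abs_cast]
    exact mul_le_mul_of_nonneg_left (mem_cube.1 hv i) (by positivity)
  have hmul : (B : ℤ) ≤ k * B := by nlinarith
  refine (h (2 * B * k) (by nlinarith) _ ?_ _ ?_ ?_).trans (le_of_eq ?_)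
  · refine mem_cube.2 fun i => ?_
    have := hkv i
    simp only [Pi.smul_apply, nsmul_eq_mul]
    push_cast
    nlinarith
  · refine mem_cube.2 fun i => ?_
    have h1 := abs_le.1 (hkv i)
    have h2 := abs_le.1 (mem_cube.1 hw i)
    simp only [Pi.add_apply, nsmul_eq_mul]
    change |(k : ℤ) * v i + w i| ≤ _
    push_cast
    rw [abs_le]
    constructor <;> linarith
  · intro i
    have h2 : |(w i : ℝ)| ≤ B := by exact_mod_cast mem_cube.1 hw i
    rw [div_le_iff₀ (by positivity)] at hk
    simp only [Pi.add_apply, Int.cast_add, sub_add_cancel_left, abs_neg]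
    push_cast
    nlinarith
  · push_cast
    field_simp

namespace IsErgodicAction

variable {μ : Measure X} {T : (Fin d → ℤ) → X → X}

theorem iterate_eq (hT : IsErgodicAction μ T) (v : Fin d → ℤ) (k : ℕ) :
    (T v)^[k] = T (k • v) := by
  induction k with
  | zero => simp [hT.zero]
  | succ k ih => rw [Function.iterate_succ, ih, succ_nsmul, hT.add]

theorem integral_comp (hT : IsErgodicAction μ T) {f : X → ℝ} (hf : Measurable f)
    (n : Fin d → ℤ) : ∫ x, f (T n x) ∂μ = ∫ x, f x ∂μ := by
  have := integral_map (μ := μ) (hT.mp n).measurable.aemeasurable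
    (f := f) hf.aestronglyMeasurable
  rw [(hT.mp n).map_eq] at this
  exact this.symm

end IsErgodicAction

theorem measurableSet_frequently_lt {f g : ℕ → X → ℝ} (hf : ∀ k, Measurable (f k))
    (hg : ∀ k, Measurable (g k)) : MeasurableSet {x | ∃ᶠ k in atTop, f k x < g k x} := by
  simp only [frequently_atTop, Set.ofPred_forall, Set.ofPred_exists, Set.ofPred_and]
  exact MeasurableSet.iInter fun N => MeasurableSet.iUnion fun k =>
    (MeasurableSet.const _).inter (measurableSet_lt (hf k) (hg k))

namespace IsRandomSemimetric

variable {μ : Measure X} {T : (Fin d → ℤ) → X → X} {ρ : X → (Fin d → ℤ) → (Fin d → ℤ) → ℝ}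

theorem integrable_zero_left [IsProbabilityMeasure μ] (hρ : IsRandomSemimetric T ρ) (hd : 1 ≤ d)
    (hL : ∀ n : Fin d → ℤ, ∫⁻ t in Set.Ioi (0 : ℝ), (μ {x | t < ρ x 0 n}) ^ (1 / (d : ℝ)) < ⊤)
    (n : Fin d → ℤ) : Integrable (fun x => ρ x 0 n) μ := by
  refine ⟨(hρ.meas 0 n).aestronglyMeasurable, ?_⟩
  rw [hasFiniteIntegral_iff_ofReal (ae_of_all _ fun x => hρ.nonneg x 0 n),
    lintegral_eq_lintegral_meas_lt μ (ae_of_all _ fun x => hρ.nonneg x 0 n)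
      (hρ.meas 0 n).aemeasurable]
  refine lt_of_le_of_lt (lintegral_mono fun t => ?_) (hL n)
  have hθ : 1 / (d : ℝ) ≤ 1 := by
    rw [div_le_one (by positivity)]
    exact_mod_cast hd
  calc μ {x | t < ρ x 0 n} = μ {x | t < ρ x 0 n} ^ (1 : ℝ) := (ENNReal.rpow_one _).symm
    _ ≤ _ := ENNReal.rpow_le_rpow_of_exponent_ge prob_le_one hθ

theorem apply_zero (hρ : IsRandomSemimetric T ρ) (x : X) (m n : Fin d → ℤ) :
    ρ (T m x) 0 n = ρ x m (n + m) := by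
  rw [hρ.equiv, zero_add]

theorem integral_neg (hρ : IsRandomSemimetric T ρ) (hT : IsErgodicAction μ T) (n : Fin d → ℤ) :
    ∫ x, ρ x 0 (-n) ∂μ = ∫ x, ρ x 0 n ∂μ := by
  rw [← hT.integral_comp (hρ.meas 0 (-n)) n]
  exact integral_congr_ae (ae_of_all _ fun x => by
    simp only [hρ.apply_zero, neg_add_cancel]
    exact hρ.symm _ _ _)

theorem integral_add_le (hρ : IsRandomSemimetric T ρ) (hT : IsErgodicAction μ T)
    (hI : ∀ n, Integrable (fun x => ρ x 0 n) μ) (n k : Fin d → ℤ) :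
    ∫ x, ρ x 0 (n + k) ∂μ ≤ ∫ x, ρ x 0 n ∂μ + ∫ x, ρ x 0 k ∂μ := by
  have hI' : Integrable (fun x => ρ (T n x) 0 k) μ := (hT.mp n).integrable_comp_of_integrable (hI k)
  rw [← hT.integral_comp (hρ.meas 0 k) n, ← integral_add (hI n) hI']
  refine integral_mono (hI _) ((hI n).add hI') fun x => ?_
  simp only [hρ.apply_zero, add_comm k n]
  exact hρ.tri _ _ _ _

/-- Almost surely, distances along a lattice direction grow at least at the mean rate. -/
theorem ae_eventually_ge [IsProbabilityMeasure μ] (hρ : IsRandomSemimetric T ρ)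
    (hT : IsErgodicAction μ T) (hI : ∀ n, Integrable (fun x => ρ x 0 n) μ)
    (hAE : ∀ᵐ x ∂μ, IsAsymptoticallyEquicontinuous (ρ x)) (v : Fin d → ℤ) {Λ a : ℝ}
    (hΛ : Tendsto (fun k : ℕ => (∫ x, ρ x 0 (k • v) ∂μ) / k) atTop (𝓝 Λ)) (ha : a < Λ) :
    ∀ᵐ x ∂μ, ∀ᶠ k : ℕ in atTop, k * a ≤ ρ x 0 (k • v) := by
  set W : Set X := {x | ∃ᶠ k : ℕ in atTop, ρ x 0 (k • v) < k * a} with hW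
  have hWm : MeasurableSet W := measurableSet_frequently_lt (fun k => hρ.meas _ _)
    fun k => measurable_const
  by_contra hcon
  have hW0 : μ W ≠ 0 := fun h => hcon <| by
    filter_upwards [measure_eq_zero_iff_ae_notMem.1 h] with x hx
    simpa [hW, not_frequently] using hx
  obtain ⟨a', haa', ha'Λ⟩ := exists_between ha
  have hneg : ∀ᵐ x ∂μ, ∃ k : ℕ, 1 ≤ k ∧ ρ x 0 (k • v) - k * a' ≤ 0 := by
    filter_upwards [hT.ae_exists_mem hWm hW0, hAE] with x ⟨m, hm⟩ hx
    have hη : 0 < (a' - a) / 2 := by linarith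
    have h1 : ∀ᶠ k : ℕ in atTop, ρ x 0 m / ((a' - a) / 2) ≤ k :=
      tendsto_natCast_atTop_atTop.eventually_ge_atTop _
    obtain ⟨k, hk, hk1, hk2, hk3⟩ := (hm.and_eventually
      (h1.and ((hx.eventually_le v m hη).and (eventually_ge_atTop 1)))).exists
    refine ⟨k, hk3, ?_⟩
    rw [hρ.apply_zero] at hk
    rw [div_le_iff₀ hη] at hk1
    have h2 := hρ.tri x 0 m (k • v)
    have h3 := hρ.tri x m (k • v + m) (k • v)
    rw [hρ.symm x (k • v + m)] at h3
    linarith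
  have hε : 0 < (Λ - a') / 2 := by linarith
  obtain ⟨C, hC⟩ := integral_le_of_subadditive (hT.mp v)
    (g := fun k x => ρ x 0 (k • v) - k * a')
    (fun k => (hρ.meas _ _).sub_const _) (fun k => (hI _).sub (integrable_const _))
    (fun x => by simp [hρ.refl]) (fun k l x => by
      rw [hT.iterate_eq, hρ.apply_zero, add_comm (l • v), ← add_nsmul]
      have := hρ.tri x 0 (k • v) ((k + l) • v)
      push_cast
      linarith) hneg hε
  have hlim : Tendsto (fun k : ℕ => a' + (Λ - a') / 2 + C / k) atTop
      (𝓝 (a' + (Λ - a') / 2 + 0)) :=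
    tendsto_const_nhds.add (tendsto_const_div_atTop_nhds_zero_nat C)
  have := le_of_tendsto_of_tendsto hΛ hlim (by
    filter_upwards [eventually_ge_atTop 1] with k hk
    have hk0 : (0 : ℝ) < k := by exact_mod_cast hk
    have h1 := hC k
    rw [integral_sub (hI _) (integrable_const _)] at h1
    simp only [integral_const, probReal_univ, one_smul] at h1
    rw [div_le_iff₀ hk0]
    have : C / k * k = C := div_mul_cancel₀ C hk0.ne'
    nlinarith)
  linarith

theorem le_birkhoffSum (hρ : IsRandomSemimetric T ρ) (hT : IsErgodicAction μ T) (w : Fin d → ℤ)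
    (j : ℕ) (x : X) : ρ x 0 (j • w) ≤ birkhoffSum (T w) (fun x => ρ x 0 w) j x := by
  induction j with
  | zero => simp [hρ.refl]
  | succ j ih =>
    rw [birkhoffSum_succ, hT.iterate_eq, hρ.apply_zero, add_comm w, ← succ_nsmul]
    linarith [hρ.tri x 0 (j • w) ((j + 1) • w)]

theorem ae_eventually_le [IsProbabilityMeasure μ] (hρ : IsRandomSemimetric T ρ)
    (hT : IsErgodicAction μ T) (hI : ∀ n, Integrable (fun x => ρ x 0 n) μ)
    (hAE : ∀ᵐ x ∂μ, IsAsymptoticallyEquicontinuous (ρ x)) (v : Fin d → ℤ) {Λ a : ℝ}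
    (hΛ : Tendsto (fun k : ℕ => (∫ x, ρ x 0 (k • v) ∂μ) / k) atTop (𝓝 Λ)) (ha : Λ < a) :
    ∀ᵐ x ∂μ, ∀ᶠ k : ℕ in atTop, ρ x 0 (k • v) ≤ k * a := by
  set W : Set X := {x | ∃ᶠ k : ℕ in atTop, k * a < ρ x 0 (k • v)} with hW
  have hWm : MeasurableSet W := measurableSet_frequently_lt (fun k => measurable_const)
    fun k => hρ.meas _ _
  by_contra hcon
  have hW0 : μ W ≠ 0 := fun h => hcon <| by
    filter_upwards [measure_eq_zero_iff_ae_notMem.1 h] with x hx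
    simpa [hW, not_frequently] using hx
  obtain ⟨a', hΛa', ha'a⟩ := exists_between ha
  obtain ⟨b, hΛb, hba'⟩ := exists_between hΛa'
  have hΛ0 : 0 ≤ Λ := ge_of_tendsto' hΛ fun k =>
    div_nonneg (integral_nonneg fun x => hρ.nonneg _ _ _) (Nat.cast_nonneg k)
  obtain ⟨N, hN, hN1⟩ := ((hΛ.eventually_lt_const hΛb).and (eventually_ge_atTop 1)).exists
  have hN0 : (0 : ℝ) < N := by exact_mod_cast hN1
  rw [div_lt_iff₀ hN0] at hN
  set w := N • v with hw
  have hneg : ∀ᵐ x ∂μ, ∃ j : ℕ, 1 ≤ j ∧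
      j * (N * b) - birkhoffSum (T w) (fun x => ρ x 0 w) j x ≤ 0 := by
    filter_upwards [hT.ae_exists_mem hWm hW0, hAE] with x ⟨m, hm⟩ hx
    have hη : 0 < (a - a') / 2 := by linarith
    have h1 : ∀ᶠ k : ℕ in atTop, ρ x 0 m / ((a - a') / 2) ≤ k :=
      tendsto_natCast_atTop_atTop.eventually_ge_atTop _
    have h2 : ∀ᶠ k : ℕ in atTop, ∀ r ∈ Finset.range N, ρ x ((k / N) • w) ((k / N) • w + r • v)
        ≤ (k / N : ℕ) * (N * (a' - b)) := by
      rw [Filter.eventually_all_finset]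
      intro r _
      exact (Nat.tendsto_div_const_atTop (by omega : N ≠ 0)).eventually
        (hx.eventually_le w (r • v) (by nlinarith))
    obtain ⟨k, hk, hk1, hk2, hk3, hk4⟩ := (hm.and_eventually
      (h1.and ((hx.eventually_le v m hη).and (h2.and (eventually_ge_atTop N))))).exists
    refine ⟨k / N, Nat.div_pos hk4 hN1, ?_⟩
    rw [hρ.apply_zero] at hk
    rw [div_le_iff₀ hη] at hk1
    have h3 := hρ.tri x m 0 (k • v + m)
    have h4 := hρ.tri x 0 (k • v) (k • v + m)
    rw [hρ.symm x m 0] at h3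
    have h5 := hk3 (k % N) (Finset.mem_range.2 (Nat.mod_lt _ hN1))
    have h6 : (k / N) • w + (k % N) • v = k • v := by
      rw [hw, ← mul_nsmul', ← add_nsmul, Nat.div_add_mod']
    rw [h6] at h5
    have h7 := hρ.le_birkhoffSum hT w (k / N) x
    have h8 := hρ.tri x 0 ((k / N) • w) (k • v)
    have h9 : ((k / N : ℕ) : ℝ) * N ≤ k := by exact_mod_cast Nat.div_mul_le_self k N
    nlinarith
  have hS : ∀ j, Measurable (birkhoffSum (T w) (fun x => ρ x 0 w) j) := fun j =>
    Finset.measurable_fun_sum _ fun i _ => (hρ.meas 0 w).comp ((hT.mp w).measurable.iterate i)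
  have hSi : ∀ j i, i ∈ Finset.range j → Integrable (fun x => ρ ((T w)^[i] x) 0 w) μ := fun j i _ =>
    ((hT.mp w).iterate i).integrable_comp_of_integrable (hI w)
  have hSint : ∀ j : ℕ, ∫ x, birkhoffSum (T w) (fun x => ρ x 0 w) j x ∂μ = j * ∫ x, ρ x 0 w ∂μ := by
    intro j
    simp only [birkhoffSum]
    rw [integral_finsetSum _ (hSi j)]
    simp only [hT.iterate_eq, hT.integral_comp (hρ.meas 0 w)]
    simp
  have hSI : ∀ j : ℕ, Integrable (birkhoffSum (T w) (fun x => ρ x 0 w) j) μ := fun j =>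
    integrable_finsetSum _ (hSi j)
  have hgap : 0 < (N * b - ∫ x, ρ x 0 w ∂μ) / 2 := by linarith
  obtain ⟨C, hC⟩ := integral_le_of_subadditive (hT.mp w)
    (g := fun j x => j * (N * b) - birkhoffSum (T w) (fun x => ρ x 0 w) j x)
    (fun j => (hS j).const_sub _) (fun j => (integrable_const _).sub (hSI j))
    (fun x => by simp) (fun k l x => by
      rw [birkhoffSum_add]
      push_cast
      linarith) hneg hgap
  obtain ⟨n, hn⟩ := exists_nat_gt (C / ((N * b - ∫ x, ρ x 0 w ∂μ) / 2))
  rw [div_lt_iff₀ hgap] at hn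
  have h1 := hC n
  rw [integral_sub (integrable_const _) (hSI n), hSint] at h1
  simp only [integral_const, probReal_univ, one_smul] at h1
  nlinarith

/-- Convergence of the rescaled distances along every lattice direction. -/
theorem ae_tendsto_nsmul [IsProbabilityMeasure μ] (hρ : IsRandomSemimetric T ρ)
    (hT : IsErgodicAction μ T) (hI : ∀ n, Integrable (fun x => ρ x 0 n) μ)
    (hAE : ∀ᵐ x ∂μ, IsAsymptoticallyEquicontinuous (ρ x)) {Λ : (Fin d → ℤ) → ℝ}
    (hΛ : ∀ v, Tendsto (fun k : ℕ => (∫ x, ρ x 0 (k • v) ∂μ) / k) atTop (𝓝 (Λ v))) :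
    ∀ᵐ x ∂μ, ∀ v, ∀ η > 0, ∀ᶠ k : ℕ in atTop, |ρ x 0 (k • v) - k * Λ v| ≤ k * η := by
  have h1 : ∀ᵐ x ∂μ, ∀ v, ∀ j : ℕ, ∀ᶠ k : ℕ in atTop, k * (Λ v - 1 / (j + 1)) ≤ ρ x 0 (k • v) :=
    ae_all_iff.2 fun v => ae_all_iff.2 fun j => hρ.ae_eventually_ge hT hI hAE v (hΛ v)
      (sub_lt_self _ (by positivity))
  have h2 : ∀ᵐ x ∂μ, ∀ v, ∀ j : ℕ, ∀ᶠ k : ℕ in atTop, ρ x 0 (k • v) ≤ k * (Λ v + 1 / (j + 1)) :=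
    ae_all_iff.2 fun v => ae_all_iff.2 fun j => hρ.ae_eventually_le hT hI hAE v (hΛ v)
      (lt_add_of_pos_right _ (by positivity))
  filter_upwards [h1, h2] with x h1 h2 v η hη
  obtain ⟨j, hj⟩ := exists_nat_one_div_lt hη
  filter_upwards [h1 v j, h2 v j] with k hk1 hk2
  have : (k : ℝ) * (1 / (j + 1)) ≤ k * η := by gcongr
  rw [abs_le]
  constructor <;> nlinarith

end IsRandomSemimetric

end

section

variable {d : ℕ}

theorem nsmul_ediv_approx {n : Fin d → ℤ} {R M : ℕ} (hn : n ∈ cube d R) (hM : 0 < M)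
    (hMR : M ≤ R) :
    (∀ i, |((R / M) • fun j => n j / ((R / M : ℕ) : ℤ)) i - n i| ≤ (R / M : ℕ)) ∧
      ((R / M) • fun j => n j / ((R / M : ℕ) : ℤ)) ∈ cube d (2 * R) ∧
      (fun j => n j / ((R / M : ℕ) : ℤ)) ∈ cube d (2 * M + 1) := by
  have hk : 0 < R / M := Nat.div_pos hMR hM
  have hkR : R / M ≤ R := Nat.div_le_self _ _
  have hRk : R < (R / M + 1) * M := by
    rw [mul_comm]; exact Nat.lt_mul_div_succ R hM
  generalize R / M = k at *
  have hk' : (0 : ℤ) < k := by exact_mod_cast hk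
  have hkR' : (k : ℤ) ≤ R := by exact_mod_cast hkR
  have hRk' : (R : ℤ) < (k + 1) * M := by exact_mod_cast hRk
  have happ : ∀ i, (k • fun j => n j / (k : ℤ)) i = k * (n i / (k : ℤ)) := fun i => by simp
  have hdiv : ∀ i, n i - k < k * (n i / (k : ℤ)) ∧ k * (n i / (k : ℤ)) ≤ n i := fun i => by
    have h1 := Int.mul_ediv_add_emod (n i) k
    have h2 := Int.emod_lt_of_pos (n i) hk'
    have h3 := Int.emod_nonneg (n i) hk'.ne'
    constructor <;> linarith
  refine ⟨fun i => ?_, mem_cube.2 fun i => ?_, mem_cube.2 fun i => ?_⟩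
  · rw [happ, abs_le]
    have := hdiv i
    constructor <;> linarith
  · rw [happ, abs_le]
    have := hdiv i
    have := abs_le.1 (mem_cube.1 hn i)
    push_cast
    constructor <;> linarith
  · have := hdiv i
    have := abs_le.1 (mem_cube.1 hn i)
    have hM' : (1 : ℤ) ≤ M := by exact_mod_cast hM
    have hRk2 : (R : ℤ) ≤ k * (2 * M) := by nlinarith
    rw [abs_le]
    push_cast
    constructor
    · refine le_of_mul_le_mul_left (a := (k : ℤ)) ?_ hk'
      nlinarith
    · refine le_of_mul_le_mul_left (a := (k : ℤ)) ?_ hk'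
      nlinarith

/-- Directional limits and equicontinuity give uniform convergence at infinity. -/
theorem IsAsymptoticallyEquicontinuous.finite_le_abs_sub {r : (Fin d → ℤ) → (Fin d → ℤ) → ℝ}
    (hr : IsAsymptoticallyEquicontinuous r) (hsymm : ∀ m n, r m n = r n m)
    (htri : ∀ m k n, r m n ≤ r m k + r k n) (L : Seminorm ℝ (Fin d → ℝ))
    (hdir : ∀ v : Fin d → ℤ, ∀ η > 0, ∀ᶠ k : ℕ in atTop,
      |r 0 (k • v) - k * L fun i => (v i : ℝ)| ≤ k * η) {ε : ℝ} (hε : 0 < ε) :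
    {n : Fin d → ℤ | ε * (∑ k, |(n k : ℝ)|) ≤ |r 0 n - L fun k => (n k : ℝ)|}.Finite := by
  obtain ⟨C, hC, hLC⟩ := exists_linear_bound (m := fun n : Fin d → ℤ => L fun k => (n k : ℝ))
    (by
      have : (fun k : Fin d => (((0 : Fin d → ℤ) k : ℤ) : ℝ)) = 0 := by ext; simp
      simp only [this, map_zero])
    (fun n => by
      have : (fun k : Fin d => (((-n) k : ℤ) : ℝ)) = -fun k => (n k : ℝ) := by ext; simp
      simp only [this, map_neg_eq_map])
    (fun n m => by
      have : (fun k : Fin d => (((n + m) k : ℤ) : ℝ)) = (fun k => (n k : ℝ)) + fun k => (m k : ℝ) := by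
        ext; simp
      simp only [this]
      exact map_add_le_add L _ _)
  obtain ⟨δ, hδ, R₀, hR₀⟩ := hr (ε / 8) (by positivity)
  obtain ⟨M, hM⟩ := exists_nat_gt (max (1 / δ) (4 * C * d / ε))
  have hM1 : 1 / δ < M := (le_max_left _ _).trans_lt hM
  have hM2 : 4 * C * d / ε < M := (le_max_right _ _).trans_lt hM
  have hM0' : (0 : ℝ) < M := lt_trans (by positivity) hM1
  have hM0 : 0 < M := by exact_mod_cast hM0'
  rw [div_lt_iff₀ hδ] at hM1
  rw [div_lt_iff₀ hε] at hM2
  have hev : ∀ᶠ k : ℕ in atTop, ∀ v ∈ cube d (2 * M + 1),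
      |r 0 (k • v) - k * L fun i => (v i : ℝ)| ≤ k * (ε / 4) :=
    (Filter.eventually_all_finset _).2 fun v _ => hdir v _ (by positivity)
  obtain ⟨k₀, hk₀⟩ := eventually_atTop.1 hev
  refine (cube d (M + M * k₀ + R₀)).finite_toSet.subset fun n hn => ?_
  by_contra hout
  set R : ℕ := ∑ k, (n k).natAbs with hR
  have hRsum : ∑ k, |(n k : ℝ)| = R := by
    rw [hR, Nat.cast_sum]
    exact Finset.sum_congr rfl fun k _ => by rw [Nat.cast_natAbs]; push_cast; rfl
  have hnR : n ∈ cube d R := mem_cube.2 fun k => by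
    rw [Int.abs_eq_natAbs]
    exact_mod_cast Finset.single_le_sum (f := fun k => (n k).natAbs)
      (fun _ _ => Nat.zero_le _) (Finset.mem_univ k)
  have hRbig : M + M * k₀ + R₀ < R := by
    by_contra! h
    exact hout <| Finset.mem_coe.2 <| mem_cube.2 fun k =>
      (mem_cube.1 hnR k).trans (by exact_mod_cast h)
  have hR0 : (0 : ℝ) < R := by exact_mod_cast (Nat.zero_le _).trans_lt hRbig
  have hkk : k₀ ≤ R / M := (Nat.le_div_iff_mul_le hM0).2 (by rw [mul_comm]; omega)
  obtain ⟨happ, hkv, hv⟩ := nsmul_ediv_approx hnR hM0 (by omega : M ≤ R)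
  have hkM : ((R / M : ℕ) : ℝ) * M ≤ R := by exact_mod_cast Nat.div_mul_le_self R M
  have hkR : ((R / M : ℕ) : ℝ) ≤ R := by exact_mod_cast Nat.div_le_self R M
  set k : ℕ := R / M with hk
  set v : Fin d → ℤ := fun j => n j / (k : ℤ) with hvdef
  have happ' : ∀ i, |((k • v) i : ℝ) - n i| ≤ k := fun i => by exact_mod_cast happ i
  have hk0 : (0 : ℝ) ≤ k := Nat.cast_nonneg k
  have h1 : r (k • v) n ≤ ε / 8 * (2 * R) := by
    have := hR₀ (2 * R) (by omega) (k • v) hkv n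
      (mem_cube.2 fun i => (mem_cube.1 hnR i).trans (by push_cast; omega)) fun i =>
        (happ' i).trans (by push_cast; nlinarith)
    exact_mod_cast this
  have h2 := abs_le.1 (hk₀ k hkk v hv)
  have hLkv : L (fun i => ((k • v) i : ℝ)) = k * L fun i => (v i : ℝ) := by
    have : (fun i => ((k • v) i : ℝ)) = (k : ℝ) • fun i => (v i : ℝ) := by ext; simp
    rw [this, map_smul_eq_mul, Real.norm_natCast]
  have h3 : |L (fun i => ((k • v) i : ℝ)) - L fun i => (n i : ℝ)| ≤ C * (d * k) := by
    refine (abs_sub_map_le_sub L _ _).trans ?_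
    have h4 := hLC (k • v - n)
    have h5 : (fun i => (((k • v - n) i : ℤ) : ℝ))
        = (fun i => ((k • v) i : ℝ)) - fun i => (n i : ℝ) := by ext; simp
    rw [h5] at h4
    refine h4.trans ?_
    gcongr
    calc ∑ i, |(((k • v - n) i : ℤ) : ℝ)| ≤ ∑ _i : Fin d, (k : ℝ) := by
          refine Finset.sum_le_sum fun i _ => ?_
          have := happ' i
          rwa [Pi.sub_apply, Int.cast_sub]
      _ = d * k := by simp
  have h4 : C * (d * k) ≤ ε / 4 * R := by
    have h5 : 4 * (C * (d * k)) ≤ k * M * ε := by nlinarith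
    nlinarith
  have h5 := htri 0 (k • v) n
  have h6 := htri 0 n (k • v)
  rw [hsymm n] at h6
  rw [hLkv] at h3
  have h7 := abs_le.1 h3
  have h8 : (k : ℝ) * (ε / 4) ≤ ε / 4 * R := by nlinarith
  have hn' : ε * R ≤ |r 0 n - L fun k => (n k : ℝ)| := by rw [← hRsum]; exact hn
  have h9 : |r 0 n - L fun k => (n k : ℝ)| ≤ 3 / 4 * (ε * R) := by
    rw [abs_le]
    constructor <;> linarith
  have h10 : 0 < ε * R := by positivity
  linarith

end

end AsymptoticShape

/-- **Asymptotic shape theorem.** If `ρ` is a random `ℤ^d`-semimetric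
modeled on an ergodic `ℤ^d`-space `(X, μ)` and `ρ(0,n) ∈ L^{d,1}(X,μ)` for every `n`,
then there is a seminorm `L` on `ℝ^d` with `(ρ_x(0,n) - L(n))/|n| → 0` as `|n| → ∞`,
almost everywhere. -/
theorem statement3
    {X : Type*} [MeasurableSpace X] (μ : Measure X) [IsProbabilityMeasure μ]
    (d : ℕ) (hd : 1 ≤ d)
    (T : (Fin d → ℤ) → X → X)
    (hT0 : T 0 = id)
    (hTadd : ∀ n m : Fin d → ℤ, T (n + m) = T n ∘ T m)
    (hTmp : ∀ n : Fin d → ℤ, MeasurePreserving (T n) μ μ)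
    (herg : ∀ A : Set X, MeasurableSet A → (∀ n : Fin d → ℤ, T n ⁻¹' A = A) →
      μ A = 0 ∨ μ A = 1)
    (ρ : X → (Fin d → ℤ) → (Fin d → ℤ) → ℝ)
    (hρ_nonneg : ∀ x m n, 0 ≤ ρ x m n)
    (hρ_symm : ∀ x m n, ρ x m n = ρ x n m)
    (hρ_refl : ∀ x m, ρ x m m = 0)
    (hρ_tri : ∀ x m k n, ρ x m n ≤ ρ x m k + ρ x k n)
    (hρ_equiv : ∀ (x : X) (k m n : Fin d → ℤ), ρ (T k x) m n = ρ x (m + k) (n + k))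
    (hρ_meas : ∀ m n, Measurable fun x => ρ x m n)
    (hLorentz : ∀ n : Fin d → ℤ,
      ∫⁻ t in Set.Ioi (0 : ℝ), (μ {x | t < ρ x 0 n}) ^ (1 / (d : ℝ)) < ⊤) :
    ∃ L : Seminorm ℝ (Fin d → ℝ), ∀ᵐ x ∂μ, ∀ ε > 0,
      {n : Fin d → ℤ |
        ε * (∑ k, |(n k : ℝ)|) ≤ |ρ x 0 n - L (fun k => (n k : ℝ))|}.Finite := by
  have hT : AsymptoticShape.IsErgodicAction μ T := ⟨hT0, hTadd, hTmp, herg⟩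
  have hρ : AsymptoticShape.IsRandomSemimetric T ρ :=
    ⟨hρ_nonneg, hρ_symm, hρ_refl, hρ_tri, hρ_equiv, hρ_meas⟩
  have hI := hρ.integrable_zero_left hd hLorentz
  have hAE := hρ.ae_isAsymptoticallyEquicontinuous hT hd hLorentz
  obtain ⟨L, hL⟩ := AsymptoticShape.exists_seminorm_tendsto
    (m := fun n => ∫ x, ρ x 0 n ∂μ) (by simp [hρ_refl]) (hρ.integral_neg hT)
    (hρ.integral_add_le hT hI)
  refine ⟨L, ?_⟩
  filter_upwards [hAE, hρ.ae_tendsto_nsmul hT hI hAE hL] with x hx hdir ε hε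
  exact hx.finite_le_abs_sub (hρ_symm x) (hρ_tri x) L hdir hε
end

section
/- (Boivin's lemma.) Let d ≥ 1, let T be an ergodic measure-preserving ℤ^d-action on a probability space (X,μ), and let ρ be a random ℤ^d-semimetric modeled on (X,μ,T). Suppose there is a constant C > 0 such that μ({x ∈ X : sup_{n ≠ 0} ρ_x(0,n)/|n| ≥ λ}) ≤ C/λ^d for all λ > 1. Then there exists a seminorm L on ℝ^d such that for μ-almost every x, (ρ_x(0,n) − L(n))/|n| → 0 as |n| → ∞; that is, for every ε > 0 there are only finitely many n ∈ ℤ^d with |ρ_x(0,n) − L(n)| ≥ ε|n|. -/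
open MeasureTheory

namespace Boivin

open Filter Topology

/-- The box of radius `R` around `k` in `ℤ^d`. -/
noncomputable def box {d : ℕ} (k : Fin d → ℤ) (R : ℕ) : Finset (Fin d → ℤ) :=
  Fintype.piFinset fun i => Finset.Icc (k i - R) (k i + R)

lemma mem_box {d : ℕ} {k j : Fin d → ℤ} {R : ℕ} : j ∈ box k R ↔ ‖j - k‖ ≤ R := by
  rw [pi_norm_le_iff_of_nonneg (Nat.cast_nonneg R)]
  simp only [box, Fintype.mem_piFinset, Finset.mem_Icc]
  refine forall_congr' fun i => ?_
  have : ‖(j - k) i‖ ≤ (R : ℝ) ↔ |j i - k i| ≤ (R : ℤ) := by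
    rw [Pi.sub_apply, Int.norm_eq_abs]
    exact_mod_cast Iff.rfl
  rw [this, abs_le]
  constructor <;> intro h <;> constructor <;> linarith [h.1, h.2]

lemma card_box {d : ℕ} (k : Fin d → ℤ) (R : ℕ) : (box k R).card = (2 * R + 1) ^ d := by
  have (i : Fin d) : (Finset.Icc (k i - R) (k i + R)).card = 2 * R + 1 := by
    rw [Int.card_Icc]; omega
  simp [box, this]

open Classical in
/-- Covering estimate: if every point of `A` is the centre of a box in which `P` has density at
least `t`, then `A` is not much larger than the set where `P` holds. -/
lemma card_le_of_density {d : ℕ} (P : (Fin d → ℤ) → Prop) (A S : Finset (Fin d → ℤ))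
    (r : (Fin d → ℤ) → ℕ) {t : ℝ} (ht : 0 ≤ t)
    (hr : ∀ k ∈ A, t * (2 * r k + 1) ^ d ≤ ((box k (r k)).filter P).card)
    (hS : ∀ k ∈ A, box k (r k) ⊆ S) :
    t * A.card ≤ 5 ^ d * (S.filter P).card := by
  obtain ⟨u, huA, hdis, hcov⟩ := Vitali.exists_disjoint_subfamily_covering_enlargement_closedBall
    (A : Set (Fin d → ℤ)) id (fun k => (r k : ℝ)) (A.sup r : ℕ)
    (fun a ha => Nat.cast_le.2 (Finset.le_sup (f := r) ha)) 5 (by norm_num)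
  lift u to Finset (Fin d → ℤ) using A.finite_toSet.subset huA
  have huA' : u ⊆ A := by exact_mod_cast huA
  have h1 : A ⊆ u.biUnion fun b => box b (5 * r b) := by
    intro a ha
    obtain ⟨b, hb, hab⟩ := hcov a ha
    refine Finset.mem_biUnion.2 ⟨b, hb, mem_box.2 ?_⟩
    have := hab (Metric.mem_closedBall_self (Nat.cast_nonneg (r a)))
    rw [Metric.mem_closedBall, dist_eq_norm] at this
    simpa using this
  have h2 : (A.card : ℝ) ≤ ∑ b ∈ u, 5 ^ d * (2 * r b + 1 : ℝ) ^ d := by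
    calc (A.card : ℝ) ≤ (∑ b ∈ u, (box b (5 * r b)).card : ℕ) := by
          exact_mod_cast (Finset.card_le_card h1).trans Finset.card_biUnion_le
      _ = ∑ b ∈ u, (2 * (5 * r b) + 1 : ℝ) ^ d := by
          push_cast [card_box]; rfl
      _ ≤ _ := by
          refine Finset.sum_le_sum fun b _ => ?_
          rw [← mul_pow]
          gcongr
          linarith
  have h3 : ∑ b ∈ u, ((box b (r b)).filter P).card ≤ (S.filter P).card := by
    rw [← Finset.card_biUnion]
    · refine Finset.card_le_card fun j hj => ?_
      obtain ⟨b, hb, hjb⟩ := Finset.mem_biUnion.1 hj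
      rw [Finset.mem_filter] at hjb ⊢
      exact ⟨hS b (huA' hb) hjb.1, hjb.2⟩
    · intro a ha b hb hab
      refine Finset.disjoint_left.2 fun j hja hjb => ?_
      refine Set.disjoint_left.1 (hdis ha hb hab) (?_ : j ∈ _) ?_
      all_goals simp only [id, Metric.mem_closedBall, dist_eq_norm]
      · exact mem_box.1 (Finset.mem_filter.1 hja).1
      · exact mem_box.1 (Finset.mem_filter.1 hjb).1
  calc t * A.card ≤ t * ∑ b ∈ u, 5 ^ d * (2 * r b + 1 : ℝ) ^ d := by gcongr
    _ = 5 ^ d * ∑ b ∈ u, t * (2 * r b + 1 : ℝ) ^ d := by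
        rw [Finset.mul_sum, Finset.mul_sum]; exact Finset.sum_congr rfl fun _ _ => by ring
    _ ≤ 5 ^ d * ∑ b ∈ u, (((box b (r b)).filter P).card : ℝ) := by
        gcongr with b hb; exact hr b (huA' hb)
    _ ≤ _ := by gcongr; exact_mod_cast h3

/-- A measure-preserving action of `ℤ^d`. -/
structure IsPMPAction {X : Type*} [MeasurableSpace X] (μ : Measure X) {d : ℕ}
    (T : (Fin d → ℤ) → X → X) : Prop where
  add : ∀ n m, T (n + m) = T n ∘ T m
  mp : ∀ n, MeasurePreserving (T n) μ μ

section Maximal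

variable {X : Type*} {d : ℕ} {T : (Fin d → ℤ) → X → X}

open Classical in
/-- The points whose orbit visits `B` with density at least `t` in the box of radius `R`. -/
def denseVisits (T : (Fin d → ℤ) → X → X) (B : Set X) (t : ℝ) (R : ℕ) : Set X :=
  {x | t * (2 * R + 1) ^ d ≤ ((box 0 R).filter fun k => T k x ∈ B).card}

lemma exists_notMem_of_notMem_denseVisits {B : Set X} {t : ℝ} {R : ℕ} {x : X}
    (hx : x ∉ denseVisits T B t R) {S : Finset (Fin d → ℤ)} (hS : S ⊆ box 0 R)
    (hcard : t * (2 * R + 1) ^ d ≤ S.card) : ∃ y ∈ S, T y x ∉ B := by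
  classical
  by_contra! hcon
  refine hx (hcard.trans (Nat.cast_le.2 (Finset.card_le_card fun y hy => ?_)))
  exact Finset.mem_filter.2 ⟨hS hy, hcon y hy⟩

open Classical in
lemma card_filter_eq_sum (T : (Fin d → ℤ) → X → X) (B : Set X) (S : Finset (Fin d → ℤ)) (x : X) :
    ((S.filter fun k => T k x ∈ B).card : ENNReal) =
      ∑ k ∈ S, (T k ⁻¹' B).indicator (fun _ => 1) x := by
  rw [Finset.card_filter]
  push_cast
  exact Finset.sum_congr rfl fun k _ => by simp [Set.indicator_apply]

variable [MeasurableSpace X] {μ : Measure X}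

lemma measurableSet_denseVisits (hT : IsPMPAction μ T) {B : Set X} (hB : MeasurableSet B) (t : ℝ)
    (R : ℕ) : MeasurableSet (denseVisits T B t R) := by
  refine measurableSet_le measurable_const ?_
  simp only [Finset.card_filter]
  push_cast
  refine Finset.measurable_sum _ fun k _ => ?_
  exact Measurable.ite ((hT.mp k).measurable hB) measurable_const measurable_const

open Classical in
lemma lintegral_card_filter (hT : IsPMPAction μ T) {B : Set X} (hB : MeasurableSet B)
    (S : Finset (Fin d → ℤ)) :
    ∫⁻ x, ((S.filter fun k => T k x ∈ B).card : ENNReal) ∂μ = S.card * μ B := by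
  simp only [card_filter_eq_sum]
  rw [lintegral_finsetSum]
  · rw [Finset.sum_congr rfl fun k _ => by
      rw [lintegral_indicator_const ((hT.mp k).measurable hB),
        (hT.mp k).measure_preimage hB.nullMeasurableSet, one_mul]]
    simp
  · exact fun k _ => measurable_const.indicator ((hT.mp k).measurable hB)

lemma measure_iUnion_le_denseVisits (hT : IsPMPAction μ T) {B : Set X} (hB : MeasurableSet B)
    {t : ℝ} (ht : 0 < t) (R : ℕ) :
    ENNReal.ofReal t * μ (⋃ r ≤ R, denseVisits T B t r) ≤ 10 ^ d * μ B := by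
  classical
  set E := ⋃ r ≤ R, denseVisits T B t r with hE
  have hEm : MeasurableSet E := MeasurableSet.iUnion fun r => MeasurableSet.iUnion fun _ =>
    measurableSet_denseVisits hT hB t r
  have key (x : X) : ENNReal.ofReal t * (((box (0 : Fin d → ℤ) R).filter fun k => T k x ∈ E).card)
      ≤ 5 ^ d * (((box (0 : Fin d → ℤ) (2 * R)).filter fun k => T k x ∈ B).card) := by
    have h (k : Fin d → ℤ) : ∃ r ≤ R, T k x ∈ E → T k x ∈ denseVisits T B t r := by
      by_cases hk : T k x ∈ E
      · simp only [hE, Set.mem_iUnion] at hk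
        obtain ⟨r, hr, h⟩ := hk
        exact ⟨r, hr, fun _ => h⟩
      · exact ⟨0, Nat.zero_le _, fun h => absurd h hk⟩
    choose r hrR hr using h
    have := card_le_of_density (fun k => T k x ∈ B)
      ((box (0 : Fin d → ℤ) R).filter fun k => T k x ∈ E) (box 0 (2 * R)) r ht.le ?_ ?_
    · have h2 := ENNReal.ofReal_le_ofReal this
      rw [ENNReal.ofReal_mul ht.le, ENNReal.ofReal_mul (by positivity)] at h2
      simpa [ENNReal.ofReal_pow] using h2
    · intro k hk
      have hk' := hr k (Finset.mem_filter.1 hk).2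
      refine le_trans (show _ ≤ _ from hk') ?_
      rw [Nat.cast_le]
      refine Finset.card_le_card_of_injOn (fun j => j + k) ?_ (fun a _ b _ h => by simpa using h)
      intro j hj
      rw [Finset.mem_coe, Finset.mem_filter, mem_box] at hj ⊢
      refine ⟨by simpa using hj.1, ?_⟩
      rw [hT.add]; exact hj.2
    · intro k hk j hj
      have hk' := mem_box.1 (Finset.mem_filter.1 hk).1
      rw [mem_box] at hj ⊢
      have h3 : (r k : ℝ) ≤ R := Nat.cast_le.2 (hrR k)
      calc ‖j - 0‖ = ‖(j - k) + (k - 0)‖ := by congr 1; abel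
        _ ≤ ‖j - k‖ + ‖k - 0‖ := norm_add_le _ _
        _ ≤ (2 * R : ℕ) := by push_cast; linarith
  have hint := lintegral_mono (μ := μ) key
  have hm (B : Set X) (hB : MeasurableSet B) (S : Finset (Fin d → ℤ)) :
      Measurable fun x => ((S.filter fun k => T k x ∈ B).card : ENNReal) := by
    simp only [card_filter_eq_sum]
    exact Finset.measurable_sum _ fun k _ =>
      measurable_const.indicator ((hT.mp k).measurable hB)
  rw [lintegral_const_mul _ (hm E hEm _), lintegral_const_mul _ (hm B hB _),
    lintegral_card_filter hT hEm, lintegral_card_filter hT hB, card_box, card_box] at hint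
  have hle : (((2 * (2 * R) + 1) ^ d : ℕ) : ENNReal) ≤ 2 ^ d * ((2 * R + 1) ^ d : ℕ) := by
    have : (2 * (2 * R) + 1) ^ d ≤ 2 ^ d * (2 * R + 1) ^ d := by
      rw [← mul_pow]; gcongr; omega
    exact_mod_cast this
  have hne : (((2 * R + 1) ^ d : ℕ) : ENNReal) ≠ 0 := by
    exact_mod_cast pow_ne_zero d (Nat.succ_ne_zero _)
  rw [← ENNReal.mul_le_mul_iff_right hne (ENNReal.natCast_ne_top _)]
  calc (((2 * R + 1) ^ d : ℕ) : ENNReal) * (ENNReal.ofReal t * μ E)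
      = ENNReal.ofReal t * (((2 * R + 1) ^ d : ℕ) * μ E) := by ring
    _ ≤ 5 ^ d * (((2 * (2 * R) + 1) ^ d : ℕ) * μ B) := hint
    _ ≤ 5 ^ d * ((2 ^ d * ((2 * R + 1) ^ d : ℕ)) * μ B) := by gcongr
    _ = _ := by
      rw [show (10 : ENNReal) = 5 * 2 by norm_num, mul_pow]; ring

/-- The weak type maximal inequality for indicator functions. -/
lemma maximal_inequality (hT : IsPMPAction μ T) {B : Set X} (hB : MeasurableSet B)
    {t : ℝ} (ht : 0 < t) :
    ENNReal.ofReal t * μ (⋃ R, denseVisits T B t R) ≤ 10 ^ d * μ B := by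
  have hmono : Monotone fun R => ⋃ r ≤ R, denseVisits T B t r := fun R R' h =>
    Set.biUnion_subset_biUnion_left fun r hr => le_trans hr h
  have heq : ⋃ R, denseVisits T B t R = ⋃ R, ⋃ r ≤ R, denseVisits T B t r := by
    ext x
    simp only [Set.mem_iUnion]
    exact ⟨fun ⟨R, h⟩ => ⟨R, R, le_rfl, h⟩, fun ⟨_, r, _, h⟩ => ⟨r, h⟩⟩
  rw [heq, hmono.measure_iUnion, ENNReal.mul_iSup]
  exact iSup_le fun R => measure_iUnion_le_denseVisits hT hB ht R

lemma tendsto_measure_denseVisits (hT : IsPMPAction μ T) {B : ℕ → Set X}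
    (hB : ∀ c, MeasurableSet (B c)) (hlim : Tendsto (fun c => μ (B c)) atTop (𝓝 0))
    {t : ℝ} (ht : 0 < t) :
    Tendsto (fun c => μ (⋃ R, denseVisits T (B c) t R)) atTop (𝓝 0) := by
  have ht' : ENNReal.ofReal t ≠ 0 := by simpa using ht
  have h : Tendsto (fun c => (ENNReal.ofReal t)⁻¹ * (10 ^ d * μ (B c))) atTop (𝓝 0) := by
    have := ENNReal.Tendsto.const_mul (a := (ENNReal.ofReal t)⁻¹ * 10 ^ d) hlim
      (Or.inr (ENNReal.mul_ne_top (ENNReal.inv_ne_top.2 ht') (by finiteness)))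
    simpa [mul_assoc] using this
  refine tendsto_of_tendsto_of_tendsto_of_le_of_le tendsto_const_nhds h (fun _ => zero_le) ?_
  intro c
  simp only
  rw [← ENNReal.mul_le_mul_iff_right ht' ENNReal.ofReal_ne_top, ← mul_assoc,
    ENNReal.mul_inv_cancel ht' ENNReal.ofReal_ne_top, one_mul]
  exact maximal_inequality hT (hB c) ht

end Maximal

/-- A random `ℤ^d`-semimetric modeled on an ergodic measure-preserving `ℤ^d`-action. -/
structure IsErgodicSemimetric {X : Type*} [MeasurableSpace X] (μ : Measure X) {d : ℕ}
    (T : (Fin d → ℤ) → X → X) (ρ : X → (Fin d → ℤ) → (Fin d → ℤ) → ℝ) : Prop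
    extends IsPMPAction μ T where
  erg : ∀ A : Set X, MeasurableSet A → (∀ n, T n ⁻¹' A = A) → μ A = 0 ∨ μ A = 1
  nonneg : ∀ x m n, 0 ≤ ρ x m n
  symm : ∀ x m n, ρ x m n = ρ x n m
  refl : ∀ x m, ρ x m m = 0
  tri : ∀ x m k n, ρ x m n ≤ ρ x m k + ρ x k n
  equiv : ∀ x k m n, ρ (T k x) m n = ρ x (m + k) (n + k)
  meas : ∀ m n, Measurable fun x => ρ x m n

lemma ae_exists_notMem_of_tendsto_measure {X : Type*} [MeasurableSpace X] {μ : Measure X}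
    {S : ℕ → Set X} (h : Tendsto (fun c => μ (S c)) atTop (𝓝 0)) : ∀ᵐ x ∂μ, ∃ c, x ∉ S c := by
  rw [ae_iff]
  push Not
  refine le_antisymm (ge_of_tendsto' h fun c => measure_mono fun x hx => hx c) zero_le

lemma tendsto_measure_compl_of_ae_exists {X : Type*} [MeasurableSpace X] {μ : Measure X}
    [IsFiniteMeasure μ] {S : ℕ → Set X} (hS : ∀ c, MeasurableSet (S c)) (hmono : Monotone S)
    (h : ∀ᵐ x ∂μ, ∃ c, x ∈ S c) : Tendsto (fun c => μ (S c)ᶜ) atTop (𝓝 0) := by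
  have h0 : μ (⋂ c, (S c)ᶜ) = 0 := by
    rw [← Set.compl_iUnion]
    simpa [ae_iff, Set.compl_def] using h
  rw [← h0]
  exact tendsto_measure_iInter_atTop (fun c => (hS c).compl.nullMeasurableSet)
    (fun a b hab => Set.compl_subset_compl.2 (hmono hab)) ⟨0, measure_ne_top _ _⟩

/-- The points from which all distances are at most `C * ‖n‖ + c`. -/
def boundedSet {X : Type*} {d : ℕ} (ρ : X → (Fin d → ℤ) → (Fin d → ℤ) → ℝ) (C : ℝ) (c : ℕ) :
    Set X :=
  {x | ∀ n, ρ x 0 n ≤ C * ‖n‖ + c}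

lemma boundedSet_mono {X : Type*} {d : ℕ} (ρ : X → (Fin d → ℤ) → (Fin d → ℤ) → ℝ) (C : ℝ) :
    Monotone (boundedSet ρ C) := fun a b hab x hx n => by
  have : (a : ℝ) ≤ b := Nat.cast_le.2 hab
  linarith [hx n]

/-- At large scales the semimetric is Lipschitz with constant `C`. -/
def AsympLipschitz {d : ℕ} (ρ : (Fin d → ℤ) → (Fin d → ℤ) → ℝ) (C : ℝ) : Prop :=
  ∀ δ > 0, ∃ c, ∀ m n, ρ m n ≤ C * ‖m - n‖ + δ * ‖n‖ + c

namespace IsErgodicSemimetric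

variable {X : Type*} [MeasurableSpace X] {μ : Measure X} {d : ℕ}
  {T : (Fin d → ℤ) → X → X} {ρ : X → (Fin d → ℤ) → (Fin d → ℤ) → ℝ}

lemma measure_eq_zero_or_one (h : IsErgodicSemimetric μ T ρ) {A : Set X} (hA : MeasurableSet A)
    (hinv : ∀ n, T n ⁻¹' A =ᵐ[μ] A) : μ A = 0 ∨ μ A = 1 := by
  have hae : (⋂ n, T n ⁻¹' A) =ᵐ[μ] A := by
    have := Filter.EventuallyEq.countable_iInter hinv
    rwa [Set.iInter_const] at this
  rw [← measure_congr hae]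
  refine h.erg _ (MeasurableSet.iInter fun n => (h.mp n).measurable hA) fun m => ?_
  rw [Set.preimage_iInter]
  simp only [← Set.preimage_comp, ← h.add]
  exact (Equiv.addRight m).surjective.iInter_comp fun n => T n ⁻¹' A

lemma exists_ae_eq_const [IsProbabilityMeasure μ] (h : IsErgodicSemimetric μ T ρ)
    {f : X → ENNReal} (hf : Measurable f)
    (hinv : ∀ n, f ∘ T n =ᵐ[μ] f) : ∃ c, ∀ᵐ x ∂μ, f x = c := by
  refine exists_eventuallyEq_const_of_forall_separating (l := ae μ) MeasurableSet fun U hU => ?_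
  have hae (n : Fin d → ℤ) : T n ⁻¹' (f ⁻¹' U) =ᵐ[μ] f ⁻¹' U := by
    filter_upwards [hinv n] with x hx
    exact propext (show f (T n x) ∈ U ↔ f x ∈ U by rw [← hx]; rfl)
  rcases h.measure_eq_zero_or_one (hf hU) hae with h0 | h1
  · exact Or.inr (measure_eq_zero_iff_ae_notMem.1 h0)
  · exact Or.inl ((prob_compl_eq_zero_iff (hf hU)).2 h1)

lemma measurableSet_boundedSet (h : IsErgodicSemimetric μ T ρ) (C : ℝ) (c : ℕ) :
    MeasurableSet (boundedSet ρ C c) := by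
  rw [boundedSet, Set.ofPred_forall]
  exact MeasurableSet.iInter fun n => measurableSet_le (h.meas 0 n) measurable_const

lemma add_mem_bounded (h : IsErgodicSemimetric μ T ρ) {C : ℝ} (hC : 0 ≤ C) {x : X}
    (k : Fin d → ℤ) (hx : ∃ c, x ∈ boundedSet ρ C c) : ∃ c, T k x ∈ boundedSet ρ C c := by
  obtain ⟨c, hc⟩ := hx
  obtain ⟨c', hc'⟩ := exists_nat_ge (ρ x 0 k + C * ‖k‖ + c)
  refine ⟨c', fun n => ?_⟩
  rw [h.equiv, zero_add]
  have h1 := h.tri x k 0 (n + k)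
  have h2 := hc (n + k)
  have h3 := mul_le_mul_of_nonneg_left (norm_add_le n k) hC
  rw [h.symm x k 0] at h1
  linarith

lemma exists_linear_bound [IsProbabilityMeasure μ] (h : IsErgodicSemimetric μ T ρ)
    (hzero : T 0 = id) (hfin : ∀ᵐ x ∂μ, ∃ C : ℕ, ∀ n, ρ x 0 n ≤ C * ‖n‖) :
    ∃ C : ℝ, 0 ≤ C ∧ ∀ᵐ x ∂μ, ∃ c, x ∈ boundedSet ρ C c := by
  by_contra hcon
  have hnull (C : ℕ) : μ {x | ∃ c, x ∈ boundedSet ρ C c} = 0 := by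
    have hm : MeasurableSet {x | ∃ c, x ∈ boundedSet ρ C c} := by
      rw [Set.ofPred_exists]
      exact MeasurableSet.iUnion fun c => h.measurableSet_boundedSet C c
    refine (h.erg _ hm fun k => ?_).resolve_right fun h1 =>
      hcon ⟨C, Nat.cast_nonneg C, (prob_compl_eq_zero_iff hm).2 h1⟩
    ext x
    refine ⟨fun hx => ?_, h.add_mem_bounded (Nat.cast_nonneg C) k⟩
    have := h.add_mem_bounded (Nat.cast_nonneg C) (-k) hx
    rwa [← Function.comp_apply (f := T (-k)), ← h.add, neg_add_cancel, hzero] at this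
  have hall : ∀ᵐ x ∂μ, ∀ C : ℕ, ¬ ∃ c, x ∈ boundedSet ρ C c :=
    ae_all_iff.2 fun C => measure_eq_zero_iff_ae_notMem.1 (hnull C)
  obtain ⟨x, ⟨C, hC⟩, hx⟩ := (hfin.and hall).exists
  exact hx C ⟨0, fun n => by simpa using hC n⟩

lemma dist_le_of_mem_boundedSet (h : IsErgodicSemimetric μ T ρ) {C : ℝ} {c : ℕ} {x : X}
    {y : Fin d → ℤ} (hy : T y x ∈ boundedSet ρ C c) (z : Fin d → ℤ) :
    ρ x y z ≤ C * ‖z - y‖ + c := by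
  have := hy (z - y)
  rwa [h.equiv, zero_add, sub_add_cancel] at this

lemma ae_asympLipschitz [IsProbabilityMeasure μ] (h : IsErgodicSemimetric μ T ρ)
    {C : ℝ} (hC : 0 ≤ C)
    (hb : ∀ᵐ x ∂μ, ∃ c, x ∈ boundedSet ρ C c) : ∀ᵐ x ∂μ, AsympLipschitz (ρ x) C := by
  have hdense : ∀ᵐ x ∂μ, ∀ p : ℕ, ∃ c, x ∉ ⋃ R, denseVisits T (boundedSet ρ C c)ᶜ
      (((1 : ℝ) / (p + 1) / (1 + 1 / (p + 1))) ^ d) R := by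
    refine ae_all_iff.2 fun p => ae_exists_notMem_of_tendsto_measure ?_
    refine tendsto_measure_denseVisits h.toIsPMPAction
      (fun c => (h.measurableSet_boundedSet C c).compl) ?_ (by positivity)
    exact tendsto_measure_compl_of_ae_exists (h.measurableSet_boundedSet C)
      (boundedSet_mono ρ C) hb
  filter_upwards [hdense] with x hx δ' hδ'
  obtain ⟨p, hp⟩ := exists_nat_ge (2 * C / δ')
  obtain ⟨c, hc⟩ := hx p
  set δ : ℝ := 1 / (p + 1) with hδ
  have hδ0 : 0 < δ := by positivity
  have hδδ' : 2 * C * δ ≤ δ' := by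
    rw [div_le_iff₀ hδ'] at hp
    rw [hδ, mul_one_div, div_le_iff₀ (by positivity)]
    linarith
  refine ⟨2 * C * (δ + 1) + 2 * c, fun m n => ?_⟩
  obtain ⟨y, hy, hyG⟩ : ∃ y, ‖y - n‖ ≤ δ * ‖n‖ + δ + 1 ∧ T y x ∈ boundedSet ρ C c := by
    set N := ⌈‖n‖⌉₊
    set r := ⌈δ * N⌉₊
    have hN : ‖n‖ ≤ N := Nat.le_ceil _
    have hN' : (N : ℝ) ≤ ‖n‖ + 1 := (Nat.ceil_lt_add_one (norm_nonneg _)).le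
    have hr : δ * N ≤ r := Nat.le_ceil _
    have hr' : (r : ℝ) ≤ δ * N + 1 := (Nat.ceil_lt_add_one (by positivity)).le
    have hsub : box n r ⊆ box 0 (N + r) := by
      intro y hy
      rw [mem_box] at hy ⊢
      push_cast
      calc ‖y - 0‖ = ‖n + (y - n)‖ := by congr 1; abel
        _ ≤ ‖n‖ + ‖y - n‖ := norm_add_le _ _
        _ ≤ N + r := by linarith
    obtain ⟨y, hy, hyG⟩ := exists_notMem_of_notMem_denseVisits
      (fun h => hc (Set.mem_iUnion.2 ⟨N + r, h⟩)) hsub (by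
        rw [card_box, ← mul_pow]
        push_cast
        refine pow_le_pow_left₀ (by positivity) ?_ d
        rw [div_mul_eq_mul_div, div_le_iff₀ (by positivity)]
        nlinarith)
    exact ⟨y, by nlinarith [mem_box.1 hy], not_not.1 hyG⟩
  have h1 := h.dist_le_of_mem_boundedSet hyG n
  have h2 := h.dist_le_of_mem_boundedSet hyG m
  have h3 := h.tri x m y n
  rw [h.symm x m y] at h3
  have h4 : ‖m - y‖ ≤ ‖m - n‖ + ‖y - n‖ := by
    rw [norm_sub_rev y n]
    exact norm_sub_le_norm_sub_add_norm_sub m n y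
  rw [norm_sub_rev n y] at h1
  have h5 : C * ‖m - y‖ ≤ C * (‖m - n‖ + ‖y - n‖) := by gcongr
  have h6 : C * ‖y - n‖ ≤ C * (δ * ‖n‖ + δ + 1) := by gcongr
  have h7 : 2 * C * δ * ‖n‖ ≤ δ' * ‖n‖ := by gcongr
  linarith

end IsErgodicSemimetric

open Classical in
/-- Subadditive tiling: from a point of `H` there is a cheap step of bounded length, and every other
step is charged to the points outside `G` or `H`. -/
lemma le_of_tiling {p : ℕ → ℕ → ℝ} {G H : Set ℕ} {a C c E : ℝ} {K : ℕ} (ha : 0 ≤ a) (hC : 0 ≤ C)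
    (hc : 0 ≤ c) (htri : ∀ i j k, p i k ≤ p i j + p j k)
    (hG : ∀ i j, i ≤ j → j ∈ G → p i j ≤ C * (j - i) + c)
    (hH : ∀ i ∈ H, ∃ k, 0 < k ∧ k ≤ K ∧ p i (i + k) ≤ a * k)
    (n : ℕ) (hend : ∀ i ≤ n, p i n ≤ C * (n - i) + E) {i : ℕ} (hi : i ≤ n) :
    p i n ≤ a * (n - i) +
      ∑ j ∈ Finset.Ico i n, ((if j ∈ H then 0 else C + c) + (if j ∈ G then 0 else C)) +
      C * K + E := by
  set w : ℕ → ℝ := fun j => (if j ∈ H then 0 else C + c) + (if j ∈ G then 0 else C) with hw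
  have hw0 (j : ℕ) : 0 ≤ w j := by
    simp only [hw]; split_ifs <;> positivity
  induction hm : n - i using Nat.strong_induction_on generalizing i with
  | _ m ih =>
    have hin : (i : ℝ) ≤ n := Nat.cast_le.2 hi
    have hstep (i' : ℕ) (hii' : i < i') (hi'n : i' ≤ n)
        (hp : p i i' ≤ a * (i' - i) + ∑ j ∈ Finset.Ico i i', w j) :
        p i n ≤ a * (n - i) + ∑ j ∈ Finset.Ico i n, w j + C * K + E := by
      have h1 := ih (n - i') (by omega) hi'n rfl
      have h2 := htri i i' n
      rw [← Finset.sum_Ico_consecutive w hii'.le hi'n]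
      linarith
    have hfinish (hlen : C * (n - i : ℝ) ≤ ∑ j ∈ Finset.Ico i n, w j + C * K) :
        p i n ≤ a * (n - i) + ∑ j ∈ Finset.Ico i n, w j + C * K + E := by
      have h1 := hend i hi
      have h2 : 0 ≤ a * (n - i : ℝ) := mul_nonneg ha (by linarith)
      linarith
    by_cases hiH : i ∈ H
    · obtain ⟨k, hk0, hkK, hk⟩ := hH i hiH
      rcases le_or_gt (i + k) n with hle | hgt
      · refine hstep (i + k) (by omega) hle ?_
        have : 0 ≤ ∑ j ∈ Finset.Ico i (i + k), w j := Finset.sum_nonneg fun j _ => hw0 j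
        push_cast
        rw [add_sub_cancel_left]
        linarith
      · refine hfinish ?_
        have h1 : 0 ≤ ∑ j ∈ Finset.Ico i n, w j := Finset.sum_nonneg fun j _ => hw0 j
        have h2 : (n - i : ℝ) ≤ K := by
          have : n ≤ i + K := by omega
          have : (n : ℝ) ≤ i + K := by exact_mod_cast this
          linarith
        have := mul_le_mul_of_nonneg_left h2 hC
        linarith
    · have hsum (i' : ℕ) (hii' : i < i') (hno : ∀ j, i < j → j < i' → j ∉ G) :
          C * (i' - i) + c ≤ ∑ j ∈ Finset.Ico i i', w j := by
        rw [Finset.sum_eq_sum_Ico_succ_bot hii']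
        have h1 : C + c ≤ w i := by
          simp only [hw, if_neg hiH]; split_ifs <;> linarith
        have h2 : ∑ j ∈ Finset.Ico (i + 1) i', C ≤ ∑ j ∈ Finset.Ico (i + 1) i', w j := by
          refine Finset.sum_le_sum fun j hj => ?_
          rw [Finset.mem_Ico] at hj
          simp only [hw, if_neg (hno j (by omega) hj.2)]
          split_ifs <;> linarith
        rw [Finset.sum_const, Nat.card_Ico, nsmul_eq_mul, Nat.cast_sub hii'] at h2
        push_cast at h2
        linarith
      by_cases hex : ∃ i', i < i' ∧ i' ≤ n ∧ i' ∈ G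
      · obtain ⟨hi1, hi2, hi3⟩ := Nat.find_spec hex
        refine hstep _ hi1 hi2 ?_
        have h1 := hG i _ hi1.le hi3
        have h2 := hsum _ hi1 fun j hij hj hjG => Nat.find_min hex hj ⟨hij, by omega, hjG⟩
        have h3 : 0 ≤ a * ((Nat.find hex : ℝ) - i) :=
          mul_nonneg ha (sub_nonneg.2 (Nat.cast_le.2 hi1.le))
        linarith
      · push Not at hex
        rcases hi.eq_or_lt with rfl | hlt
        · exact hfinish (by simp; positivity)
        · have := hsum n hlt fun j hij hj => hex j hij hj.le
          refine hfinish ?_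
          have : 0 ≤ C * K := by positivity
          linarith

section Line

variable {X : Type*} {d : ℕ} {T : (Fin d → ℤ) → X → X}

/-- The `ℤ`-action generated by `T v`. -/
def lineAction (T : (Fin d → ℤ) → X → X) (v : Fin d → ℤ) : (Fin 1 → ℤ) → X → X :=
  fun k => T (k 0 • v)

lemma IsPMPAction.lineAction [MeasurableSpace X] {μ : Measure X} (hT : IsPMPAction μ T)
    (v : Fin d → ℤ) : IsPMPAction μ (lineAction T v) where
  add n m := by simp only [Boivin.lineAction, Pi.add_apply, add_smul, hT.add]
  mp n := hT.mp _

open Classical in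
lemma card_filter_range_le {v : Fin d → ℤ} {B : Set X} {t : ℝ} {x : X}
    (hx : x ∉ ⋃ R, denseVisits (lineAction T v) B t R) (n : ℕ) :
    (((Finset.range n).filter fun i => T (i • v) x ∈ B).card : ℝ) ≤ t * (2 * n + 1) := by
  have h : x ∉ denseVisits (lineAction T v) B t n := fun h => hx (Set.mem_iUnion.2 ⟨n, h⟩)
  rw [denseVisits, Set.mem_ofPred_eq, not_le, pow_one] at h
  refine le_trans (Nat.cast_le.2 ?_) h.le
  refine Finset.card_le_card_of_injOn (fun i => fun _ => (i : ℤ)) ?_ ?_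
  · intro i hi
    rw [Finset.mem_coe, Finset.mem_filter] at hi ⊢
    rw [mem_box, pi_norm_le_iff_of_nonneg (Nat.cast_nonneg n)]
    refine ⟨fun _ => ?_, ?_⟩
    · simpa using (Finset.mem_range.1 hi.1).le
    · simpa [lineAction] using hi.2
  · intro i _ j _ hij
    simpa using congrFun hij 0

end Line

lemma tendsto_div_zero_of_forall_le {u : ℕ → ℝ} (hu : ∀ k, 0 ≤ u k)
    (h : ∀ δ > 0, ∃ A, ∀ k : ℕ, u k ≤ A + δ * k) :
    Tendsto (fun k => u k / k) atTop (𝓝 0) := by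
  rw [Metric.tendsto_atTop]
  intro ε hε
  obtain ⟨A, hA⟩ := h (ε / 2) (by positivity)
  obtain ⟨N, hN⟩ := exists_nat_gt (2 * A / ε)
  refine ⟨N + 1, fun k hk => ?_⟩
  have hk0 : (0 : ℝ) < k := by exact_mod_cast (by omega : 0 < k)
  have hNk : (N : ℝ) ≤ k := by exact_mod_cast (by omega : N ≤ k)
  rw [Real.dist_0_eq_abs, abs_of_nonneg (div_nonneg (hu k) hk0.le), div_lt_iff₀ hk0]
  rw [div_lt_iff₀ hε] at hN
  nlinarith [hA k]

lemma limsup_ofReal_div_le {u : ℕ → ℝ} {b A : ℝ} (h : ∀ k : ℕ, u k ≤ b * k + A) :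
    limsup (fun k : ℕ => ENNReal.ofReal (u k / k)) atTop ≤ ENNReal.ofReal b := by
  have hlim : Tendsto (fun k : ℕ => ENNReal.ofReal (b + A / k)) atTop (𝓝 (ENNReal.ofReal b)) := by
    refine ENNReal.tendsto_ofReal ?_
    simpa using (tendsto_const_div_atTop_nhds_zero_nat A).const_add b
  rw [← hlim.limsup_eq]
  refine limsup_le_limsup ?_
  filter_upwards [eventually_gt_atTop 0] with k hk
  have hk0 : (0 : ℝ) < k := by exact_mod_cast hk
  refine ENNReal.ofReal_le_ofReal ?_
  rw [div_le_iff₀ hk0, add_mul, div_mul_cancel₀ _ hk0.ne']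
  exact h k

namespace IsErgodicSemimetric

variable {X : Type*} [MeasurableSpace X] {μ : Measure X} {d : ℕ}
  {T : (Fin d → ℤ) → X → X} {ρ : X → (Fin d → ℤ) → (Fin d → ℤ) → ℝ}

lemma exists_tendsto_zero_abs_le (h : IsErgodicSemimetric μ T ρ) {C : ℝ} {x : X}
    (hx : AsympLipschitz (ρ x) C) (v m : Fin d → ℤ) :
    ∃ g : ℕ → ENNReal, Tendsto g atTop (𝓝 0) ∧ ∀ k : ℕ,
      ENNReal.ofReal (ρ (T m x) 0 (k • v) / k) ≤ ENNReal.ofReal (ρ x 0 (k • v) / k) + g k ∧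
      ENNReal.ofReal (ρ x 0 (k • v) / k) ≤ ENNReal.ofReal (ρ (T m x) 0 (k • v) / k) + g k := by
  refine ⟨fun k => ENNReal.ofReal ((ρ x 0 m + ρ x (k • v + m) (k • v)) / k), ?_, fun k => ?_⟩
  · rw [← ENNReal.ofReal_zero]
    refine ENNReal.tendsto_ofReal (tendsto_div_zero_of_forall_le
      (fun k => add_nonneg (h.nonneg _ _ _) (h.nonneg _ _ _)) fun δ hδ => ?_)
    obtain ⟨c, hc⟩ := hx (δ / (‖v‖ + 1)) (by positivity)
    refine ⟨ρ x 0 m + (C * ‖m‖ + c), fun k => ?_⟩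
    have h1 := hc (k • v + m) (k • v)
    rw [add_sub_cancel_left] at h1
    have h2 : δ / (‖v‖ + 1) * ‖k • v‖ ≤ δ * k := by
      rw [div_mul_eq_mul_div, div_le_iff₀ (by positivity), mul_assoc]
      have := norm_nsmul_le (n := k) (a := v)
      gcongr
      nlinarith
    linarith
  · rw [← ENNReal.ofReal_add (div_nonneg (h.nonneg _ _ _) k.cast_nonneg)
        (div_nonneg (add_nonneg (h.nonneg _ _ _) (h.nonneg _ _ _)) k.cast_nonneg),
      ← ENNReal.ofReal_add (div_nonneg (h.nonneg _ _ _) k.cast_nonneg)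
        (div_nonneg (add_nonneg (h.nonneg _ _ _) (h.nonneg _ _ _)) k.cast_nonneg),
      ← add_div, ← add_div, h.equiv, zero_add]
    have h1 := h.tri x m 0 (k • v + m)
    have h2 := h.tri x 0 (k • v) (k • v + m)
    have h3 := h.tri x 0 m (k • v)
    have h4 := h.tri x m (k • v + m) (k • v)
    rw [h.symm x m 0] at h1
    rw [h.symm x (k • v) (k • v + m)] at h2
    constructor <;> refine ENNReal.ofReal_le_ofReal ?_ <;> gcongr <;> linarith

lemma measurable_ofReal_div (h : IsErgodicSemimetric μ T ρ) (v : Fin d → ℤ) (k : ℕ) :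
    Measurable fun x => ENNReal.ofReal (ρ x 0 (k • v) / k) :=
  ((h.meas _ _).div_const _).ennreal_ofReal

variable [IsProbabilityMeasure μ]

lemma exists_ae_liminf_eq (h : IsErgodicSemimetric μ T ρ) {C : ℝ}
    (hL : ∀ᵐ x ∂μ, AsympLipschitz (ρ x) C) (v : Fin d → ℤ) :
    ∃ l, ∀ᵐ x ∂μ, liminf (fun k : ℕ => ENNReal.ofReal (ρ x 0 (k • v) / k)) atTop = l := by
  refine h.exists_ae_eq_const (Measurable.liminf (h.measurable_ofReal_div v)) fun m => ?_
  filter_upwards [hL] with x hx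
  obtain ⟨g, hg, hle⟩ := h.exists_tendsto_zero_abs_le hx v m
  refine le_antisymm ?_ ?_
  · exact (liminf_le_liminf (.of_forall fun k => (hle k).1)).trans_eq
      (ENNReal.liminf_add_of_right_tendsto_zero hg _)
  · exact (liminf_le_liminf (.of_forall fun k => (hle k).2)).trans_eq
      (ENNReal.liminf_add_of_right_tendsto_zero hg _)

lemma exists_ae_limsup_eq (h : IsErgodicSemimetric μ T ρ) {C : ℝ}
    (hL : ∀ᵐ x ∂μ, AsympLipschitz (ρ x) C) (v : Fin d → ℤ) :
    ∃ u, ∀ᵐ x ∂μ, limsup (fun k : ℕ => ENNReal.ofReal (ρ x 0 (k • v) / k)) atTop = u := by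
  refine h.exists_ae_eq_const (Measurable.limsup (h.measurable_ofReal_div v)) fun m => ?_
  filter_upwards [hL] with x hx
  obtain ⟨g, hg, hle⟩ := h.exists_tendsto_zero_abs_le hx v m
  refine le_antisymm ?_ ?_
  · exact (limsup_le_limsup (.of_forall fun k => (hle k).1)).trans_eq
      (ENNReal.limsup_add_of_right_tendsto_zero hg _)
  · exact (limsup_le_limsup (.of_forall fun k => (hle k).2)).trans_eq
      (ENNReal.limsup_add_of_right_tendsto_zero hg _)

end IsErgodicSemimetric

open Classical in
lemma sum_ite_range_le {X : Type*} {d : ℕ} {T : (Fin d → ℤ) → X → X} {v : Fin d → ℤ} {B : Set X}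
    {D ε : ℝ} (hD : 0 ≤ D) (hε : 0 ≤ ε) {x : X} {S : Set ℕ} (hS : ∀ i, i ∈ S ↔ T (i • v) x ∈ B)
    (hx : x ∉ ⋃ R, denseVisits (lineAction T v) Bᶜ (ε / (D + 1)) R) (n : ℕ) :
    ∑ j ∈ Finset.range n, (if j ∈ S then 0 else D) ≤ ε * (2 * n + 1) := by
  have hsum := mul_le_mul_of_nonneg_right (card_filter_range_le hx n) hD
  rw [Finset.card_filter, Nat.cast_sum, Finset.sum_mul] at hsum
  refine le_trans (le_of_eq (Finset.sum_congr rfl fun j _ => ?_)) (hsum.trans ?_)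
  · by_cases hj : j ∈ S
    · rw [if_pos hj, if_neg (fun hn => hn ((hS j).1 hj)), Nat.cast_zero, zero_mul]
    · rw [if_neg hj, if_pos (Set.mem_compl (mt (hS j).2 hj)), Nat.cast_one, one_mul]
  · rw [show ε / (D + 1) * (2 * n + 1) * D = ε * (2 * n + 1) * D / (D + 1) by ring,
      div_le_iff₀ (by positivity)]
    gcongr
    linarith

namespace IsErgodicSemimetric

variable {X : Type*} [MeasurableSpace X] {μ : Measure X} {d : ℕ}
  {T : (Fin d → ℤ) → X → X} {ρ : X → (Fin d → ℤ) → (Fin d → ℤ) → ℝ}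

/-- The points with a cheap step of length at most `K` in direction `v`. -/
def cheapSet (ρ : X → (Fin d → ℤ) → (Fin d → ℤ) → ℝ) (v : Fin d → ℤ) (a : ℝ) (K : ℕ) : Set X :=
  {x | ∃ k : ℕ, 0 < k ∧ k ≤ K ∧ ρ x 0 (k • v) ≤ a * k}

lemma measurableSet_cheapSet (h : IsErgodicSemimetric μ T ρ) (v : Fin d → ℤ) (a : ℝ) (K : ℕ) :
    MeasurableSet (cheapSet ρ v a K) := by
  have : cheapSet ρ v a K = ⋃ k : ℕ, ⋃ _ : 0 < k ∧ k ≤ K, {x | ρ x 0 (k • v) ≤ a * k} := by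
    ext x; simp [cheapSet, and_assoc]
  rw [this]
  exact MeasurableSet.iUnion fun k => MeasurableSet.iUnion fun _ =>
    measurableSet_le (h.meas _ _) measurable_const

lemma dist_nsmul_le_of_density (h : IsErgodicSemimetric μ T ρ) {C a ε : ℝ} (hC : 0 ≤ C)
    (ha : 0 ≤ a) (hε : 0 < ε) {v : Fin d → ℤ} {c K : ℕ} {x : X} (hx : AsympLipschitz (ρ x) C)
    (hG : x ∉ ⋃ R, denseVisits (lineAction T v) (boundedSet ρ C c)ᶜ (ε / (C * ‖v‖ + 1)) R)
    (hH : x ∉ ⋃ R, denseVisits (lineAction T v) (cheapSet ρ v a K)ᶜ (ε / (C * ‖v‖ + c + 1)) R) :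
    ∃ A, ∀ n : ℕ, ρ x 0 (n • v) ≤ (a + 5 * ε) * n + A := by
  obtain ⟨c', hc'⟩ := hx (ε / (‖v‖ + 1)) (by positivity)
  have hsub {i j : ℕ} (hij : i ≤ j) : C * ‖i • v - j • v‖ ≤ C * ‖v‖ * (j - i) := by
    obtain ⟨m, rfl⟩ := Nat.exists_eq_add_of_le hij
    rw [add_smul, sub_add_cancel_left, norm_neg]
    have := norm_nsmul_le (n := m) (a := v)
    push_cast
    rw [add_sub_cancel_left, mul_assoc, mul_comm ‖v‖]
    gcongr
  refine ⟨2 * ε + C * ‖v‖ * K + c', fun n => ?_⟩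
  have hend (i : ℕ) (hi : i ≤ n) :
      ρ x (i • v) (n • v) ≤ C * ‖v‖ * (n - i) + (ε * n + c') := by
    have h1 := hc' (i • v) (n • v)
    have h2 : ε / (‖v‖ + 1) * ‖n • v‖ ≤ ε * n := by
      rw [div_mul_eq_mul_div, div_le_iff₀ (by positivity), mul_assoc]
      have := norm_nsmul_le (n := n) (a := v)
      gcongr
      nlinarith
    linarith [hsub hi]
  obtain ⟨G, hGmem⟩ : ∃ G : Set ℕ, ∀ i, i ∈ G ↔ T (i • v) x ∈ boundedSet ρ C c :=
    ⟨{i | T (i • v) x ∈ boundedSet ρ C c}, fun i => Iff.rfl⟩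
  obtain ⟨H, hHmem⟩ : ∃ H : Set ℕ, ∀ i, i ∈ H ↔ T (i • v) x ∈ cheapSet ρ v a K :=
    ⟨{i | T (i • v) x ∈ cheapSet ρ v a K}, fun i => Iff.rfl⟩
  have htile := le_of_tiling (p := fun i j => ρ x (i • v) (j • v))
    (G := G) (H := H) (a := a) (C := C * ‖v‖) (c := c) (K := K) (E := ε * n + c') ha (by positivity)
    (Nat.cast_nonneg c) (fun i j k => h.tri _ _ _ _)
    (fun i j hij hj => by
      have := h.dist_le_of_mem_boundedSet ((hGmem j).1 hj) (i • v)
      rw [h.symm] at this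
      linarith [hsub hij])
    (fun i hi => by
      obtain ⟨k, hk0, hkK, hk⟩ := (hHmem i).1 hi
      refine ⟨k, hk0, hkK, ?_⟩
      rwa [h.equiv, zero_add, ← add_smul, add_comm] at hk)
    n hend (Nat.zero_le n)
  rw [Finset.sum_add_distrib, ← Finset.range_eq_Ico] at htile
  have hsG := sum_ite_range_le (by positivity) hε.le hGmem hG n
  have hsH := sum_ite_range_le (by positivity) hε.le hHmem hH n
  simp only [zero_smul, CharP.cast_eq_zero, sub_zero] at htile
  linarith

variable [IsProbabilityMeasure μ]

lemma limsup_le_of_liminf_lt (h : IsErgodicSemimetric μ T ρ) {C a : ℝ} (hC : 0 ≤ C) (ha : 0 ≤ a)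
    (hb : ∀ᵐ x ∂μ, ∃ c, x ∈ boundedSet ρ C c) {v : Fin d → ℤ} {u : ENNReal}
    (hlim : ∀ᵐ x ∂μ,
      liminf (fun k : ℕ => ENNReal.ofReal (ρ x 0 (k • v) / k)) atTop < ENNReal.ofReal a)
    (hu : ∀ᵐ x ∂μ, limsup (fun k : ℕ => ENNReal.ofReal (ρ x 0 (k • v) / k)) atTop = u)
    {ε : ℝ} (hε : 0 < ε) : u ≤ ENNReal.ofReal (a + 5 * ε) := by
  have hquarter : (0 : ENNReal) < 1 / 4 := by simp
  obtain ⟨c, hc⟩ : ∃ c, μ (⋃ R, denseVisits (lineAction T v) (boundedSet ρ C c)ᶜ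
      (ε / (C * ‖v‖ + 1)) R) < 1 / 4 :=
    ((tendsto_measure_denseVisits (h.toIsPMPAction.lineAction v)
      (fun c => (h.measurableSet_boundedSet C c).compl)
      (tendsto_measure_compl_of_ae_exists (h.measurableSet_boundedSet C)
        (boundedSet_mono ρ C) hb) (by positivity)).eventually_lt_const hquarter).exists
  have hcheap : ∀ᵐ x ∂μ, ∃ K, x ∈ cheapSet ρ v a K := by
    filter_upwards [hlim] with x hx
    obtain ⟨k, hk0, hk⟩ := ((frequently_lt_of_liminf_lt (by isBoundedDefault) hx).and_eventually
      (eventually_gt_atTop 0)).exists.imp fun _ h => h.symm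
    refine ⟨k, k, hk0, le_rfl, ?_⟩
    have hk' : (0 : ℝ) < k := by exact_mod_cast hk0
    exact ((div_lt_iff₀ hk').1 (ENNReal.ofReal_lt_ofReal_iff'.1 hk).1).le
  obtain ⟨K, hK⟩ : ∃ K, μ (⋃ R, denseVisits (lineAction T v) (cheapSet ρ v a K)ᶜ
      (ε / (C * ‖v‖ + c + 1)) R) < 1 / 4 :=
    ((tendsto_measure_denseVisits (h.toIsPMPAction.lineAction v)
      (fun K => (h.measurableSet_cheapSet v a K).compl)
      (tendsto_measure_compl_of_ae_exists (h.measurableSet_cheapSet v a)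
        (fun K K' hKK' x ⟨k, hk0, hk, hkx⟩ => ⟨k, hk0, hk.trans hKK', hkx⟩) hcheap)
      (by positivity)).eventually_lt_const hquarter).exists
  obtain ⟨x, hxL, hxu, hxG, hxH⟩ : ∃ x, AsympLipschitz (ρ x) C ∧
      limsup (fun k : ℕ => ENNReal.ofReal (ρ x 0 (k • v) / k)) atTop = u ∧
      (x ∉ ⋃ R, denseVisits (lineAction T v) (boundedSet ρ C c)ᶜ (ε / (C * ‖v‖ + 1)) R) ∧
      x ∉ ⋃ R, denseVisits (lineAction T v) (cheapSet ρ v a K)ᶜ (ε / (C * ‖v‖ + c + 1)) R := by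
    by_contra! hcon
    have hae : Set.univ ≤ᵐ[μ]
        ((⋃ R, denseVisits (lineAction T v) (boundedSet ρ C c)ᶜ (ε / (C * ‖v‖ + 1)) R) ∪
        ⋃ R, denseVisits (lineAction T v) (cheapSet ρ v a K)ᶜ (ε / (C * ‖v‖ + c + 1)) R :
          Set X) := by
      filter_upwards [h.ae_asympLipschitz hC hb, hu] with x hx hxu _
      by_contra hnot
      exact hnot (Or.inr (hcon x hx hxu fun hG => hnot (Or.inl hG)))
    have := (measure_mono_ae hae).trans (measure_union_le _ _)
    rw [measure_univ] at this
    have h2 := this.trans_lt (ENNReal.add_lt_add hc hK)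
    rw [← ENNReal.add_div, ENNReal.lt_div_iff_mul_lt (by simp) (by simp)] at h2
    norm_num at h2
  obtain ⟨A, hA⟩ := h.dist_nsmul_le_of_density hC ha hε hxL hxG hxH
  rw [← hxu]
  exact limsup_ofReal_div_le hA

/-- Along each direction the normalized distance converges to a constant. -/
lemma exists_ae_tendsto (h : IsErgodicSemimetric μ T ρ) {C : ℝ} (hC : 0 ≤ C)
    (hb : ∀ᵐ x ∂μ, ∃ c, x ∈ boundedSet ρ C c) (v : Fin d → ℤ) :
    ∃ l : ℝ, ∀ᵐ x ∂μ, Tendsto (fun k : ℕ => ρ x 0 (k • v) / k) atTop (𝓝 l) := by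
  have hL := h.ae_asympLipschitz hC hb
  obtain ⟨l, hl⟩ := h.exists_ae_liminf_eq hL v
  obtain ⟨u, hu⟩ := h.exists_ae_limsup_eq hL v
  have hltop : l ≠ ⊤ := by
    obtain ⟨x, ⟨c, hc⟩, hxl⟩ := (hb.and hl).exists
    have hle : limsup (fun k : ℕ => ENNReal.ofReal (ρ x 0 (k • v) / k)) atTop ≤
        ENNReal.ofReal (C * ‖v‖) := limsup_ofReal_div_le (A := c) fun k => by
      refine (hc _).trans ?_
      rw [mul_assoc, mul_comm ‖v‖]
      have := norm_nsmul_le (n := k) (a := v)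
      gcongr
    rw [← hxl]
    exact ne_top_of_le_ne_top ENNReal.ofReal_ne_top ((liminf_le_limsup).trans hle)
  have hul : u ≤ l := by
    refine ENNReal.le_of_forall_pos_le_add fun ε hε _ => ?_
    have hε' : (0 : ℝ) < ε := hε
    have hal : l < ENNReal.ofReal (l.toReal + ε / 6) := by
      rw [ENNReal.lt_ofReal_iff_toReal_lt hltop]
      linarith
    refine (h.limsup_le_of_liminf_lt hC (a := l.toReal + ε / 6) (by positivity) hb
      (hl.mono fun x hx => hx ▸ hal) hu (ε := ε / 6) (by positivity)).trans ?_
    rw [show (l.toReal + ε / 6 + 5 * (ε / 6) : ℝ) = l.toReal + ε by ring,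
      ENNReal.ofReal_add ENNReal.toReal_nonneg hε'.le, ENNReal.ofReal_toReal hltop,
      ENNReal.ofReal_coe_nnreal]
  refine ⟨l.toReal, ?_⟩
  filter_upwards [hl, hu] with x hxl hxu
  have ht := tendsto_of_le_liminf_of_limsup_le hxl.ge (hxu.trans_le hul)
  have := (ENNReal.tendsto_toReal hltop).comp ht
  refine this.congr fun k => ?_
  exact ENNReal.toReal_ofReal (div_nonneg (h.nonneg _ _ _) k.cast_nonneg)

end IsErgodicSemimetric

namespace IsErgodicSemimetric

variable {X : Type*} [MeasurableSpace X] {μ : Measure X} {d : ℕ}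
  {T : (Fin d → ℤ) → X → X} {ρ : X → (Fin d → ℤ) → (Fin d → ℤ) → ℝ} {L : (Fin d → ℤ) → ℝ}

/-- The points where the normalized distance at time `k` is far from its limit. -/
def farSet (ρ : X → (Fin d → ℤ) → (Fin d → ℤ) → ℝ) (l : ℝ) (v : Fin d → ℤ) (ε : ℝ) (k : ℕ) :
    Set X :=
  {x | ε ≤ |ρ x 0 (k • v) / k - l|}

lemma measurableSet_farSet (h : IsErgodicSemimetric μ T ρ) (l : ℝ) (v : Fin d → ℤ) (ε : ℝ)
    (k : ℕ) : MeasurableSet (farSet ρ l v ε k) :=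
  measurableSet_le measurable_const
    (((h.meas 0 (k • v)).div_const (k : ℝ)).sub_const l).norm

variable [IsProbabilityMeasure μ]

lemma tendsto_measure_farSet (h : IsErgodicSemimetric μ T ρ) {l : ℝ} {v : Fin d → ℤ}
    (hl : ∀ᵐ x ∂μ, Tendsto (fun k : ℕ => ρ x 0 (k • v) / k) atTop (𝓝 l)) {ε : ℝ} (hε : 0 < ε) :
    Tendsto (fun k => μ (farSet ρ l v ε k)) atTop (𝓝 0) := by
  have := tendstoInMeasure_of_tendsto_ae
    (fun k : ℕ => ((h.meas 0 (k • v)).div_const (k : ℝ)).aestronglyMeasurable) hl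
  rw [tendstoInMeasure_iff_norm] at this
  exact this ε hε

lemma exists_notMem_farSet (h : IsErgodicSemimetric μ T ρ)
    (hL : ∀ v, ∀ᵐ x ∂μ, Tendsto (fun k : ℕ => ρ x 0 (k • v) / k) atTop (𝓝 (L v)))
    {ε : ℝ} (hε : 0 < ε) (u v w z : Fin d → ℤ) :
    ∃ k : ℕ, 0 < k ∧ ∃ x, x ∉ farSet ρ (L u) u ε k ∧ x ∉ farSet ρ (L v) v ε k ∧
      T (k • z) x ∉ farSet ρ (L w) w ε k := by
  have hq : (0 : ENNReal) < 1 / 4 := by simp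
  have hev (v) := (h.tendsto_measure_farSet (hL v) hε).eventually_lt_const hq
  obtain ⟨k, hk0, hu, hv, hw⟩ :=
    ((eventually_gt_atTop 0).and ((hev u).and ((hev v).and (hev w)))).exists
  refine ⟨k, hk0, ?_⟩
  by_contra! hcon
  rw [← (h.mp (k • z)).measure_preimage (h.measurableSet_farSet _ _ _ _).nullMeasurableSet] at hw
  have hcover : Set.univ ⊆ farSet ρ (L u) u ε k ∪ (farSet ρ (L v) v ε k ∪
      T (k • z) ⁻¹' farSet ρ (L w) w ε k) := fun x _ => by
    by_contra hx
    simp only [Set.mem_union, not_or] at hx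
    exact hx.2.2 (hcon x hx.1 hx.2.1)
  have h1 := (measure_mono hcover).trans (measure_union_le (μ := μ) _ _)
  have h2 := h1.trans_lt (ENNReal.add_lt_add hu
    ((measure_union_le _ _).trans_lt (ENNReal.add_lt_add hv hw)))
  rw [measure_univ, ← ENNReal.add_div, ← ENNReal.add_div,
    ENNReal.lt_div_iff_mul_lt (by simp) (by simp)] at h2
  norm_num at h2

lemma limit_add_le (h : IsErgodicSemimetric μ T ρ)
    (hL : ∀ v, ∀ᵐ x ∂μ, Tendsto (fun k : ℕ => ρ x 0 (k • v) / k) atTop (𝓝 (L v)))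
    (v w : Fin d → ℤ) : L (v + w) ≤ L v + L w := by
  refine le_of_forall_pos_le_add fun ε hε => ?_
  obtain ⟨k, hk0, x, hu, hv, hw⟩ :=
    h.exists_notMem_farSet hL (show 0 < ε / 3 by positivity) (v + w) v w v
  have hk : (0 : ℝ) < k := Nat.cast_pos.2 hk0
  simp only [farSet, Set.mem_ofPred_eq, not_le, abs_lt] at hu hv hw
  rw [h.equiv, zero_add, add_comm (k • w), ← smul_add] at hw
  have htri := div_le_div_of_nonneg_right (h.tri x 0 (k • v) (k • (v + w))) hk.le
  rw [add_div] at htri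
  linarith [hu.1, hv.2, hw.2]

lemma limit_neg_le (h : IsErgodicSemimetric μ T ρ)
    (hL : ∀ v, ∀ᵐ x ∂μ, Tendsto (fun k : ℕ => ρ x 0 (k • v) / k) atTop (𝓝 (L v)))
    (v : Fin d → ℤ) : L (-v) ≤ L v := by
  refine le_of_forall_pos_le_add fun ε hε => ?_
  obtain ⟨k, -, x, hu, -, hw⟩ :=
    h.exists_notMem_farSet hL (show 0 < ε / 2 by positivity) (-v) (-v) v (-v)
  simp only [farSet, Set.mem_ofPred_eq, not_le, abs_lt] at hu hw
  rw [h.equiv, zero_add, smul_neg, add_neg_cancel, h.symm] at hw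
  rw [smul_neg] at hu
  linarith [hu.1, hw.2]

lemma limit_nsmul (h : IsErgodicSemimetric μ T ρ)
    (hL : ∀ v, ∀ᵐ x ∂μ, Tendsto (fun k : ℕ => ρ x 0 (k • v) / k) atTop (𝓝 (L v)))
    (j : ℕ) (v : Fin d → ℤ) : L (j • v) = j * L v := by
  obtain ⟨x, hx, hy⟩ := ((hL (j • v)).and (hL v)).exists
  rcases Nat.eq_zero_or_pos j with rfl | hj
  · rw [Nat.cast_zero, zero_mul]
    refine tendsto_nhds_unique hx (tendsto_const_nhds.congr fun k => ?_)
    rw [zero_smul, smul_zero, h.refl, zero_div]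
  · have hsub := (hy.comp (tendsto_id.atTop_mul_const' hj)).const_mul (j : ℝ)
    refine tendsto_nhds_unique hx (hsub.congr fun k => ?_)
    have hj' : (j : ℝ) ≠ 0 := by positivity
    simp only [Function.comp_apply, id_eq, mul_smul, Nat.cast_mul]
    rw [mul_comm (k : ℝ), ← div_div, mul_div_assoc', mul_div_cancel₀ _ hj']

lemma limit_nonneg (h : IsErgodicSemimetric μ T ρ)
    (hL : ∀ v, ∀ᵐ x ∂μ, Tendsto (fun k : ℕ => ρ x 0 (k • v) / k) atTop (𝓝 (L v)))
    (v : Fin d → ℤ) : 0 ≤ L v := by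
  obtain ⟨x, hx⟩ := (hL v).exists
  exact ge_of_tendsto' hx fun k => div_nonneg (h.nonneg _ _ _) k.cast_nonneg

lemma limit_le (hL : ∀ v, ∀ᵐ x ∂μ, Tendsto (fun k : ℕ => ρ x 0 (k • v) / k) atTop (𝓝 (L v)))
    {C : ℝ} (hC : 0 ≤ C) (hb : ∀ᵐ x ∂μ, ∃ c, x ∈ boundedSet ρ C c)
    (v : Fin d → ℤ) : L v ≤ C * ‖v‖ := by
  obtain ⟨x, hx, c, hc⟩ := ((hL v).and hb).exists
  have hlim : Tendsto (fun k : ℕ => C * ‖v‖ + (c : ℝ) / k) atTop (𝓝 (C * ‖v‖ + 0)) :=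
    tendsto_const_nhds.add (tendsto_const_div_atTop_nhds_zero_nat _)
  rw [add_zero] at hlim
  refine le_of_tendsto_of_tendsto hx hlim ?_
  filter_upwards [eventually_gt_atTop 0] with k hk0
  have hk : (0 : ℝ) < k := Nat.cast_pos.2 hk0
  rw [div_le_iff₀ hk, add_mul, div_mul_cancel₀ _ hk.ne']
  have h1 := hc (k • v)
  have h2 := mul_le_mul_of_nonneg_left (norm_nsmul_le (n := k) (a := v)) hC
  linarith

end IsErgodicSemimetric

section Extension

variable {d : ℕ}

/-- The inclusion of the integer lattice in the real vector space. -/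
def intCastVec (n : Fin d → ℤ) : Fin d → ℝ := fun k => (n k : ℝ)

lemma intCastVec_add (m n : Fin d → ℤ) : intCastVec (m + n) = intCastVec m + intCastVec n := by
  ext; simp [intCastVec]

lemma intCastVec_neg (n : Fin d → ℤ) : intCastVec (-n) = -intCastVec n := by
  ext; simp [intCastVec]

lemma intCastVec_nsmul (k : ℕ) (n : Fin d → ℤ) :
    intCastVec (k • n) = (k : ℝ) • intCastVec n := by
  ext; simp [intCastVec]

lemma norm_intCastVec (n : Fin d → ℤ) : ‖intCastVec n‖ = ‖n‖ := by
  refine le_antisymm ((pi_norm_le_iff_of_nonneg (norm_nonneg n)).2 fun k => ?_)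
    ((pi_norm_le_iff_of_nonneg (norm_nonneg (intCastVec n))).2 fun k => ?_)
  · simpa [intCastVec, Int.norm_eq_abs] using norm_le_pi_norm n k
  · simpa [intCastVec, Int.norm_eq_abs] using norm_le_pi_norm (intCastVec n) k

/-- The largest homogeneous extension of `L` which is `C`-Lipschitz. -/
noncomputable def lipExtend (L : (Fin d → ℤ) → ℝ) (C : ℝ) (u : Fin d → ℝ) : ℝ :=
  ⨅ i : {k : ℕ // 0 < k} × (Fin d → ℤ),
    (L i.2 + C * ‖((i.1 : ℕ) : ℝ) • u - intCastVec i.2‖) / (i.1 : ℕ)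

variable {L : (Fin d → ℤ) → ℝ} {C : ℝ}

lemma lipExtend_le (hL : ∀ n, 0 ≤ L n) (hC : 0 ≤ C) (u : Fin d → ℝ) {k : ℕ} (hk : 0 < k)
    (n : Fin d → ℤ) : lipExtend L C u ≤ (L n + C * ‖(k : ℝ) • u - intCastVec n‖) / k := by
  refine ciInf_le ⟨0, ?_⟩
    ((⟨k, hk⟩, n) : {k : ℕ // 0 < k} × (Fin d → ℤ))
  rintro _ ⟨i, rfl⟩
  have := hL i.2
  positivity

lemma le_lipExtend {u : Fin d → ℝ} {a : ℝ}
    (h : ∀ k : ℕ, 0 < k → ∀ n, a ≤ (L n + C * ‖(k : ℝ) • u - intCastVec n‖) / k) :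
    a ≤ lipExtend L C u :=
  haveI : Nonempty ({k : ℕ // 0 < k} × (Fin d → ℤ)) := ⟨⟨1, one_pos⟩, 0⟩
  le_ciInf fun i => h _ i.1.2 _

lemma lipExtend_add_le (hL : ∀ n, 0 ≤ L n) (hC : 0 ≤ C)
    (hadd : ∀ m n, L (m + n) ≤ L m + L n) (hsmul : ∀ (j : ℕ) n, L (j • n) = j * L n)
    (u v : Fin d → ℝ) : lipExtend L C (u + v) ≤ lipExtend L C u + lipExtend L C v := by
  rw [← sub_le_iff_le_add]
  refine le_lipExtend fun k hk m => ?_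
  rw [sub_le_comm]
  refine le_lipExtend fun l hl n => ?_
  rw [sub_le_iff_le_add']
  have hk' : (0 : ℝ) < k := Nat.cast_pos.2 hk
  have hl' : (0 : ℝ) < l := Nat.cast_pos.2 hl
  refine (lipExtend_le hL hC (u + v) (Nat.mul_pos hk hl) (l • m + k • n)).trans ?_
  have h1 := hadd (l • m) (k • n)
  rw [hsmul, hsmul] at h1
  have h2 : ((k * l : ℕ) : ℝ) • (u + v) - intCastVec (l • m + k • n) =
      (l : ℝ) • ((k : ℝ) • u - intCastVec m) + (k : ℝ) • ((l : ℝ) • v - intCastVec n) := by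
    rw [intCastVec_add, intCastVec_nsmul, intCastVec_nsmul]
    push_cast
    module
  have h3 : ‖((k * l : ℕ) : ℝ) • (u + v) - intCastVec (l • m + k • n)‖ ≤
      l * ‖(k : ℝ) • u - intCastVec m‖ + k * ‖(l : ℝ) • v - intCastVec n‖ := by
    rw [h2]
    refine (norm_add_le _ _).trans (le_of_eq ?_)
    rw [norm_smul, norm_smul, Real.norm_natCast, Real.norm_natCast]
  rw [div_add_div _ _ hk'.ne' hl'.ne', Nat.cast_mul]
  refine div_le_div_of_nonneg_right ?_ (by positivity)
  have h4 := mul_le_mul_of_nonneg_left h3 hC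
  push_cast at h4
  linarith

lemma lipExtend_neg_le (hL : ∀ n, 0 ≤ L n) (hC : 0 ≤ C) (hneg : ∀ n, L (-n) ≤ L n)
    (u : Fin d → ℝ) : lipExtend L C (-u) ≤ lipExtend L C u := by
  refine le_lipExtend fun k hk n => (lipExtend_le hL hC (-u) hk (-n)).trans ?_
  refine div_le_div_of_nonneg_right ?_ k.cast_nonneg
  rw [intCastVec_neg, smul_neg, ← neg_sub', norm_neg]
  linarith [hneg n]

lemma lipExtend_le_norm (hL : ∀ n, 0 ≤ L n) (hC : 0 ≤ C)
    (hsmul : ∀ (j : ℕ) n, L (j • n) = j * L n) (u : Fin d → ℝ) :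
    lipExtend L C u ≤ C * ‖u‖ := by
  have h0 : L 0 = 0 := by simpa using hsmul 0 0
  have hz : intCastVec (0 : Fin d → ℤ) = 0 := by ext; simp [intCastVec]
  simpa [h0, hz] using lipExtend_le hL hC u one_pos 0

lemma lipExtend_intCastVec (hL : ∀ n, 0 ≤ L n) (hC : 0 ≤ C)
    (hadd : ∀ m n, L (m + n) ≤ L m + L n) (hsmul : ∀ (j : ℕ) n, L (j • n) = j * L n)
    (hle : ∀ n, L n ≤ C * ‖n‖) (n : Fin d → ℤ) : lipExtend L C (intCastVec n) = L n := by
  refine le_antisymm (by simpa using lipExtend_le hL hC (intCastVec n) one_pos n)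
    (le_lipExtend fun k hk m => ?_)
  rw [le_div_iff₀ (Nat.cast_pos.2 hk), mul_comm, ← hsmul, ← intCastVec_nsmul, sub_eq_add_neg,
    ← intCastVec_neg, ← intCastVec_add, norm_intCastVec]
  have h1 := hadd m (k • n + -m)
  rw [add_comm, neg_add_cancel_right] at h1
  linarith [hle (k • n + -m)]

lemma lipExtend_ratCast_smul_le (hL : ∀ n, 0 ≤ L n) (hC : 0 ≤ C)
    (hsmul : ∀ (j : ℕ) n, L (j • n) = j * L n) {a b : ℕ} (hb : 0 < b) (u : Fin d → ℝ) :
    lipExtend L C (((a : ℝ) / b) • u) ≤ (a : ℝ) / b * lipExtend L C u := by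
  have hb' : (0 : ℝ) < b := Nat.cast_pos.2 hb
  rcases Nat.eq_zero_or_pos a with rfl | ha
  · simpa using lipExtend_le_norm hL hC hsmul (0 : Fin d → ℝ)
  have ha' : (0 : ℝ) < a := Nat.cast_pos.2 ha
  rw [← div_le_iff₀' (by positivity)]
  refine le_lipExtend fun k hk n => ?_
  have hk' : (0 : ℝ) < k := Nat.cast_pos.2 hk
  rw [div_le_iff₀' (by positivity)]
  refine (lipExtend_le hL hC _ (Nat.mul_pos hb hk) (a • n)).trans (le_of_eq ?_)
  have h2 : ((b * k : ℕ) : ℝ) • ((a : ℝ) / b) • u - intCastVec (a • n) =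
      (a : ℝ) • ((k : ℝ) • u - intCastVec n) := by
    rw [intCastVec_nsmul, smul_sub, smul_smul, smul_smul]
    congr 2
    push_cast
    field_simp
  rw [h2, norm_smul, Real.norm_natCast, hsmul]
  push_cast
  field_simp

lemma lipExtend_smul_le (hL : ∀ n, 0 ≤ L n) (hC : 0 ≤ C)
    (hadd : ∀ m n, L (m + n) ≤ L m + L n) (hsmul : ∀ (j : ℕ) n, L (j • n) = j * L n)
    {c : ℝ} (hc : 0 ≤ c) (u : Fin d → ℝ) : lipExtend L C (c • u) ≤ c * lipExtend L C u := by
  have key (k : ℕ) : lipExtend L C (c • u) ≤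
      (⌊c * (k + 1 : ℕ)⌋₊ / (k + 1 : ℕ) : ℝ) * lipExtend L C u +
        C * (|c - ⌊c * (k + 1 : ℕ)⌋₊ / (k + 1 : ℕ)| * ‖u‖) := by
    set q : ℝ := ⌊c * (k + 1 : ℕ)⌋₊ / (k + 1 : ℕ) with hq
    have h1 := lipExtend_add_le hL hC hadd hsmul (q • u) ((c - q) • u)
    rw [← add_smul, add_sub_cancel] at h1
    have h2 := lipExtend_ratCast_smul_le hL hC hsmul (a := ⌊c * (k + 1 : ℕ)⌋₊) k.succ_pos u
    have h3 := lipExtend_le_norm hL hC hsmul ((c - q) • u)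
    rw [norm_smul, Real.norm_eq_abs] at h3
    exact h1.trans (add_le_add h2 h3)
  have hlim : Tendsto (fun k : ℕ => (⌊c * (k + 1 : ℕ)⌋₊ / (k + 1 : ℕ) : ℝ)) atTop (𝓝 c) :=
    (tendsto_nat_floor_mul_div_atTop hc).comp
      (tendsto_natCast_atTop_atTop.comp (tendsto_add_atTop_nat 1))
  refine ge_of_tendsto' (?_ : Tendsto _ atTop (𝓝 _)) key
  have := (hlim.mul_const (lipExtend L C u)).add
    ((((hlim.const_sub c).abs).mul_const ‖u‖).const_mul C)
  simpa using this

/-- A subadditive, even, homogeneous function on the lattice with linear growth extends to a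
seminorm. -/
lemma exists_seminorm (hL : ∀ n, 0 ≤ L n) (hC : 0 ≤ C)
    (hadd : ∀ m n, L (m + n) ≤ L m + L n) (hneg : ∀ n, L (-n) ≤ L n)
    (hsmul : ∀ (j : ℕ) n, L (j • n) = j * L n) (hle : ∀ n, L n ≤ C * ‖n‖) :
    ∃ p : Seminorm ℝ (Fin d → ℝ), ∀ n : Fin d → ℤ, p (fun k => (n k : ℝ)) = L n := by
  refine ⟨Seminorm.ofSMulLE (lipExtend L C) (le_antisymm ?_ ?_)
    (lipExtend_add_le hL hC hadd hsmul) fun c u => ?_,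
    fun n => lipExtend_intCastVec hL hC hadd hsmul hle n⟩
  · simpa using lipExtend_le_norm hL hC hsmul (0 : Fin d → ℝ)
  · refine le_lipExtend fun k hk n => ?_
    have := hL n
    positivity
  · rcases le_total 0 c with hc | hc
    · rw [Real.norm_of_nonneg hc]
      exact lipExtend_smul_le hL hC hadd hsmul hc u
    · rw [Real.norm_of_nonpos hc]
      have h1 := lipExtend_neg_le hL hC hneg (-(c • u))
      rw [neg_neg, ← neg_smul] at h1
      exact h1.trans (lipExtend_smul_le hL hC hadd hsmul (neg_nonneg.2 hc) u)

end Extension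

lemma exists_nsmul_approx {d : ℕ} (n : Fin d → ℤ) {k Q : ℕ} (hk : 0 < k) (hn : ‖n‖ ≤ 2 * Q * k) :
    ∃ v : Fin d → ℤ, ‖v‖ ≤ 2 * Q ∧ ‖k • v - n‖ ≤ k := by
  have hk' : (0 : ℤ) < k := by exact_mod_cast hk
  refine ⟨fun i => n i / k, (pi_norm_le_iff_of_nonneg (by positivity)).2 fun i => ?_,
    (pi_norm_le_iff_of_nonneg (by positivity)).2 fun i => ?_⟩
  · have h1 : |n i| ≤ 2 * Q * k := by
      have := (norm_le_pi_norm n i).trans hn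
      rw [Int.norm_eq_abs] at this
      exact_mod_cast this
    rw [abs_le] at h1
    rw [Int.norm_eq_abs]
    suffices h : |n i / k| ≤ 2 * Q by exact_mod_cast h
    rw [abs_le, Int.le_ediv_iff_mul_le hk']
    refine ⟨by linarith, ?_⟩
    exact Int.ediv_le_of_le_mul hk' h1.2
  · rw [Int.norm_eq_abs]
    suffices h : |(k : ℤ) * (n i / k) - n i| ≤ k by
      simp only [Pi.sub_apply, nsmul_eq_mul]
      exact_mod_cast h
    have h1 := Int.emod_nonneg (n i) hk'.ne'
    have h2 := Int.emod_lt_of_pos (n i) hk'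
    have h3 := Int.mul_ediv_add_emod (n i) k
    rw [abs_le]
    constructor <;> linarith

/-- Convergence along every direction and the Lipschitz property at large scales give uniform
convergence. -/
lemma finite_setOf_le_abs_sub {d : ℕ} {r : (Fin d → ℤ) → (Fin d → ℤ) → ℝ} {L : (Fin d → ℤ) → ℝ}
    {C : ℝ} (hC : 0 ≤ C) (hsymm : ∀ m n, r m n = r n m) (htri : ∀ m k n, r m n ≤ r m k + r k n)
    (hr : AsympLipschitz r C) (hLip : ∀ m n, |L m - L n| ≤ C * ‖m - n‖)
    (hsmul : ∀ (j : ℕ) n, L (j • n) = j * L n)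
    (hlim : ∀ v, Tendsto (fun k : ℕ => r 0 (k • v) / k) atTop (𝓝 (L v))) {ε : ℝ} (hε : 0 < ε) :
    {n | ε * ‖n‖ ≤ |r 0 n - L n|}.Finite := by
  obtain ⟨c, hc⟩ := hr (ε / 8) (by positivity)
  obtain ⟨Q, hQ⟩ := exists_nat_ge (max 1 (8 * C / ε))
  rw [max_le_iff, div_le_iff₀ hε] at hQ
  have hQ0 : (0 : ℝ) < Q := by linarith [hQ.1]
  obtain ⟨K, hK⟩ : ∃ K : ℕ, ∀ k ≥ K, ∀ v ∈ box (0 : Fin d → ℤ) (2 * Q),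
      |r 0 (k • v) / k - L v| < ε / 8 := by
    refine eventually_atTop.1 ((Filter.eventually_all_finset _).2 fun v _ => ?_)
    have := (Metric.tendsto_nhds.1 (hlim v)) (ε / 8) (by positivity)
    simpa only [Real.dist_eq] using this
  obtain ⟨M, hM⟩ := exists_nat_gt (max ((Q : ℝ) * (K + 1)) (2 * c / ε))
  rw [max_lt_iff, div_lt_iff₀ hε] at hM
  refine (box (0 : Fin d → ℤ) M).finite_toSet.subset fun n hn => ?_
  rw [Finset.mem_coe, mem_box, sub_zero]
  by_contra! hnM
  rw [Set.mem_ofPred_eq] at hn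
  set k := ⌊‖n‖ / Q⌋₊ with hkdef
  have hkK : K + 1 ≤ k := by
    refine Nat.le_floor ?_
    rw [le_div_iff₀ hQ0]
    push_cast
    linarith [hM.1]
  have hk0 : 0 < k := by omega
  have hk1 : (1 : ℝ) ≤ k := by exact_mod_cast hk0
  have hkle : Q * (k : ℝ) ≤ ‖n‖ := by
    rw [← le_div_iff₀' hQ0]
    exact Nat.floor_le (by positivity)
  have hklt : ‖n‖ < (k + 1) * Q := by
    rw [← div_lt_iff₀ hQ0]
    exact Nat.lt_floor_add_one _
  obtain ⟨v, hv, hvn⟩ := exists_nsmul_approx n hk0 (Q := Q) (by nlinarith)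
  have hkv := hK k (by omega) v (by rw [mem_box, sub_zero]; exact_mod_cast hv)
  have h1 : |r 0 (k • v) - k * L v| ≤ ε / 8 * k := by
    have : r 0 (k • v) - k * L v = (r 0 (k • v) / k - L v) * k := by field_simp
    rw [this, abs_mul, Nat.abs_cast]
    gcongr
  have h2 : |r 0 n - r 0 (k • v)| ≤ C * ‖k • v - n‖ + ε / 8 * ‖n‖ + c := by
    have ha := hc (k • v) n
    have hb := htri 0 (k • v) n
    have hd := htri 0 n (k • v)
    rw [hsymm n] at hd
    rw [abs_le]
    constructor <;> linarith
  have h3 := hLip (k • v) n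
  rw [hsmul] at h3
  have h4 : C * ‖k • v - n‖ ≤ ε / 8 * ‖n‖ := by
    have : C * ‖k • v - n‖ ≤ C * k := by gcongr
    have : 8 * C * k ≤ Q * ε * k := mul_le_mul_of_nonneg_right hQ.2 k.cast_nonneg
    nlinarith
  have h5 : ε / 8 * k ≤ ε / 8 * ‖n‖ := by
    gcongr
    nlinarith [hQ.1]
  have h6 : |r 0 n - L n| ≤ |r 0 n - r 0 (k • v)| + |r 0 (k • v) - k * L v| +
      |k * L v - L n| := by
    refine le_trans (le_of_eq ?_) (abs_add_three _ _ _)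
    congr 1
    ring
  have h7 : ε * M < ε * ‖n‖ := by gcongr
  nlinarith [hM.2, mul_nonneg hε.le (norm_nonneg n)]

lemma norm_le_sum_abs {d : ℕ} (n : Fin d → ℤ) : ‖n‖ ≤ ∑ k, |(n k : ℝ)| := by
  refine (pi_norm_le_iff_of_nonneg (Finset.sum_nonneg fun _ _ => abs_nonneg _)).2 fun i => ?_
  rw [Int.norm_eq_abs]
  exact Finset.single_le_sum (f := fun k => |(n k : ℝ)|) (fun _ _ => abs_nonneg _)
    (Finset.mem_univ i)

lemma sum_abs_le_norm {d : ℕ} (n : Fin d → ℤ) : ∑ k, |(n k : ℝ)| ≤ d * ‖n‖ := by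
  have := Finset.sum_le_card_nsmul Finset.univ (fun k => |(n k : ℝ)|) ‖n‖ fun i _ => by
    rw [← Int.norm_eq_abs]; exact norm_le_pi_norm n i
  simpa using this

/-- A tail bound for the maximal function makes it finite almost everywhere. -/
lemma ae_exists_linear_bound_of_maximal {X : Type*} [MeasurableSpace X] {μ : Measure X} {d : ℕ}
    (hd : 1 ≤ d) {r : X → (Fin d → ℤ) → ℝ} (hr : ∀ x, r x 0 = 0) (C : ℝ)
    (hmax : ∀ lam : ℝ, 1 < lam →
      μ {x | ENNReal.ofReal lam ≤
          ⨆ n : {n : Fin d → ℤ // n ≠ 0},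
            ENNReal.ofReal (r x n.1 / ∑ k, |(n.1 k : ℝ)|)} ≤
        ENNReal.ofReal (C / lam ^ d)) :
    ∀ᵐ x ∂μ, ∃ K : ℕ, ∀ n, r x n ≤ K * ‖n‖ := by
  set S : ℕ → Set X := fun c => {x | ENNReal.ofReal ((c : ℝ) + 2) ≤
    ⨆ n : {n : Fin d → ℤ // n ≠ 0}, ENNReal.ofReal (r x n.1 / ∑ k, |(n.1 k : ℝ)|)} with hS
  have hlim : Tendsto (fun c => μ (S c)) atTop (𝓝 0) := by
    have h1 : Tendsto (fun c : ℕ => C / ((c : ℝ) + 2) ^ d) atTop (𝓝 0) :=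
      tendsto_const_nhds.div_atTop ((tendsto_pow_atTop (by omega)).comp
        (tendsto_atTop_add_const_right _ _ tendsto_natCast_atTop_atTop))
    have h2 := ENNReal.tendsto_ofReal h1
    rw [ENNReal.ofReal_zero] at h2
    refine tendsto_of_tendsto_of_tendsto_of_le_of_le tendsto_const_nhds h2 (fun _ => zero_le)
      fun c => hmax _ ?_
    have : (0 : ℝ) ≤ c := c.cast_nonneg
    linarith
  filter_upwards [ae_exists_notMem_of_tendsto_measure hlim] with x ⟨c, hc⟩
  simp only [hS, Set.mem_ofPred_eq, not_le] at hc
  refine ⟨(c + 2) * d, fun n => ?_⟩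
  rcases eq_or_ne n 0 with rfl | hn
  · rw [hr, norm_zero, mul_zero]
  · have hpos : 0 < ∑ k, |(n k : ℝ)| := (norm_pos_iff.2 hn).trans_le (norm_le_sum_abs n)
    have h1 := (le_iSup (fun n : {n : Fin d → ℤ // n ≠ 0} =>
      ENNReal.ofReal (r x n.1 / ∑ k, |(n.1 k : ℝ)|)) ⟨n, hn⟩).trans hc.le
    rw [ENNReal.ofReal_le_ofReal_iff (by positivity), div_le_iff₀ hpos] at h1
    push_cast
    refine h1.trans ?_
    rw [mul_assoc]
    have := sum_abs_le_norm n
    gcongr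

/-- The shape theorem for a random semimetric whose distances grow at most linearly. -/
theorem IsErgodicSemimetric.exists_seminorm_ae_finite {X : Type*} [MeasurableSpace X]
    {μ : Measure X} [IsProbabilityMeasure μ] {d : ℕ} {T : (Fin d → ℤ) → X → X}
    {ρ : X → (Fin d → ℤ) → (Fin d → ℤ) → ℝ} (h : IsErgodicSemimetric μ T ρ) (hzero : T 0 = id)
    (hfin : ∀ᵐ x ∂μ, ∃ K : ℕ, ∀ n, ρ x 0 n ≤ K * ‖n‖) :
    ∃ L : Seminorm ℝ (Fin d → ℝ), ∀ᵐ x ∂μ, ∀ ε > 0,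
      {n : Fin d → ℤ | ε * ‖n‖ ≤ |ρ x 0 n - L (fun k => (n k : ℝ))|}.Finite := by
  obtain ⟨C, hC, hb⟩ := h.exists_linear_bound hzero hfin
  choose L hL using h.exists_ae_tendsto hC hb
  have hle := limit_le hL hC hb
  have hadd := h.limit_add_le hL
  have hsmul := h.limit_nsmul hL
  obtain ⟨p, hp⟩ := exists_seminorm (h.limit_nonneg hL) hC hadd (h.limit_neg_le hL) hsmul hle
  refine ⟨p, ?_⟩
  filter_upwards [ae_all_iff.2 hL, h.ae_asympLipschitz hC hb] with x hx hxL ε hε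
  simp only [hp]
  refine finite_setOf_le_abs_sub hC (h.symm x) (h.tri x) hxL (fun m n => ?_) hsmul hx hε
  have h1 := hadd n (m - n)
  have h2 := hadd m (n - m)
  rw [add_sub_cancel] at h1 h2
  have h3 := hle (m - n)
  have h4 := hle (n - m)
  rw [norm_sub_rev] at h4
  rw [abs_le]
  constructor <;> linarith

end Boivin

/-- **Boivin's lemma.** If a random `ℤ^d`-semimetric `ρ` on an ergodic
`ℤ^d`-space satisfies the maximal-function tail bound
`μ{x : sup_{n ≠ 0} ρ_x(0,n)/|n| ≥ λ} ≤ C/λ^d` for all `λ > 1`, then there is a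
seminorm `L` on `ℝ^d` with `(ρ_x(0,n) - L(n))/|n| → 0` almost everywhere. -/
theorem statement4
    {X : Type*} [MeasurableSpace X] (μ : Measure X) [IsProbabilityMeasure μ]
    (d : ℕ) (hd : 1 ≤ d)
    (T : (Fin d → ℤ) → X → X)
    (hT0 : T 0 = id)
    (hTadd : ∀ n m : Fin d → ℤ, T (n + m) = T n ∘ T m)
    (hTmp : ∀ n : Fin d → ℤ, MeasurePreserving (T n) μ μ)
    (herg : ∀ A : Set X, MeasurableSet A → (∀ n : Fin d → ℤ, T n ⁻¹' A = A) →
      μ A = 0 ∨ μ A = 1)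
    (ρ : X → (Fin d → ℤ) → (Fin d → ℤ) → ℝ)
    (hρ_nonneg : ∀ x m n, 0 ≤ ρ x m n)
    (hρ_symm : ∀ x m n, ρ x m n = ρ x n m)
    (hρ_refl : ∀ x m, ρ x m m = 0)
    (hρ_tri : ∀ x m k n, ρ x m n ≤ ρ x m k + ρ x k n)
    (hρ_equiv : ∀ (x : X) (k m n : Fin d → ℤ), ρ (T k x) m n = ρ x (m + k) (n + k))
    (hρ_meas : ∀ m n, Measurable fun x => ρ x m n)
    (C : ℝ) (hC : 0 < C)
    (hmax : ∀ lam : ℝ, 1 < lam →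
      μ {x | ENNReal.ofReal lam ≤
          ⨆ n : {n : Fin d → ℤ // n ≠ 0},
            ENNReal.ofReal (ρ x 0 n.1 / ∑ k, |(n.1 k : ℝ)|)} ≤
        ENNReal.ofReal (C / lam ^ d)) :
    ∃ L : Seminorm ℝ (Fin d → ℝ), ∀ᵐ x ∂μ, ∀ ε > 0,
      {n : Fin d → ℤ |
        ε * (∑ k, |(n k : ℝ)|) ≤ |ρ x 0 n - L (fun k => (n k : ℝ))|}.Finite := by
  have h : Boivin.IsErgodicSemimetric μ T ρ :=
    { add := hTadd, mp := hTmp, erg := herg, nonneg := hρ_nonneg, symm := hρ_symm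
      refl := hρ_refl, tri := hρ_tri, equiv := hρ_equiv, meas := hρ_meas }
  obtain ⟨L, hL⟩ := h.exists_seminorm_ae_finite hT0
    (Boivin.ae_exists_linear_bound_of_maximal hd (fun x => hρ_refl x 0) C hmax)
  refine ⟨L, hL.mono fun x hx ε hε => (hx ε hε).subset fun n hn => ?_⟩
  exact (mul_le_mul_of_nonneg_left (Boivin.norm_le_sum_abs n) hε.le).trans hn
end
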